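/- Let (A,m) be a multiarrangement with a locally heavy hyperplane H_0 and m_0 = m(H_0). Then b_2(A,m) − m_0(|m| − m_0) ≥ b_2(A^{H_0}, m^{H_0}), where (A^{H_0}, m^{H_0}) is the Euler–Ziegler restriction. Moreover, (A,m) is free if and only if (A^{H_0}, m^{H_0}) is free and this inequality is an equality. -/

import Mathlib

open scoped Classical
open MvPolynomial

namespace ArrPaper

variable {K : Type*} [Field K] {ℓ : ℕ}

/-- The coordinate ring `S = K[x₁,…,x_ℓ]`. -/
noncomputable abbrev S (K : Type*) [Field K] (ℓ : ℕ) := MvPolynomial (Fin ℓ) K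

/-- The linear form associated to a covector `c`. -/
noncomputable def linForm (c : Fin ℓ → K) : S K ℓ :=
  ∑ i, MvPolynomial.C (c i) * MvPolynomial.X i

/-- The linear functional associated to a covector. -/
noncomputable def toFunc (c : Fin ℓ → K) : (Fin ℓ → K) →ₗ[K] K :=
  ∑ i, c i • LinearMap.proj i

/-- A (central) hyperplane arrangement, given by a finite set of nonzero,
pairwise non-proportional covectors (defining linear forms). -/
structure Arrangement (K : Type*) [Field K] (ℓ : ℕ) where
  hyps : Finset (Fin ℓ → K)
  ne_zero : ∀ c ∈ hyps, c ≠ 0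
  nonparallel : ∀ c ∈ hyps, ∀ c' ∈ hyps, c ≠ c' → ∀ t : K, c' ≠ t • c

/-- Derivations of the polynomial ring `S`. -/
abbrev Der (K : Type*) [Field K] (ℓ : ℕ) := Derivation K (S K ℓ) (S K ℓ)

/-- `θ` is a logarithmic derivation of the multiarrangement `(A, m)`, i.e.
`θ(α_H) ∈ α_H^{m(H)}·S` for all `H ∈ A`. -/
def IsLogDer (A : Arrangement K ℓ) (m : (Fin ℓ → K) → ℕ) (θ : Der K ℓ) : Prop :=
  ∀ c ∈ A.hyps, (linForm c) ^ (m c) ∣ θ (linForm c)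

/-- `θ` is homogeneous of polynomial degree `d`: `θ(α)` is homogeneous of degree `d`
for every linear form `α`. -/
def IsHomogOfDeg (θ : Der K ℓ) (d : ℕ) : Prop :=
  ∀ c : Fin ℓ → K, (θ (linForm c)).IsHomogeneous d

/-- `θ₁, …, θ_ℓ` form a basis of the `S`-module `D(A,m)`. -/
def IsDerBasis (A : Arrangement K ℓ) (m : (Fin ℓ → K) → ℕ) (θ : Fin ℓ → Der K ℓ) : Prop :=
  (∀ i, IsLogDer A m (θ i)) ∧
  ∀ η : Der K ℓ, IsLogDer A m η → ∃! f : Fin ℓ → S K ℓ, η = ∑ i, f i • θ i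

/-- `(A,m)` is free with a homogeneous basis of degrees (exponents) `d`. -/
def IsFreeWithExp (A : Arrangement K ℓ) (m : (Fin ℓ → K) → ℕ) (d : Fin ℓ → ℕ) : Prop :=
  ∃ θ : Fin ℓ → Der K ℓ, (∀ i, IsHomogOfDeg (θ i) (d i)) ∧ IsDerBasis A m θ

/-- `(A,m)` is a free multiarrangement. -/
def IsFree (A : Arrangement K ℓ) (m : (Fin ℓ → K) → ℕ) : Prop :=
  ∃ d : Fin ℓ → ℕ, IsFreeWithExp A m d

/-- `|m|`, the total multiplicity. -/
def msum (A : Arrangement K ℓ) (m : (Fin ℓ → K) → ℕ) : ℕ := ∑ c ∈ A.hyps, m c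

/-- The rank of an arrangement: the dimension of the span of its covectors. -/
noncomputable def rank (A : Arrangement K ℓ) : ℕ :=
  Module.finrank K (Submodule.span K (A.hyps : Set (Fin ℓ → K)))

/-- `A` is reducible: after a linear change of coordinates it is a product of two
arrangements in complementary (nonzero) subspaces.  In terms of covectors: the
covectors split between two complementary nonzero subspaces of the dual space. -/
def Reducible (A : Arrangement K ℓ) : Prop :=
  ∃ W₁ W₂ : Submodule K (Fin ℓ → K), W₁ ≠ ⊥ ∧ W₂ ≠ ⊥ ∧ W₁ ⊓ W₂ = ⊥ ∧ W₁ ⊔ W₂ = ⊤ ∧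
    ∀ c ∈ A.hyps, c ∈ W₁ ∨ c ∈ W₂

/-- The hyperplanes of the localization at a flat; the flat of codimension `r` is
encoded by the `r`-dimensional subspace `U` of the dual space spanned by the
covectors of the hyperplanes containing it. -/
noncomputable def locHyps (A : Arrangement K ℓ) (U : Submodule K (Fin ℓ → K)) :
    Finset (Fin ℓ → K) :=
  A.hyps.filter (· ∈ U)

/-- `U` encodes a flat of `A` of codimension `r` (an element of `L_r(A)`). -/
def IsFlatOfRank (A : Arrangement K ℓ) (U : Submodule K (Fin ℓ → K)) (r : ℕ) : Prop :=
  Module.finrank K U = r ∧ Submodule.span K (locHyps A U : Set (Fin ℓ → K)) = U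

/-- The localization `A_X` of `A` at the flat encoded by `U`. -/
noncomputable def localize (A : Arrangement K ℓ) (U : Submodule K (Fin ℓ → K)) :
    Arrangement K ℓ where
  hyps := locHyps A U
  ne_zero := fun c hc => A.ne_zero c (Finset.mem_filter.mp hc).1
  nonparallel := fun c hc c' hc' =>
    A.nonparallel c (Finset.mem_filter.mp hc).1 c' (Finset.mem_filter.mp hc').1

/-- `H₀` (given by covector `c₀`) is a heavy hyperplane of `(A,m)`. -/
def IsHeavy (A : Arrangement K ℓ) (m : (Fin ℓ → K) → ℕ) (c₀ : Fin ℓ → K) : Prop :=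
  c₀ ∈ A.hyps ∧ (∑ c ∈ A.hyps.erase c₀, m c) ≤ m c₀

/-- `H₀` (given by covector `c₀`) is a locally heavy hyperplane of `(A,m)`. -/
def IsLocallyHeavy (A : Arrangement K ℓ) (m : (Fin ℓ → K) → ℕ) (c₀ : Fin ℓ → K) : Prop :=
  c₀ ∈ A.hyps ∧ ∀ U : Submodule K (Fin ℓ → K), IsFlatOfRank A U 2 → c₀ ∈ U →
    3 ≤ (locHyps A U).card → (∑ c ∈ (locHyps A U).erase c₀, m c) ≤ m c₀

/-- `b` is the second Betti number of the rank-2 localization of `(A,m)` at `U`: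
the product of the nonzero exponents of this free rank-2 multiarrangement. -/
def IsLocalB2 (A : Arrangement K ℓ) (m : (Fin ℓ → K) → ℕ)
    (U : Submodule K (Fin ℓ → K)) (b : ℕ) : Prop :=
  ∃ d : Fin ℓ → ℕ, IsFreeWithExp (localize A U) m d ∧
    b = ∏ i ∈ Finset.univ.filter (fun i => d i ≠ 0), d i

/-- `b` is the second Betti number `b₂(A,m)` of the multiarrangement `(A,m)`. -/
def IsB2 (A : Arrangement K ℓ) (m : (Fin ℓ → K) → ℕ) (b : ℕ) : Prop :=
  ∃ bloc : Submodule K (Fin ℓ → K) → ℕ,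
    (∀ U, IsFlatOfRank A U 2 → IsLocalB2 A m U (bloc U)) ∧
    b = ∑ᶠ U ∈ {U : Submodule K (Fin ℓ → K) | IsFlatOfRank A U 2}, bloc U

/-- The second Betti number of a simple arrangement:
`b₂(A) = Σ_{X ∈ L₂(A)} (|A_X| - 1)`. -/
noncomputable def b2Simple (A : Arrangement K ℓ) : ℕ :=
  ∑ᶠ U ∈ {U : Submodule K (Fin ℓ → K) | IsFlatOfRank A U 2}, ((locHyps A U).card - 1)

/-- The Euler–Ziegler multiplicity of the restricted hyperplane `H₀ ∩ ker(c)` of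
`A^{H₀}`: `m^{H₀}(X) = |m_X| - m(H₀)`. -/
noncomputable def EZmult (A : Arrangement K ℓ) (m : (Fin ℓ → K) → ℕ)
    (c₀ c : Fin ℓ → K) : ℕ :=
  (∑ c' ∈ A.hyps.filter (· ∈ Submodule.span K ({c₀, c} : Set (Fin ℓ → K))), m c') - m c₀

/-- Two covectors are parallel (define the same hyperplane). -/
def Parallel {n : ℕ} (b b' : Fin n → K) : Prop := ∃ t : K, t ≠ 0 ∧ b' = t • b

/-- The covector on `K^n` obtained by restricting the covector `c` on `K^{n+1}` to the
hyperplane `ker c₀`, transported by the linear isomorphism `e : ker c₀ ≃ K^n`. -/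
noncomputable def resCov {n : ℕ} (c₀ : Fin (n+1) → K)
    (e : ↥(LinearMap.ker (toFunc c₀)) ≃ₗ[K] (Fin n → K)) (c : Fin (n+1) → K) :
    Fin n → K :=
  fun j => toFunc c ((e.symm (Pi.single j 1) : ↥(LinearMap.ker (toFunc c₀))) : Fin (n+1) → K)

/-- `(B, mB)` is (a model, in coordinates, of) the Euler–Ziegler restriction
`(A^{H₀}, m^{H₀})` of `(A,m)` to the hyperplane `H₀ = ker c₀ ∈ A`. -/
def IsEZRes {n : ℕ} (A : Arrangement K (n+1)) (m : (Fin (n+1) → K) → ℕ)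
    (c₀ : Fin (n+1) → K) (B : Arrangement K n) (mB : (Fin n → K) → ℕ) : Prop :=
  c₀ ∈ A.hyps ∧
  ∃ e : ↥(LinearMap.ker (toFunc c₀)) ≃ₗ[K] (Fin n → K),
    (∀ c ∈ A.hyps.erase c₀, ∃ b ∈ B.hyps,
        Parallel b (resCov c₀ e c) ∧ mB b = EZmult A m c₀ c) ∧
    (∀ b ∈ B.hyps, ∃ c ∈ A.hyps.erase c₀, Parallel b (resCov c₀ e c))

/-- A combinatorial equivalence between two arrangements: a bijection between the
hyperplanes inducing an isomorphism of intersection lattices (it preserves the rank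
of every subset of hyperplanes). -/
def CombEquiv (A A' : Arrangement K ℓ) : Prop :=
  ∃ φ : (Fin ℓ → K) → (Fin ℓ → K), Set.BijOn φ ↑A.hyps ↑A'.hyps ∧
    ∀ T : Finset (Fin ℓ → K), T ⊆ A.hyps →
      Module.finrank K (Submodule.span K (T : Set (Fin ℓ → K))) =
      Module.finrank K (Submodule.span K ((T.image φ) : Set (Fin ℓ → K)))

/-- Pairing of a covector with a vector of elements of a `K`-algebra. -/
def ev {R : Type*} [CommRing R] [Algebra K R] {r : ℕ} (c : Fin r → K) (θ : Fin r → R) : R :=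
  ∑ j, c j • θ j

section ev
variable {R R' : Type*} [CommRing R] [Algebra K R] [CommRing R'] [Algebra K R'] {r : ℕ}

lemma ev_add (c : Fin r → K) (θ η : Fin r → R) : ev c (θ + η) = ev c θ + ev c η := by
  simp [ev, smul_add, Finset.sum_add_distrib]

lemma ev_sub (c : Fin r → K) (θ η : Fin r → R) : ev c (θ - η) = ev c θ - ev c η := by
  simp [ev, smul_sub, Finset.sum_sub_distrib]

@[simp] lemma ev_zero (c : Fin r → K) : ev c (0 : Fin r → R) = 0 := by simp [ev]

@[simp] lemma zero_ev (θ : Fin r → R) : ev (0 : Fin r → K) θ = 0 := by simp [ev]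

lemma ev_smul (c : Fin r → K) (g : R) (θ : Fin r → R) : ev c (g • θ) = g * ev c θ := by
  simp [ev, Finset.mul_sum]

lemma ev_sum {ι : Type*} (s : Finset ι) (c : Fin r → K) (θ : ι → Fin r → R) :
    ev c (∑ i ∈ s, θ i) = ∑ i ∈ s, ev c (θ i) := by
  simp only [ev, Finset.sum_apply, Finset.smul_sum]
  exact Finset.sum_comm

lemma add_ev (c c' : Fin r → K) (θ : Fin r → R) : ev (c + c') θ = ev c θ + ev c' θ := by
  simp [ev, add_smul, Finset.sum_add_distrib]

lemma sum_ev {ι : Type*} (s : Finset ι) (c : ι → Fin r → K) (θ : Fin r → R) :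
    ev (∑ i ∈ s, c i) θ = ∑ i ∈ s, ev (c i) θ := by
  simp only [ev, Finset.sum_apply, Finset.sum_smul]
  exact Finset.sum_comm

lemma smul_ev (u : K) (c : Fin r → K) (θ : Fin r → R) : ev (u • c) θ = u • ev c θ := by
  simp [ev, mul_smul, Finset.smul_sum]

lemma map_ev (f : R →ₐ[K] R') (c : Fin r → K) (θ : Fin r → R) :
    f (ev c θ) = ev c (fun j => f (θ j)) := by
  simp [ev]

lemma ev_cons (a : K) (c : Fin r → K) (θ : Fin (r + 1) → R) :
    ev (Fin.cons a c : Fin (r + 1) → K) θ = a • θ 0 + ev c (fun j => θ j.succ) := by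
  simp [ev, Fin.sum_univ_succ]

/-- If `p` divides the pairing of every row with a nonzero covector, it divides the determinant. -/
lemma dvd_det_of_dvd_ev {c : Fin r → K} (hc : c ≠ 0) (N : Matrix (Fin r) (Fin r) R) {p : R}
    (h : ∀ i, p ∣ ev c (N i)) : p ∣ N.det := by
  obtain ⟨j, hj⟩ : ∃ j, c j ≠ 0 := by
    by_contra hh
    push Not at hh
    exact hc (funext hh)
  let v : Fin r → R := fun j => algebraMap K R (c j)
  have hv : ∀ i, N.mulVec v i = ev c (N i) := fun i => by
    simp [Matrix.mulVec, dotProduct, ev, v, Algebra.smul_def, mul_comm]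
  have h1 : N.det • v = N.adjugate.mulVec (N.mulVec v) := by
    rw [Matrix.mulVec_mulVec, Matrix.adjugate_mul, Matrix.smul_mulVec, Matrix.one_mulVec]
  have h2 : p ∣ N.det * algebraMap K R (c j) := by
    have := congrFun h1 j
    simp only [Pi.smul_apply, smul_eq_mul] at this
    rw [show algebraMap K R (c j) = v j from rfl, this]
    change p ∣ ∑ i, N.adjugate j i * N.mulVec v i
    refine Finset.dvd_sum fun i _ => ?_
    rw [hv]
    exact (h i).mul_left _
  have h3 : N.det = N.det * algebraMap K R (c j) * algebraMap K R (c j)⁻¹ := by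
    rw [mul_assoc, ← map_mul, mul_inv_cancel₀ hj, map_one, mul_one]
  rw [h3]
  exact h2.mul_right _

end ev

section linForm
variable {r : ℕ}

lemma linForm_eq_ev (c : Fin r → K) : linForm c = ev c (X : Fin r → S K r) := by
  simp [linForm, ev, MvPolynomial.smul_eq_C_mul]

lemma linForm_add (c c' : Fin r → K) : linForm (c + c') = linForm c + linForm c' := by
  simp [linForm_eq_ev, add_ev]

lemma linForm_smul (u : K) (c : Fin r → K) : linForm (u • c) = C u * linForm c := by
  simp [linForm_eq_ev, smul_ev, MvPolynomial.smul_eq_C_mul]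

@[simp] lemma linForm_zero : linForm (0 : Fin r → K) = 0 := by simp [linForm]

lemma linForm_isHomogeneous (c : Fin r → K) : (linForm c).IsHomogeneous 1 := by
  refine IsHomogeneous.sum _ _ _ fun i _ => ?_
  simpa using (isHomogeneous_C (Fin r) (c i)).mul (isHomogeneous_X K i)

lemma linForm_single (i : Fin r) : linForm (Pi.single i (1 : K)) = X i := by
  simp [linForm, Pi.single_apply, ite_mul]

/-- The affine form with linear part `c` and constant term `a`. -/
noncomputable def aff (c : Fin r → K) (a : K) : S K r := linForm c + C a

lemma aff_zero (c : Fin r → K) : aff c 0 = linForm c := by simp [aff]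

lemma coeff_single_aff (c : Fin r → K) (a : K) (i : Fin r) :
    coeff (Finsupp.single i 1) (aff c a) = c i := by
  have h0 : (0 : Fin r →₀ ℕ) ≠ Finsupp.single i 1 := fun h => by
    simpa using DFunLike.congr_fun h i
  simp [aff, linForm, coeff_sum, coeff_C_mul, coeff_X, coeff_C, h0,
    Finsupp.single_left_inj (one_ne_zero)]

lemma coeff_zero_aff (c : Fin r → K) (a : K) : coeff 0 (aff c a) = a := by
  simp [aff, linForm, coeff_sum]

lemma aff_injective {c c' : Fin r → K} {a a' : K} (h : aff c a = aff c' a') :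
    c = c' ∧ a = a' := by
  refine ⟨funext fun i => ?_, ?_⟩
  · rw [← coeff_single_aff c a, h, coeff_single_aff]
  · rw [← coeff_zero_aff c a, h, coeff_zero_aff]

lemma totalDegree_aff_le (c : Fin r → K) (a : K) : (aff c a).totalDegree ≤ 1 := by
  refine (totalDegree_add _ _).trans ?_
  simp [(linForm_isHomogeneous c).totalDegree_le]

lemma aff_ne_zero {c : Fin r → K} (hc : c ≠ 0) (a : K) : aff c a ≠ 0 := fun h => hc
  (aff_injective (c' := 0) (a' := 0) (h.trans (by simp [aff]))).1

lemma linForm_ne_zero {c : Fin r → K} (hc : c ≠ 0) : linForm c ≠ 0 :=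
  aff_zero c ▸ aff_ne_zero hc 0

lemma totalDegree_aff {c : Fin r → K} (hc : c ≠ 0) (a : K) : (aff c a).totalDegree = 1 := by
  refine le_antisymm (totalDegree_aff_le c a) ?_
  obtain ⟨i, hi⟩ := Function.ne_iff.mp hc
  have := le_totalDegree (p := aff c a) (s := Finsupp.single i 1)
    (by rw [mem_support_iff, coeff_single_aff]; exact hi)
  simpa using this

lemma prime_aff {c : Fin r → K} (hc : c ≠ 0) (a : K) : Prime (aff c a) := by
  refine Irreducible.prime (irreducible_of_totalDegree_eq_one (totalDegree_aff hc a) fun x hx => ?_)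
  obtain ⟨i, hi⟩ := Function.ne_iff.mp hc
  have := hx (Finsupp.single i 1)
  rw [coeff_single_aff] at this
  refine IsUnit.mk0 x ?_
  rintro rfl
  exact hi (zero_dvd_iff.mp this)

lemma prime_linForm {c : Fin r → K} (hc : c ≠ 0) : Prime (linForm c) :=
  aff_zero c ▸ prime_aff hc 0

lemma exists_smul_of_aff_dvd {c c' : Fin r → K} {a a' : K} (hc : c ≠ 0)
    (h : aff c a ∣ aff c' a') : ∃ u : K, c' = u • c ∧ a' = u * a := by
  by_cases h0 : aff c' a' = 0
  · refine ⟨0, ?_⟩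
    obtain ⟨h1, h2⟩ := aff_injective (c' := 0) (a' := 0) (h0.trans (by simp [aff]))
    simp [h1, h2]
  obtain ⟨q, hq⟩ := h
  have hq0 : q ≠ 0 := by rintro rfl; simp at hq; exact h0 hq
  have h1 := totalDegree_mul_of_isDomain (aff_ne_zero hc a) hq0
  rw [← hq, totalDegree_aff hc] at h1
  have h2 := totalDegree_aff_le c' a'
  have h3 : q.totalDegree = 0 := by omega
  rw [totalDegree_eq_zero_iff_eq_C] at h3
  generalize coeff 0 q = u at h3
  refine ⟨u, aff_injective ?_⟩
  rw [hq, h3, aff, aff, linForm_smul, C_mul]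
  ring

lemma isRelPrime_pow_aff {c c' : Fin r → K} {a a' : K} (hc : c ≠ 0)
    (h : ∀ u : K, c' = u • c → a' ≠ u * a) (m m' : ℕ) :
    IsRelPrime (aff c a ^ m) (aff c' a' ^ m') := by
  refine IsRelPrime.pow ((prime_aff hc a).irreducible.isRelPrime_iff_not_dvd.mpr fun hd => ?_)
  obtain ⟨u, h1, h2⟩ := exists_smul_of_aff_dvd hc hd
  exact h u h1 h2

lemma isRelPrime_pow_linForm {c c' : Fin r → K} (hc : c ≠ 0)
    (h : ∀ u : K, c' ≠ u • c) (m m' : ℕ) :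
    IsRelPrime (linForm c ^ m) (linForm c' ^ m') := by
  rw [← aff_zero c, ← aff_zero c']
  exact isRelPrime_pow_aff hc (fun u hu => absurd hu (h u)) m m'

/-- A family of covectors that are nonzero and pairwise nonparallel on a finite set. -/
def NP {ι : Type*} (s : Finset ι) (a : ι → Fin r → K) : Prop :=
  (∀ h ∈ s, a h ≠ 0) ∧ ∀ h ∈ s, ∀ h' ∈ s, h ≠ h' → ∀ u : K, a h' ≠ u • a h

lemma NP.mono {ι : Type*} {s s' : Finset ι} {a : ι → Fin r → K} (h : NP s a) (hs : s' ⊆ s) :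
    NP s' a :=
  ⟨fun i hi => h.1 i (hs hi), fun i hi j hj => h.2 i (hs hi) j (hs hj)⟩

lemma NP.prod_dvd {ι : Type*} {s : Finset ι} {a : ι → Fin r → K} (hs : NP s a) (m : ι → ℕ)
    {p : S K r} (h : ∀ i ∈ s, linForm (a i) ^ m i ∣ p) : ∏ i ∈ s, linForm (a i) ^ m i ∣ p :=
  Finset.prod_dvd_of_isRelPrime (fun i hi j hj hij =>
    isRelPrime_pow_linForm (hs.1 i hi) (hs.2 i hi j hj hij) _ _) h

end linForm

section exponents
variable {r : ℕ} {ι ι' : Type*}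

/-- Logarithmic vector fields of a weighted family of linear forms. -/
def LD (s : Finset ι) (a : ι → Fin r → K) (m : ι → ℕ) : Submodule (S K r) (Fin r → S K r) where
  carrier := {θ | ∀ h ∈ s, linForm (a h) ^ m h ∣ ev (a h) θ}
  zero_mem' := fun h _ => by simp
  add_mem' := fun {x y} hx hy h hh => by rw [ev_add]; exact dvd_add (hx h hh) (hy h hh)
  smul_mem' := fun g x hx h hh => by rw [ev_smul]; exact (hx h hh).mul_left _

lemma mem_LD {s : Finset ι} {a : ι → Fin r → K} {m : ι → ℕ} {θ : Fin r → S K r} :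
    θ ∈ LD s a m ↔ ∀ h ∈ s, linForm (a h) ^ m h ∣ ev (a h) θ := Iff.rfl

/-- The weighted defining polynomial of a family of linear forms. -/
noncomputable def defPoly (s : Finset ι) (a : ι → Fin r → K) (m : ι → ℕ) : S K r :=
  ∏ h ∈ s, linForm (a h) ^ m h

/-- A weighted family of linear forms admits homogeneous independent logarithmic vector fields of
the correct total degree. -/
def HasExp (s : Finset ι) (a : ι → Fin r → K) (m : ι → ℕ) (d : Fin r → ℕ) : Prop :=
  ∑ i, d i = ∑ h ∈ s, m h ∧ ∃ θ : Matrix (Fin r) (Fin r) (S K r),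
    (∀ i, θ i ∈ LD s a m) ∧ (∀ i j, (θ i j).IsHomogeneous (d i)) ∧ θ.det ≠ 0

lemma defPoly_isHomogeneous (s : Finset ι) (a : ι → Fin r → K) (m : ι → ℕ) :
    (defPoly s a m).IsHomogeneous (∑ h ∈ s, m h) :=
  IsHomogeneous.prod _ _ _ fun h _ => by simpa using (linForm_isHomogeneous (a h)).pow (m h)

lemma defPoly_ne_zero {s : Finset ι} {a : ι → Fin r → K} (hs : ∀ h ∈ s, a h ≠ 0) (m : ι → ℕ) :
    defPoly s a m ≠ 0 :=
  Finset.prod_ne_zero_iff.mpr fun h hh => pow_ne_zero _ (linForm_ne_zero (hs h hh))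

lemma det_isHomogeneous {n : ℕ} {θ : Matrix (Fin n) (Fin n) (S K r)} {d : Fin n → ℕ}
    (h : ∀ i j, (θ i j).IsHomogeneous (d i)) : θ.det.IsHomogeneous (∑ i, d i) := by
  rw [← Matrix.det_transpose, Matrix.det_apply]
  refine IsHomogeneous.sum _ _ _ fun σ _ => ?_
  have h1 : (∏ i, θ.transpose (σ i) i).IsHomogeneous (∑ i, d i) :=
    IsHomogeneous.prod _ _ _ fun i _ => h i (σ i)
  rcases Int.units_eq_one_or (Equiv.Perm.sign σ) with hs | hs <;> rw [hs]
  · simpa using h1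
  · simpa using h1.neg

lemma defPoly_dvd_det {s : Finset ι} {a : ι → Fin r → K} {m : ι → ℕ} (hs : NP s a)
    {θ : Matrix (Fin r) (Fin r) (S K r)} (h : ∀ i, θ i ∈ LD s a m) : defPoly s a m ∣ θ.det :=
  hs.prod_dvd m fun k hk => dvd_det_of_dvd_ev (hs.1 k hk) θ fun i => h i k hk

lemma exists_C_mul_of_dvd {p q : S K r} {d : ℕ} (hp : p.IsHomogeneous d) (hq : q.IsHomogeneous d)
    (hp0 : p ≠ 0) (h : q ∣ p) : ∃ c : K, c ≠ 0 ∧ p = C c * q := by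
  obtain ⟨f, rfl⟩ := h
  have hq0 : q ≠ 0 := left_ne_zero_of_mul hp0
  have hf0 : f ≠ 0 := right_ne_zero_of_mul hp0
  have h1 := totalDegree_mul_of_isDomain hq0 hf0
  rw [hp.totalDegree hp0, hq.totalDegree hq0] at h1
  have h3 : f.totalDegree = 0 := by omega
  rw [totalDegree_eq_zero_iff_eq_C] at h3
  refine ⟨coeff 0 f, fun h => hf0 (by rw [h3, h, C_0]), ?_⟩
  rw [mul_comm, ← h3]

lemma det_eq_C_mul_defPoly {s : Finset ι} {a : ι → Fin r → K} {m : ι → ℕ} {d : Fin r → ℕ}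
    (hs : NP s a) (hd : ∑ i, d i = ∑ h ∈ s, m h)
    {θ : Matrix (Fin r) (Fin r) (S K r)} (h : ∀ i, θ i ∈ LD s a m)
    (hh : ∀ i j, (θ i j).IsHomogeneous (d i)) (h0 : θ.det ≠ 0) :
    ∃ c : K, c ≠ 0 ∧ θ.det = C c * defPoly s a m :=
  exists_C_mul_of_dvd (det_isHomogeneous hh) (hd ▸ defPoly_isHomogeneous s a m) h0
    (defPoly_dvd_det hs h)

lemma det_smul_eq_sum_updateRow {R : Type*} [CommRing R] {n : ℕ} (N : Matrix (Fin n) (Fin n) R)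
    (b : Fin n → R) : N.det • b = ∑ i, (N.updateRow i b).det • N i := by
  have h := Matrix.mulVec_cramer N.transpose b
  rw [Matrix.det_transpose] at h
  rw [← h]
  ext j
  simp [Matrix.mulVec, dotProduct, Matrix.cramer_transpose_apply, mul_comm]

/-- Cramer's rule: if the determinant divides all the modified determinants, the vector is a
combination of the rows. -/
lemma exists_combination_of_det {n : ℕ} {q : S K r} {c : K} (hc : c ≠ 0) (hq : q ≠ 0)
    {N : Matrix (Fin n) (Fin n) (S K r)} (hN : N.det = C c * q) (b : Fin n → S K r)
    (hb : ∀ i, q ∣ (N.updateRow i b).det) : ∃ f : Fin n → S K r, b = ∑ i, f i • N i := by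
  choose g hg using hb
  refine ⟨fun i => C c⁻¹ * g i, ?_⟩
  have h := det_smul_eq_sum_updateRow N b
  have h2 : (C c * q) • (b - ∑ i, (C c⁻¹ * g i) • N i) = 0 := by
    rw [smul_sub, ← hN, h, sub_eq_zero, Finset.smul_sum]
    refine Finset.sum_congr rfl fun i _ => ?_
    rw [hg, smul_smul, hN]
    congr 1
    have : (C c * C c⁻¹ : S K r) = 1 := by rw [← C_mul, mul_inv_cancel₀ hc, C_1]
    linear_combination (-q * g i) * this
  have h3 : (C c * q : S K r) ≠ 0 := mul_ne_zero (by simpa using hc) hq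
  rw [smul_eq_zero] at h2
  exact sub_eq_zero.mp (h2.resolve_left h3)

lemma updateRow_mem {n : ℕ} {R : Type*} [CommRing R] {M : Submodule R (Fin n → R)}
    {N : Matrix (Fin n) (Fin n) R} (hN : ∀ i, N i ∈ M) {b : Fin n → R} (hb : b ∈ M) (i j : Fin n) :
    N.updateRow i b j ∈ M := by
  rcases eq_or_ne j i with rfl | h
  · rwa [Matrix.updateRow_self]
  · rw [Matrix.updateRow_ne h]; exact hN j

lemma exists_combination_of_mem_LD {s : Finset ι} {a : ι → Fin r → K} {m : ι → ℕ} {c : K}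
    (hs : NP s a) (hc : c ≠ 0) {θ : Matrix (Fin r) (Fin r) (S K r)} (h : ∀ i, θ i ∈ LD s a m)
    (hdet : θ.det = C c * defPoly s a m) {b : Fin r → S K r} (hb : b ∈ LD s a m) :
    ∃ f : Fin r → S K r, b = ∑ i, f i • θ i :=
  exists_combination_of_det hc (defPoly_ne_zero hs.1 m) hdet b fun i =>
    defPoly_dvd_det hs fun j => updateRow_mem h hb i j

lemma det_dvd_of_mem_span {R : Type*} [CommRing R] {n : ℕ} {θ F : Matrix (Fin n) (Fin n) R}
    (h : ∀ i, ∃ f : Fin n → R, F i = ∑ k, f k • θ k) : θ.det ∣ F.det := by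
  choose G hG using h
  have : F = (Matrix.of G) * θ := by
    ext i j
    rw [hG]
    simp [Matrix.mul_apply]
  rw [this, Matrix.det_mul]
  exact dvd_mul_left _ _

/-- The cofactor of a generating system of logarithmic vector fields is a unit. -/
lemma isUnit_of_span_LD {s : Finset ι} {a : ι → Fin r → K} {m : ι → ℕ} (hs : NP s a)
    {θ : Matrix (Fin r) (Fin r) (S K r)}
    (hspan : ∀ b ∈ LD s a m, ∃ f : Fin r → S K r, b = ∑ k, f k • θ k)
    {f : S K r} (hf : θ.det = defPoly s a m * f) : IsUnit f := by
  have hQ0 := defPoly_ne_zero hs.1 m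
  have key1 : f ∣ defPoly s a m ^ r := by
    have h1 : θ.det ∣ (defPoly s a m • (1 : Matrix (Fin r) (Fin r) (S K r))).det := by
      refine det_dvd_of_mem_span fun i => hspan _ fun h hh => ?_
      have : (defPoly s a m • (1 : Matrix (Fin r) (Fin r) (S K r))) i
        = defPoly s a m • (1 : Matrix (Fin r) (Fin r) (S K r)) i := rfl
      rw [this, ev_smul]
      exact (Finset.dvd_prod_of_mem _ hh).mul_right _
    rw [Matrix.det_smul, Matrix.det_one, mul_one, Fintype.card_fin] at h1
    exact (Dvd.intro_left _ hf.symm).trans h1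
  have key2 : ∀ h ∈ s, f ∣ (∏ k ∈ s.erase h, linForm (a k) ^ m k) ^ r := by
    intro h hh
    set g := ∏ k ∈ s.erase h, linForm (a k) ^ m k with hg
    have hQ : defPoly s a m = linForm (a h) ^ m h * g := (Finset.mul_prod_erase s _ hh).symm
    obtain ⟨j, hj⟩ : ∃ j, a h j ≠ 0 := Function.ne_iff.mp (hs.1 h hh)
    let D : Matrix (Fin r) (Fin r) (S K r) :=
      Matrix.diagonal fun i => if i = j then g * linForm (a h) ^ m h else g
    let w : Fin r → S K r := fun i => if i = j then 1 else -C (a h i / a h j)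
    let E : Matrix (Fin r) (Fin r) (S K r) := (1 : Matrix (Fin r) (Fin r) (S K r)).updateCol j w
    have hE : E.det = 1 := by
      rw [← Matrix.cramer_apply, Matrix.cramer_one]
      simp [w]
    have hD : D.det = g ^ r * linForm (a h) ^ m h := by
      rw [Matrix.det_diagonal, ← Finset.mul_prod_erase _ _ (Finset.mem_univ j)]
      rw [Finset.prod_congr rfl (g := fun _ => g) fun i hi => if_neg (Finset.ne_of_mem_erase hi)]
      rw [if_pos rfl, Finset.prod_const, Finset.card_erase_of_mem (Finset.mem_univ j),
        Finset.card_univ, Fintype.card_fin]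
      have hr : g ^ r = g ^ (r - 1) * g := (pow_sub_one_mul (by have := j.pos; omega) g).symm
      rw [hr]
      ring
    have hrow : ∀ i, (D * E) i = (if i = j then g * linForm (a h) ^ m h else g) • E i := by
      intro i
      ext k
      simp [D, Matrix.diagonal_mul]
    have hev : ∀ i, i ≠ j → ev (a h) (E i) = 0 := by
      intro i hi
      have : ∀ k, E i k = if k = j then w i else if k = i then 1 else 0 := by
        intro k
        simp [E, Matrix.updateCol_apply, Matrix.one_apply, eq_comm]
      simp only [ev, this]
      rw [← Finset.add_sum_erase _ _ (Finset.mem_univ j),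
        ← Finset.add_sum_erase _ _ (Finset.mem_erase.mpr ⟨hi, Finset.mem_univ i⟩),
        Finset.sum_eq_zero]
      · simp only [if_true, if_neg hi, w, smul_eq_C_mul, mul_one, add_zero]
        rw [mul_neg, ← C_mul, mul_div_cancel₀ _ hj]
        ring
      · intro k hk
        simp only [Finset.mem_erase] at hk
        simp [hk.1, hk.2.1]
    have h1 : θ.det ∣ (D * E).det := by
      refine det_dvd_of_mem_span fun i => hspan _ fun k hk => ?_
      rw [hrow, ev_smul]
      by_cases hkh : k = h
      · subst hkh
        by_cases hi : i = j
        · rw [if_pos hi]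
          exact (Dvd.intro_left _ rfl).mul_right _
        · rw [hev i hi, mul_zero]; exact dvd_zero _
      · have : linForm (a k) ^ m k ∣ g :=
          Finset.dvd_prod_of_mem (fun k => linForm (a k) ^ m k) (Finset.mem_erase.mpr ⟨hkh, hk⟩)
        refine Dvd.dvd.mul_right ?_ _
        split_ifs
        · exact this.mul_right _
        · exact this
    rw [Matrix.det_mul, hE, mul_one, hD, hf, hQ] at h1
    have h2 : linForm (a h) ^ m h * f ∣ linForm (a h) ^ m h * g ^ r := by
      refine (Dvd.intro_left g ?_).trans (h1.trans (dvd_of_eq (mul_comm _ _)))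
      ring
    exact (mul_dvd_mul_iff_left (pow_ne_zero _ (linForm_ne_zero (hs.1 h hh)))).mp h2
  by_contra hu
  have hf0 : f ≠ 0 := by
    rintro rfl
    exact pow_ne_zero r hQ0 (zero_dvd_iff.mp key1)
  obtain ⟨p, hp, hpf⟩ := WfDvdMonoid.exists_irreducible_factor hu hf0
  have hp := hp.prime
  obtain ⟨h, hh, hph⟩ := (hp.dvd_finsetProd_iff _).mp (hp.dvd_of_dvd_pow (hpf.trans key1))
  have hph := hp.dvd_of_dvd_pow hph
  obtain ⟨k, hk, hpk⟩ := (hp.dvd_finsetProd_iff _).mp (hp.dvd_of_dvd_pow (hpf.trans (key2 h hh)))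
  have hpk := hp.dvd_of_dvd_pow hpk
  rw [Finset.mem_erase] at hk
  have := isRelPrime_pow_linForm (hs.1 h hh) (hs.2 h hh k hk.2 (Ne.symm hk.1)) 1 1
  rw [pow_one, pow_one] at this
  exact hp.not_isUnit (this hph hpk)

end exponents

section exponents
variable {r : ℕ} {ι ι' : Type*}

lemma derivation_linForm (θ : Der K ℓ) (c : Fin ℓ → K) :
    θ (linForm c) = ev c fun j => θ (X j) := by
  rw [linForm_eq_ev]
  simp [ev]

lemma isHomogOfDeg_iff (θ : Der K ℓ) (d : ℕ) :
    IsHomogOfDeg θ d ↔ ∀ j, (θ (X j)).IsHomogeneous d := by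
  constructor
  · intro h j
    have := h (Pi.single j 1)
    rwa [linForm_single] at this
  · intro h c
    rw [derivation_linForm]
    refine IsHomogeneous.sum _ _ _ fun j _ => ?_
    rw [smul_eq_C_mul]
    simpa using (isHomogeneous_C (Fin ℓ) (c j)).mul (h j)

lemma isLogDer_iff (A : Arrangement K ℓ) (m : (Fin ℓ → K) → ℕ) (θ : Der K ℓ) :
    IsLogDer A m θ ↔ (fun j => θ (X j)) ∈ LD A.hyps id m := by
  simp only [IsLogDer, mem_LD, derivation_linForm, id]

lemma Arrangement.np (A : Arrangement K ℓ) : NP A.hyps (id : (Fin ℓ → K) → _) :=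
  ⟨A.ne_zero, A.nonparallel⟩

lemma der_eq_sum_iff (η : Der K ℓ) (f : Fin ℓ → S K ℓ) (θ : Fin ℓ → Der K ℓ) :
    η = ∑ i, f i • θ i ↔ (fun j => η (X j)) = ∑ i, f i • fun j => θ i (X j) := by
  have hsum : ∀ j, (∑ i, f i • θ i) (X j) = (∑ i, f i • fun j => θ i (X j)) j := by
    intro j
    rw [← Derivation.coeFnAddMonoidHom_apply, map_sum]
    simp
  constructor
  · rintro rfl
    exact funext hsum
  · intro h
    refine MvPolynomial.derivation_ext fun j => ?_
    rw [hsum]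
    exact congrFun h j

/-- Saito's criterion: freeness is the existence of independent homogeneous logarithmic
derivations of the right total degree. -/
theorem isFreeWithExp_iff (A : Arrangement K ℓ) (m : (Fin ℓ → K) → ℕ) (d : Fin ℓ → ℕ) :
    IsFreeWithExp A m d ↔ HasExp A.hyps id m d := by
  constructor
  · rintro ⟨θ, hhom, hlog, hbasis⟩
    let M : Matrix (Fin ℓ) (Fin ℓ) (S K ℓ) := fun i j => θ i (X j)
    have hM : ∀ i, M i ∈ LD A.hyps id m := fun i => (isLogDer_iff A m (θ i)).mp (hlog i)
    have hMh : ∀ i j, (M i j).IsHomogeneous (d i) := fun i j =>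
      (isHomogOfDeg_iff _ _).mp (hhom i) j
    obtain ⟨f, hf⟩ := defPoly_dvd_det A.np hM
    have hspan : ∀ b ∈ LD A.hyps id m, ∃ f : Fin ℓ → S K ℓ, b = ∑ k, f k • M k := by
      intro b hb
      have hb' : (fun j => (mkDerivation K b : Der K ℓ) (X j)) = b := by
        funext j; simp [mkDerivation_X]
      obtain ⟨f, hf, -⟩ := hbasis (mkDerivation K b) ((isLogDer_iff A m _).mpr (by rwa [hb']))
      refine ⟨f, ?_⟩
      rw [← hb']
      exact (der_eq_sum_iff _ _ _).mp hf
    have hu := isUnit_of_span_LD A.np hspan hf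
    have h0 : M.det ≠ 0 := by
      rw [hf]
      exact mul_ne_zero (defPoly_ne_zero A.np.1 m) hu.ne_zero
    refine ⟨?_, M, hM, hMh, h0⟩
    have h1 := (det_isHomogeneous hMh).totalDegree h0
    rw [hf, totalDegree_mul_of_isDomain (defPoly_ne_zero A.np.1 m) hu.ne_zero,
      (defPoly_isHomogeneous _ _ _).totalDegree (defPoly_ne_zero A.np.1 m)] at h1
    have h2 : f.totalDegree = 0 := by
      obtain ⟨u, hu1, rfl⟩ := MvPolynomial.isUnit_iff_eq_C_of_isReduced.mp hu
      simp
    omega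
  · rintro ⟨hd, M, hM, hMh, h0⟩
    refine ⟨fun i => mkDerivation K (M i), fun i => ?_, fun i => ?_, fun η hη => ?_⟩
    · rw [isHomogOfDeg_iff]
      intro j
      rw [mkDerivation_X]
      exact hMh i j
    · rw [isLogDer_iff]
      simpa [mkDerivation_X] using hM i
    · obtain ⟨c, hc, hdet⟩ := det_eq_C_mul_defPoly A.np hd hM hMh h0
      obtain ⟨f, hf⟩ := exists_combination_of_mem_LD A.np hc hM hdet ((isLogDer_iff A m η).mp hη)
      have hrow : ∀ i, (fun j => (mkDerivation K (M i) : Der K ℓ) (X j)) = M i := fun i => by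
        funext j; simp [mkDerivation_X]
      refine ⟨f, ?_, fun g hg => ?_⟩
      · simp only [der_eq_sum_iff, hrow]
        exact hf
      · simp only [der_eq_sum_iff, hrow] at hg
        have : Matrix.vecMul (g - f) M = 0 := by
          have h1 : ∀ f : Fin ℓ → S K ℓ, Matrix.vecMul f M = ∑ i, f i • M i := fun f => by
            ext j; simp [Matrix.vecMul, dotProduct]
          rw [Matrix.sub_vecMul, h1, h1, ← hf, ← hg, sub_self]
        exact sub_eq_zero.mp (Matrix.eq_zero_of_vecMul_eq_zero h0 this)

lemma HasExp.congr {s : Finset ι} {a : ι → Fin r → K} {m : ι → ℕ} {s' : Finset ι'}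
    {a' : ι' → Fin r → K} {m' : ι' → ℕ} {d : Fin r → ℕ} (h : HasExp s a m d)
    (hsum : ∑ k ∈ s', m' k = ∑ k ∈ s, m k)
    (hmem : ∀ k' ∈ s', m' k' = 0 ∨ ∃ k ∈ s, m k = m' k' ∧ ∃ u : K, u ≠ 0 ∧ a' k' = u • a k) :
    HasExp s' a' m' d := by
  obtain ⟨h1, θ, h2, h3, h4⟩ := h
  refine ⟨h1.trans hsum.symm, θ, fun i k' hk' => ?_, h3, h4⟩
  rcases hmem k' hk' with h0 | ⟨k, hk, hm, u, hu, ha⟩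
  · simp [h0]
  · rw [ha, linForm_smul, smul_ev, mul_pow, smul_eq_C_mul, ← hm]
    have hu' : IsUnit (C u ^ m k : S K r) := ((IsUnit.mk0 u hu).map C).pow _
    rw [hu'.mul_left_dvd]
    exact (h2 i k hk).mul_left _

/-- The algebra map acting on linear forms through a linear map of covectors. -/
noncomputable def covMap {r' : ℕ} (L : (Fin r → K) →ₗ[K] (Fin r' → K)) : S K r →ₐ[K] S K r' :=
  aeval fun i => linForm (L (Pi.single i 1))

lemma covMap_linForm {r' : ℕ} (L : (Fin r → K) →ₗ[K] (Fin r' → K)) (c : Fin r → K) :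
    covMap L (linForm c) = linForm (L c) := by
  have hc : c = ∑ i, c i • Pi.single i (1 : K) := by
    simpa using (pi_eq_sum_univ' c)
  rw [linForm_eq_ev, map_ev]
  conv_rhs => rw [hc, map_sum]
  rw [linForm_eq_ev, sum_ev]
  simp only [← linForm_eq_ev]
  simp [ev, covMap, linForm_smul, smul_eq_C_mul]

lemma covMap_isHomogeneous {r' : ℕ} (L : (Fin r → K) →ₗ[K] (Fin r' → K)) {p : S K r} {d : ℕ}
    (hp : p.IsHomogeneous d) : (covMap L p).IsHomogeneous d := by
  have := hp.aeval (n := 1) (fun i => linForm (L (Pi.single i 1)))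
    (fun i => linForm_isHomogeneous _)
  simpa [covMap] using this

lemma covMap_comp {r' r'' : ℕ} (L : (Fin r → K) →ₗ[K] (Fin r' → K))
    (L' : (Fin r' → K) →ₗ[K] (Fin r'' → K)) (p : S K r) :
    covMap L' (covMap L p) = covMap (L' ∘ₗ L) p := by
  have : (covMap L').comp (covMap L) = covMap (L' ∘ₗ L) := by
    refine MvPolynomial.algHom_ext fun i => ?_
    rw [AlgHom.comp_apply, ← linForm_single, covMap_linForm, covMap_linForm, covMap_linForm]
    rfl
  exact DFunLike.congr_fun this p

lemma covMap_id (p : S K r) : covMap LinearMap.id p = p := by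
  have : covMap LinearMap.id = AlgHom.id K (S K r) := by
    refine MvPolynomial.algHom_ext fun i => ?_
    rw [← linForm_single, covMap_linForm]
    rfl
  exact DFunLike.congr_fun this p

lemma covMap_injective (L : (Fin r → K) ≃ₗ[K] (Fin r → K)) :
    Function.Injective (covMap L.toLinearMap) := by
  refine Function.LeftInverse.injective (g := covMap L.symm.toLinearMap) fun p => ?_
  rw [covMap_comp]
  simp [covMap_id]

lemma HasExp.linearEquiv {s : Finset ι} {a : ι → Fin r → K} {m : ι → ℕ} {d : Fin r → ℕ}
    (h : HasExp s a m d) (L : (Fin r → K) ≃ₗ[K] (Fin r → K)) :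
    HasExp s (fun k => L (a k)) m d := by
  obtain ⟨h1, θ, h2, h3, h4⟩ := h
  let φ := covMap L.toLinearMap
  let N : Matrix (Fin r) (Fin r) (S K r) := fun i j => φ (ev (L.symm (Pi.single j 1)) (θ i))
  have hev : ∀ (c : Fin r → K) i, ev (L c) (N i) = φ (ev c (θ i)) := by
    intro c i
    have hc : c = ∑ j, (L c) j • L.symm (Pi.single j (1 : K)) := by
      rw [← L.symm_apply_apply c]
      conv_lhs => rw [pi_eq_sum_univ' (L c)]
      simp [map_sum]
    conv_rhs => rw [hc]
    rw [sum_ev, map_sum]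
    simp only [smul_ev, map_smul]
    rfl
  refine ⟨h1, N, fun i k hk => ?_, fun i j => ?_, ?_⟩
  · rw [hev, ← LinearEquiv.coe_toLinearMap, ← covMap_linForm, ← map_pow]
    exact map_dvd φ (h2 i k hk)
  · refine covMap_isHomogeneous _ (IsHomogeneous.sum _ _ _ fun k _ => ?_)
    rw [smul_eq_C_mul]
    simpa using (isHomogeneous_C (Fin r) _).mul (h3 i k)
  · intro h0
    obtain ⟨v, hv, hv0⟩ := Matrix.exists_mulVec_eq_zero_iff.mpr
      ((Matrix.det_transpose N).trans h0)
    have hrows : ∑ i, v i • N i = 0 := by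
      funext j
      have := congrFun hv0 j
      simpa [Matrix.mulVec, dotProduct, mul_comm] using this
    have hφ : (θ.map φ).det ≠ 0 := by
      rw [← AlgHom.mapMatrix_apply, ← AlgHom.map_det]
      exact fun h => h4 (covMap_injective L (h.trans (map_zero _).symm))
    refine hv (Matrix.eq_zero_of_vecMul_eq_zero hφ ?_)
    funext j
    have h5 := hev (Pi.single j 1)
    have h6 : ev (L (Pi.single j 1)) (∑ i, v i • N i) = 0 := by rw [hrows, ev_zero]
    rw [ev_sum] at h6
    simp only [ev_smul, h5] at h6
    have h7 : ∀ i, ev (Pi.single j (1 : K)) (θ i) = θ i j := fun i => by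
      simp [ev, Pi.single_apply, ite_smul]
    simp only [h7] at h6
    simpa [Matrix.vecMul, dotProduct] using h6

end exponents

section restriction
variable {r : ℕ}

/-- Restriction of polynomials to the hyperplane where the first coordinate vanishes. -/
noncomputable def rho : S K (r + 1) →ₐ[K] S K r :=
  aeval (Fin.cons 0 X : Fin (r + 1) → S K r)

/-- Inclusion of polynomials not involving the first coordinate. -/
noncomputable def sig : S K r →ₐ[K] S K (r + 1) := rename Fin.succ

@[simp] lemma rho_X_zero : rho (X 0 : S K (r + 1)) = 0 := by simp [rho]

@[simp] lemma rho_X_succ (j : Fin r) : rho (X j.succ : S K (r + 1)) = X j := by simp [rho]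

@[simp] lemma rho_C (c : K) : rho (C c : S K (r + 1)) = C c := by
  simp [rho]

@[simp] lemma sig_X (j : Fin r) : sig (X j : S K r) = X j.succ := by simp [sig]

@[simp] lemma sig_C (c : K) : sig (C c : S K r) = C c := by simp [sig]

@[simp] lemma rho_sig (p : S K r) : rho (sig p) = p := by
  have : (rho : S K (r + 1) →ₐ[K] S K r).comp sig = AlgHom.id K _ :=
    MvPolynomial.algHom_ext fun i => by simp
  exact DFunLike.congr_fun this p

lemma rho_linForm (c : Fin (r + 1) → K) : rho (linForm c) = linForm (Fin.tail c) := by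
  simp [linForm, Fin.sum_univ_succ, Fin.tail]

lemma sig_linForm (c : Fin r → K) :
    sig (linForm c) = linForm (Fin.cons 0 c : Fin (r + 1) → K) := by
  simp [linForm, Fin.sum_univ_succ]

lemma linForm_cons_one_zero : linForm (Fin.cons 1 0 : Fin (r + 1) → K) = X 0 := by
  simp [linForm, Fin.sum_univ_succ]

lemma X_zero_dvd_sub_sig_rho (p : S K (r + 1)) : X 0 ∣ p - sig (rho p) := by
  induction p using MvPolynomial.induction_on with
  | C a => simp
  | add p q hp hq =>
    rw [map_add, map_add, add_sub_add_comm]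
    exact dvd_add hp hq
  | mul_X p i hp =>
    have h1 : X 0 ∣ (X i - sig (rho (X i)) : S K (r + 1)) := by
      refine Fin.cases ?_ (fun j => ?_) i <;> simp
    rw [map_mul, map_mul,
      show p * X i - sig (rho p) * sig (rho (X i)) =
        (p - sig (rho p)) * X i + sig (rho p) * (X i - sig (rho (X i))) by ring]
    exact dvd_add (hp.mul_right _) (h1.mul_left _)

lemma X_zero_dvd_of_rho_eq_zero {p : S K (r + 1)} (h : rho p = 0) : X 0 ∣ p := by
  simpa [h] using X_zero_dvd_sub_sig_rho p

lemma rho_isHomogeneous {p : S K (r + 1)} {d : ℕ} (hp : p.IsHomogeneous d) :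
    (rho p).IsHomogeneous d := by
  have := hp.aeval (n := 1) (Fin.cons 0 X : Fin (r + 1) → S K r) (fun i => by
    refine Fin.cases ?_ (fun j => ?_) i
    · simpa using isHomogeneous_zero (Fin r) K 1
    · simpa using isHomogeneous_X K j)
  simpa [rho] using this

lemma homogeneousComponent_of_isHomogeneous {p : S K r} {d : ℕ} (hp : p.IsHomogeneous d) (e : ℕ) :
    homogeneousComponent e p = if e = d then p else 0 :=
  homogeneousComponent_of_mem hp

/-- Graded maps commute with homogeneous components. -/
lemma homogeneousComponent_map {r' : ℕ} (f : S K r →ₗ[K] S K r') (a : ℕ)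
    (hf : ∀ (p : S K r) (d : ℕ), p.IsHomogeneous d → (f p).IsHomogeneous (d + a))
    (p : S K r) (d : ℕ) :
    homogeneousComponent (d + a) (f p) = f (homogeneousComponent d p) := by
  conv_lhs => rw [← sum_homogeneousComponent p]
  rw [map_sum, map_sum]
  simp only [homogeneousComponent_of_isHomogeneous
    (hf _ _ (homogeneousComponent_isHomogeneous _ p)), Nat.add_right_cancel_iff]
  rw [Finset.sum_ite_eq]
  split_ifs with h
  · rfl
  · have : p.totalDegree < d := by simpa using h
    rw [homogeneousComponent_eq_zero _ _ this, map_zero]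

lemma homogeneousComponent_map_of_lt {r' : ℕ} (f : S K r →ₗ[K] S K r') (a : ℕ)
    (hf : ∀ (p : S K r) (d : ℕ), p.IsHomogeneous d → (f p).IsHomogeneous (d + a))
    (p : S K r) (d : ℕ) (hd : d < a) : homogeneousComponent d (f p) = 0 := by
  conv_lhs => rw [← sum_homogeneousComponent p]
  rw [map_sum, map_sum]
  refine Finset.sum_eq_zero fun i _ => ?_
  rw [homogeneousComponent_of_isHomogeneous
    (hf _ _ (homogeneousComponent_isHomogeneous _ p)), if_neg (by omega)]

lemma homogeneousComponent_rho (p : S K (r + 1)) (d : ℕ) :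
    homogeneousComponent d (rho p) = rho (homogeneousComponent d p) :=
  homogeneousComponent_map (rho : S K (r + 1) →ₐ[K] S K r).toLinearMap 0
    (fun _ _ hp => rho_isHomogeneous hp) p d

lemma homogeneousComponent_mul_left {q : S K r} {a : ℕ} (hq : q.IsHomogeneous a) (p : S K r)
    (d : ℕ) : homogeneousComponent (d + a) (q * p) = q * homogeneousComponent d p :=
  homogeneousComponent_map (LinearMap.mulLeft K q) a
    (fun _ _ hp => by simpa [add_comm] using hq.mul hp) p d

lemma homogeneousComponent_mul_left_of_lt {q : S K r} {a : ℕ} (hq : q.IsHomogeneous a) (p : S K r)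
    (d : ℕ) (hd : d < a) : homogeneousComponent d (q * p) = 0 :=
  homogeneousComponent_map_of_lt (LinearMap.mulLeft K q) a
    (fun _ _ hp => by simpa [add_comm] using hq.mul hp) p d hd

lemma dvd_homogeneousComponent {q p : S K r} {a : ℕ} (hq : q.IsHomogeneous a) (h : q ∣ p)
    (d : ℕ) : q ∣ homogeneousComponent d p := by
  obtain ⟨f, rfl⟩ := h
  rcases lt_or_ge d a with hd | hd
  · rw [homogeneousComponent_mul_left_of_lt hq f d hd]; exact dvd_zero _
  · obtain ⟨e, rfl⟩ := Nat.exists_eq_add_of_le' hd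
    rw [homogeneousComponent_mul_left hq]; exact dvd_mul_right _ _

lemma homogeneousComponent_ev (c : Fin r → K) {n : ℕ} (θ : Fin r → S K n) (d : ℕ) :
    homogeneousComponent d (ev c θ) = ev c fun j => homogeneousComponent d (θ j) := by
  simp [ev]

end restriction

/-- Data of a weighted family of linear forms grouped into classes according to their restriction
to the first coordinate hyperplane, which carries the weight `m0`. -/
structure PD (K : Type*) [Field K] (r : ℕ) (ι κ : Type*) where
  cl : ι → κ
  av : ι → K
  m : ι → ℕ
  m0 : ℕ
  β : κ → Fin r → K
  t : Finset κ

namespace PD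
variable {r : ℕ} {ι κ : Type*} (D : PD K r ι κ) (s : Finset ι)

/-- The covector of a member of the family. -/
def cov (h : ι) : Fin (r + 1) → K := Fin.cons (D.av h) (D.β (D.cl h))

/-- The linear form of a member of the family. -/
noncomputable def al (h : ι) : S K (r + 1) := linForm (D.cov h)

/-- The total multiplicity of a class. -/
noncomputable def mu (k : κ) : ℕ := ∑ h ∈ s with D.cl h = k, D.m h

/-- The value on a linear form of the vector field whose first component is divided by
the power of the first coordinate. -/
noncomputable def bv (h : ι) : (Fin (r + 1) → S K (r + 1)) →ₗ[S K (r + 1)] S K (r + 1) where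
  toFun u := C (D.av h) * (X 0 ^ D.m0 * u 0) + ev (D.β (D.cl h)) fun j => u j.succ
  map_add' u v := by
    have : (fun j : Fin r => (u + v) j.succ) = (fun j => u j.succ) + fun j => v j.succ := rfl
    rw [this, ev_add, Pi.add_apply]; ring
  map_smul' g u := by
    have : (fun j : Fin r => (g • u) j.succ) = g • fun j => u j.succ := rfl
    rw [this, ev_smul, Pi.smul_apply, smul_eq_mul, RingHom.id_apply, smul_eq_mul]; ring

lemma bv_apply (h : ι) (u : Fin (r + 1) → S K (r + 1)) :
    D.bv h u = C (D.av h) * (X 0 ^ D.m0 * u 0) + ev (D.β (D.cl h)) fun j => u j.succ := rfl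

/-- Reduced logarithmic vector fields of the whole family. -/
def Dh : Submodule (S K (r + 1)) (Fin (r + 1) → S K (r + 1)) where
  carrier := {u | ∀ h ∈ s, D.al h ^ D.m h ∣ D.bv h u}
  zero_mem' := fun h _ => by simp
  add_mem' := fun {x y} hx hy h hh => by rw [map_add]; exact dvd_add (hx h hh) (hy h hh)
  smul_mem' := fun g x hx h hh => by rw [map_smul]; exact (hx h hh).mul_left _

/-- Candidate restrictions of reduced logarithmic vector fields. -/
def E : Submodule (S K r) (Fin (r + 1) → S K r) where
  carrier := {v | ∀ k ∈ D.t, linForm (D.β k) ^ D.mu s k ∣ ev (D.β k) fun j => v j.succ}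
  zero_mem' := fun h _ => by simp [ev]
  add_mem' := fun {x y} hx hy h hh => by
    have : (fun j : Fin r => (x + y) j.succ) = (fun j => x j.succ) + fun j => y j.succ := rfl
    rw [this, ev_add]; exact dvd_add (hx h hh) (hy h hh)
  smul_mem' := fun g x hx h hh => by
    have : (fun j : Fin r => (g • x) j.succ) = g • fun j => x j.succ := rfl
    rw [this, ev_smul]; exact (hx h hh).mul_left _

variable {s} in
lemma mem_Dh {u : Fin (r + 1) → S K (r + 1)} :
    u ∈ D.Dh s ↔ ∀ h ∈ s, D.al h ^ D.m h ∣ D.bv h u := Iff.rfl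

/-- Every candidate restriction lifts to a reduced logarithmic vector field. -/
def Good : Prop := ∀ v ∈ D.E s, ∃ u ∈ D.Dh s, (fun j => rho (u j)) = v

/-- The standing assumptions on the data: classes are nonparallel, members of a class are distinct,
and there are interpolating polynomials for each class. -/
structure WF : Prop where
  cl_mem : ∀ h ∈ s, D.cl h ∈ D.t
  np : NP D.t D.β
  inj : ∀ h ∈ s, ∀ h' ∈ s, D.cl h = D.cl h' → D.av h = D.av h' → h = h'
  interp : ∀ k ∈ D.t, ∃ P : S K (r + 1), P.IsHomogeneous D.m0 ∧ rho P = 0 ∧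
    ∀ h ∈ s, D.cl h = k → D.al h ^ D.m h ∣ P + C (D.av h) * X 0 ^ D.m0

/-- The covectors of the whole family together with the first coordinate. -/
def full : Option ι → Fin (r + 1) → K
  | none => Fin.cons 1 0
  | some h => D.cov h

/-- The multiplicities of the whole family. -/
def fm : Option ι → ℕ
  | none => D.m0
  | some h => D.m h

variable {D s}

lemma WF.mono {s' : Finset ι} (h : D.WF s) (hs : s' ⊆ s) : D.WF s' where
  cl_mem k hk := h.cl_mem k (hs hk)
  np := h.np
  inj k hk k' hk' := h.inj k (hs hk) k' (hs hk')
  interp k hk := by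
    obtain ⟨P, h1, h2, h3⟩ := h.interp k hk
    exact ⟨P, h1, h2, fun i hi => h3 i (hs hi)⟩

lemma WF.cov_ne_smul (hD : D.WF s) {h h' : ι} (hh : h ∈ s) (hh' : h' ∈ s) (hne : h ≠ h') (u : K) :
    D.cov h' ≠ u • D.cov h := by
  intro heq
  have h0 : D.av h' = u * D.av h := by simpa [cov] using congrFun heq 0
  have h1 : D.β (D.cl h') = u • D.β (D.cl h) := by
    ext j; simpa [cov] using congrFun heq j.succ
  by_cases hcl : D.cl h = D.cl h'
  · have hu : u = 1 := by
      rw [hcl] at h1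
      have hβ := hD.np.1 _ (hD.cl_mem h' hh')
      have : (u - 1) • D.β (D.cl h') = 0 := by rw [sub_smul, ← h1, one_smul, sub_self]
      exact sub_eq_zero.mp ((smul_eq_zero.mp this).resolve_right hβ)
    exact hne (hD.inj h hh h' hh' hcl (by rw [h0, hu, one_mul]))
  · exact hD.np.2 _ (hD.cl_mem h hh) _ (hD.cl_mem h' hh') hcl u h1

lemma WF.cov_ne_zero (hD : D.WF s) {h : ι} (hh : h ∈ s) : D.cov h ≠ 0 := by
  intro heq
  refine hD.np.1 _ (hD.cl_mem h hh) ?_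
  ext j
  simpa [cov] using congrFun heq j.succ

lemma WF.np_full (hD : D.WF s) : NP (Finset.insertNone s) D.full := by
  have hβ : ∀ h ∈ s, D.β (D.cl h) ≠ 0 := fun h hh => hD.np.1 _ (hD.cl_mem h hh)
  refine ⟨fun h hh => ?_, fun h hh h' hh' hne u heq => ?_⟩
  · cases h with
    | none => exact fun h => one_ne_zero (α := K) (by simpa [full] using congrFun h 0)
    | some h => exact hD.cov_ne_zero (by simpa using hh)
  · cases h with
    | none =>
      cases h' with
      | none => exact hne rfl
      | some h' =>
        refine hβ h' (by simpa using hh') ?_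
        ext j
        simpa [full, cov] using congrFun heq j.succ
    | some h =>
      have hs : h ∈ s := by simpa using hh
      cases h' with
      | none =>
        have h1 : u • D.β (D.cl h) = 0 := by
          ext j
          simpa [full, cov] using (congrFun heq j.succ).symm
        have hu : u = 0 := (smul_eq_zero.mp h1).resolve_right (hβ h hs)
        simpa [full, hu] using congrFun heq 0
      | some h' =>
        exact hD.cov_ne_smul hs (by simpa using hh') (fun h => hne (by rw [h])) u heq

lemma rho_al (h : ι) : rho (D.al h) = linForm (D.β (D.cl h)) := by
  rw [al, rho_linForm]; rfl

lemma WF.prod_al_dvd (hD : D.WF s) {s' : Finset ι} (hs : s' ⊆ s) {p : S K (r + 1)}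
    (h : ∀ i ∈ s', D.al i ^ D.m i ∣ p) : ∏ i ∈ s', D.al i ^ D.m i ∣ p :=
  NP.prod_dvd (a := D.cov) ⟨fun _ hi => hD.cov_ne_zero (hs hi),
    fun _ hi _ hj hij u => hD.cov_ne_smul (hs hi) (hs hj) hij u⟩ D.m h

lemma rho_prod_class (k : κ) :
    rho (∏ h ∈ s with D.cl h = k, D.al h ^ D.m h) = linForm (D.β k) ^ D.mu s k := by
  rw [map_prod, mu, ← Finset.prod_pow_eq_pow_sum]
  refine Finset.prod_congr rfl fun h hh => ?_
  rw [map_pow, rho_al, (Finset.mem_filter.mp hh).2]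

lemma WF.rho_prod (hD : D.WF s) :
    rho (∏ h ∈ s, D.al h ^ D.m h) = defPoly D.t D.β (D.mu s) := by
  rw [← Finset.prod_fiberwise_of_maps_to hD.cl_mem, map_prod, defPoly]
  exact Finset.prod_congr rfl fun k _ => rho_prod_class k

lemma WF.sum_mu (hD : D.WF s) : ∑ k ∈ D.t, D.mu s k = ∑ h ∈ s, D.m h :=
  Finset.sum_fiberwise_of_maps_to hD.cl_mem _

/-- Restrictions of reduced logarithmic vector fields are candidates. -/
lemma WF.rho_mem_E (hD : D.WF s) {u : Fin (r + 1) → S K (r + 1)} (hu : u ∈ D.Dh s) :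
    (fun j => rho (u j)) ∈ D.E s := by
  intro k hk
  obtain ⟨P, -, hP, hPs⟩ := hD.interp k hk
  have h1 : ∏ h ∈ s with D.cl h = k, D.al h ^ D.m h ∣
      ev (D.β k) (fun j => u j.succ) - P * u 0 := by
    refine hD.prod_al_dvd (Finset.filter_subset _ _) fun h hh => ?_
    obtain ⟨hhs, rfl⟩ := Finset.mem_filter.mp hh
    have h2 := dvd_sub (hu h hhs) ((hPs h hhs rfl).mul_right (u 0))
    rw [bv_apply] at h2
    convert h2 using 1
    ring
  have h3 := map_dvd (rho : S K (r + 1) →ₐ[K] S K r) h1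
  rwa [rho_prod_class, map_sub, map_ev, map_mul, hP, zero_mul, sub_zero] at h3

lemma defPoly_full (D : PD K r ι κ) (s : Finset ι) : defPoly (Finset.insertNone s) D.full D.fm =
    X 0 ^ D.m0 * ∏ h ∈ s, D.al h ^ D.m h := by
  rw [defPoly, Finset.prod_insertNone]
  simp [full, fm, al, linForm_cons_one_zero]

lemma sum_fm (D : PD K r ι κ) (s : Finset ι) :
    ∑ h ∈ Finset.insertNone s, D.fm h = D.m0 + ∑ h ∈ s, D.m h := by
  rw [Finset.sum_insertNone]
  rfl

lemma mem_LD_full_iff {θ u : Fin (r + 1) → S K (r + 1)} (h0 : θ 0 = X 0 ^ D.m0 * u 0)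
    (h1 : ∀ j : Fin r, θ j.succ = u j.succ) :
    θ ∈ LD (Finset.insertNone s) D.full D.fm ↔ u ∈ D.Dh s := by
  simp only [mem_LD, Finset.forall_mem_insertNone, mem_Dh]
  have : linForm (D.full none) ^ D.fm none ∣ ev (D.full none) θ := by
    simp only [full, fm, linForm_cons_one_zero, ev_cons, h0]
    simp
  simp only [this, true_and]
  refine forall₂_congr fun h _ => ?_
  simp only [full, fm, cov, al, bv_apply, ev_cons, h0, h1, smul_eq_C_mul]

lemma E_dvd_det (hD : D.WF s) {N : Matrix (Fin (r + 1)) (Fin (r + 1)) (S K r)}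
    (h : ∀ i, N i ∈ D.E s) : defPoly D.t D.β (D.mu s) ∣ N.det := by
  refine hD.np.prod_dvd _ fun k hk => ?_
  refine dvd_det_of_dvd_ev (c := (Fin.cons 0 (D.β k) : Fin (r + 1) → K)) (fun h0 => ?_) N
    fun i => ?_
  · refine hD.np.1 k hk ?_
    ext j
    simpa using congrFun h0 j.succ
  · rw [ev_cons, zero_smul, zero_add]
    exact h i k hk

end PD

namespace PD
variable {r : ℕ} {ι κ : Type*} {D : PD K r ι κ} {s : Finset ι}

lemma det_eq_pow_mul_det {n r m0 : ℕ} (θ u : Matrix (Fin (n + 1)) (Fin (n + 1)) (S K (r + 1)))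
    (h0 : ∀ i, θ i 0 = X 0 ^ m0 * u i 0) (h1 : ∀ i (j : Fin n), θ i j.succ = u i j.succ) :
    θ.det = X 0 ^ m0 * u.det := by
  have : θ = u * Matrix.diagonal (Fin.cons (X 0 ^ m0) 1) := by
    ext1 i j
    rw [Matrix.mul_diagonal]
    refine Fin.cases ?_ (fun j => ?_) j
    · simp [h0, mul_comm]
    · simp [h1]
  rw [this, Matrix.det_mul, Matrix.det_diagonal, Fin.prod_univ_succ]
  simp [mul_comm]

lemma exists_constantCoeff_ne_zero {n : ℕ} {N : Matrix (Fin (n + 1)) (Fin (n + 1)) (S K r)}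
    {c : K} {q : S K r} (hc : c ≠ 0) (hq : q ≠ 0) (hN : N.det = C c * q)
    (hdvd : ∀ i : Fin (n + 1), q ∣ (N.submatrix i.succAbove Fin.succ).det) :
    ∃ i, constantCoeff (N i 0) ≠ 0 ∧ (N.submatrix i.succAbove Fin.succ).det ≠ 0 := by
  choose g hg using hdvd
  rw [Matrix.det_succ_column_zero] at hN
  have h1 : q * ∑ i : Fin (n + 1), (-1) ^ (i : ℕ) * N i 0 * g i = q * C c := by
    rw [mul_comm q (C c), ← hN, Finset.mul_sum]
    refine Finset.sum_congr rfl fun i _ => ?_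
    rw [hg]
    ring
  have h2 := congrArg constantCoeff (mul_left_cancel₀ hq h1)
  rw [map_sum, constantCoeff_C] at h2
  obtain ⟨i, -, hi⟩ := Finset.exists_ne_zero_of_sum_ne_zero (h2 ▸ hc)
  rw [map_mul, map_mul] at hi
  refine ⟨i, right_ne_zero_of_mul (left_ne_zero_of_mul hi), ?_⟩
  rw [hg]
  refine mul_ne_zero hq fun h => ?_
  rw [h, map_zero, mul_zero] at hi
  exact hi rfl

/-- Freeness of the whole family forces one exponent to be the multiplicity of the distinguished
hyperplane, freeness of the restriction and liftability of all candidate restrictions. -/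
theorem WF.good_of_hasExp (hD : D.WF s) {d : Fin (r + 1) → ℕ}
    (h : HasExp (Finset.insertNone s) D.full D.fm d) :
    (∃ i, d i = D.m0 ∧ HasExp D.t D.β (D.mu s) (d ∘ i.succAbove)) ∧ D.Good s := by
  obtain ⟨hd, θ, hθ, hhom, h0⟩ := h
  have hx : ∀ i, X 0 ^ D.m0 ∣ θ i 0 := fun i => by
    have := hθ i none (by simp)
    simpa [full, fm, linForm_cons_one_zero, ev_cons] using this
  choose f hf using hx
  let u : Matrix (Fin (r + 1)) (Fin (r + 1)) (S K (r + 1)) :=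
    fun i => Fin.cons (f i) fun j => θ i j.succ
  have hu : ∀ i, u i ∈ D.Dh s := fun i =>
    (mem_LD_full_iff (by simp [u, hf]) (fun j => by simp [u])).mp (hθ i)
  have hdet : θ.det = X 0 ^ D.m0 * u.det :=
    det_eq_pow_mul_det θ u (fun i => by simp [u, hf]) (fun i j => by simp [u])
  obtain ⟨c, hc, hcQ⟩ := det_eq_C_mul_defPoly hD.np_full hd hθ hhom h0
  have hudet : u.det = C c * ∏ h ∈ s, D.al h ^ D.m h := by
    rw [hdet, defPoly_full] at hcQ
    have hX : (X 0 ^ D.m0 : S K (r + 1)) ≠ 0 := pow_ne_zero _ (X_ne_zero 0)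
    refine mul_left_cancel₀ hX (hcQ.trans ?_)
    ring
  let N : Matrix (Fin (r + 1)) (Fin (r + 1)) (S K r) := fun i j => rho (u i j)
  have hNdet : N.det = C c * defPoly D.t D.β (D.mu s) := by
    have : N = (rho : S K (r + 1) →ₐ[K] S K r).mapMatrix u := rfl
    rw [this, ← AlgHom.map_det, hudet, map_mul, hD.rho_prod, rho_C]
  have hNE : ∀ i, N i ∈ D.E s := fun i => hD.rho_mem_E (hu i)
  have hq0 := defPoly_ne_zero hD.np.1 (D.mu s)
  have hminor : ∀ i i', (N.submatrix (Fin.succAbove i) Fin.succ) i' ∈ LD D.t D.β (D.mu s) :=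
    fun i i' k hk => hNE (i.succAbove i') k hk
  refine ⟨?_, fun v hv => ?_⟩
  · obtain ⟨i, hi, hi'⟩ := exists_constantCoeff_ne_zero hc hq0 hNdet
      fun i => defPoly_dvd_det hD.np (hminor i)
    have hdi : d i = D.m0 := by
      have h1 : constantCoeff (f i) ≠ 0 := by
        intro h1
        apply hi
        have h2 : (constantCoeff : S K r →+* K).comp (rho : S K (r + 1) →ₐ[K] S K r).toRingHom
            = constantCoeff := by
          refine MvPolynomial.ringHom_ext (fun a => by simp) fun j => ?_
          refine Fin.cases ?_ (fun j => ?_) j <;> simp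
        have h3 := DFunLike.congr_fun h2 (f i)
        rw [h1] at h3
        simpa [N, u] using h3
      have h2 : coeff (Finsupp.single 0 D.m0) (θ i 0) ≠ 0 := by
        rw [hf, X_pow_eq_monomial]
        have := coeff_monomial_mul (R := K) 0 (Finsupp.single (0 : Fin (r + 1)) D.m0) 1 (f i)
        rw [add_zero, one_mul] at this
        rw [this]
        exact h1
      have := hhom i 0 h2
      rw [← this]
      simp [Finsupp.weight_apply, Finsupp.sum_single_index]
    refine ⟨i, hdi, ?_, N.submatrix i.succAbove Fin.succ, hminor i, fun i' j => ?_, hi'⟩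
    · rw [sum_fm, Fin.sum_univ_succAbove _ i, hdi] at hd
      rw [hD.sum_mu]
      exact Nat.add_left_cancel hd
    · have : N (i.succAbove i') j.succ = rho (θ (i.succAbove i') j.succ) := by simp [N, u]
      rw [Matrix.submatrix_apply, this]
      exact rho_isHomogeneous (hhom _ _)
  · obtain ⟨g, hg⟩ := exists_combination_of_det hc hq0 hNdet v fun i =>
      E_dvd_det hD fun j => updateRow_mem hNE hv i j
    refine ⟨∑ i, sig (g i) • u i, Submodule.sum_mem _ fun i _ => Submodule.smul_mem _ _ (hu i), ?_⟩
    rw [hg]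
    funext j
    simp [N]

/-- Homogeneous lifting. -/
lemma exists_homogeneous_lift (hG : D.Good s) {v : Fin (r + 1) → S K r} (hv : v ∈ D.E s) {d : ℕ}
    (hv0 : D.m0 ≤ d → (v 0).IsHomogeneous (d - D.m0)) (hv0' : d < D.m0 → v 0 = 0)
    (hv1 : ∀ j : Fin r, (v j.succ).IsHomogeneous d) :
    ∃ u ∈ D.Dh s, (fun j => rho (u j)) = v ∧ (X 0 ^ D.m0 * u 0).IsHomogeneous d ∧
      (D.m0 ≤ d → (u 0).IsHomogeneous (d - D.m0)) ∧ (d < D.m0 → u 0 = 0) ∧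
      ∀ j : Fin r, (u j.succ).IsHomogeneous d := by
  obtain ⟨u, hu, rfl⟩ := hG v hv
  let u0 : S K (r + 1) := if D.m0 ≤ d then homogeneousComponent (d - D.m0) (u 0) else 0
  have hX : (X 0 ^ D.m0 : S K (r + 1)).IsHomogeneous D.m0 := by
    simpa using (isHomogeneous_X K (0 : Fin (r + 1))).pow D.m0
  have hcomp : X 0 ^ D.m0 * u0 = homogeneousComponent d (X 0 ^ D.m0 * u 0) := by
    by_cases h : D.m0 ≤ d
    · simp only [u0, if_pos h]
      rw [← homogeneousComponent_mul_left hX, Nat.sub_add_cancel h]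
    · simp only [u0, if_neg h]
      rw [homogeneousComponent_mul_left_of_lt hX _ _ (by omega), mul_zero]
  refine ⟨Fin.cons u0 fun j => homogeneousComponent d (u j.succ), fun h hh => ?_, ?_, ?_, ?_, ?_, ?_⟩
  · have h1 := dvd_homogeneousComponent (q := D.al h ^ D.m h)
      ((linForm_isHomogeneous (D.cov h)).pow (D.m h)) (hu h hh) d
    rw [bv_apply, map_add, homogeneousComponent_C_mul, homogeneousComponent_ev, ← hcomp] at h1
    rw [bv_apply]
    simpa using h1
  · funext j
    refine Fin.cases ?_ (fun j => ?_) j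
    · simp only [Fin.cons_zero, u0]
      split_ifs with h
      · rw [← homogeneousComponent_rho, homogeneousComponent_of_isHomogeneous (hv0 h), if_pos rfl]
      · rw [map_zero]
        exact (hv0' (by omega)).symm
    · simp only [Fin.cons_succ]
      rw [← homogeneousComponent_rho, homogeneousComponent_of_isHomogeneous (hv1 j), if_pos rfl]
  · rw [Fin.cons_zero, hcomp]
    exact homogeneousComponent_isHomogeneous _ _
  · intro h
    simp only [Fin.cons_zero, u0, if_pos h]
    exact homogeneousComponent_isHomogeneous _ _
  · intro h
    simp only [Fin.cons_zero, u0, if_neg (not_le.mpr h)]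
  · intro j
    exact homogeneousComponent_isHomogeneous _ _

lemma cons_mem_E {g : S K r} {η : Fin r → S K r} (hη : η ∈ LD D.t D.β (D.mu s)) :
    (Fin.cons g η : Fin (r + 1) → S K r) ∈ D.E s := fun k hk => by
  simpa using hη k hk

/-- Freeness of the restriction together with liftability gives freeness of the whole family. -/
theorem WF.hasExp_of_good (hD : D.WF s) (hG : D.Good s) {e : Fin r → ℕ}
    (h : HasExp D.t D.β (D.mu s) e) :
    HasExp (Finset.insertNone s) D.full D.fm (Fin.cons D.m0 e : Fin (r + 1) → ℕ) := by
  obtain ⟨he, η, hη, hhom, h0⟩ := h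
  let v : Fin (r + 1) → Fin (r + 1) → S K r :=
    Fin.cons (Fin.cons 1 0) fun i => Fin.cons 0 (η i)
  have hlift : ∀ i, ∃ u ∈ D.Dh s, (fun j => rho (u j)) = v i ∧
      (X 0 ^ D.m0 * u 0).IsHomogeneous ((Fin.cons D.m0 e : Fin (r + 1) → ℕ) i) ∧
      ∀ j : Fin r, (u j.succ).IsHomogeneous ((Fin.cons D.m0 e : Fin (r + 1) → ℕ) i) := by
    intro i
    refine Fin.cases ?_ (fun i => ?_) i
    · obtain ⟨u, h1, h2, h3, -, -, h4⟩ := exists_homogeneous_lift hG (v := v 0) (d := D.m0)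
        (cons_mem_E (Submodule.zero_mem _))
        (fun _ => by simpa [v] using isHomogeneous_one (Fin r) K) (by simp)
        (fun j => by simpa [v] using isHomogeneous_zero (Fin r) K _)
      exact ⟨u, h1, h2, h3, h4⟩
    · obtain ⟨u, h1, h2, h3, -, -, h4⟩ := exists_homogeneous_lift hG (v := v i.succ) (d := e i)
        (cons_mem_E (hη i))
        (fun _ => by simpa [v] using isHomogeneous_zero (Fin r) K _) (by simp [v])
        (fun j => by simpa [v] using hhom i j)
      exact ⟨u, h1, h2, h3, h4⟩
  choose u hu huv hu0 hu1 using hlift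
  let θ : Matrix (Fin (r + 1)) (Fin (r + 1)) (S K (r + 1)) :=
    fun i => Fin.cons (X 0 ^ D.m0 * u i 0) fun j => u i j.succ
  refine ⟨?_, θ, fun i => (mem_LD_full_iff (θ := θ i) (u := u i) rfl fun j => rfl).mpr (hu i),
    fun i j => ?_, ?_⟩
  · rw [sum_fm, Fin.sum_univ_succ, Fin.cons_zero, ← hD.sum_mu, ← he]
    simp
  · refine Fin.cases ?_ (fun j => ?_) j
    · exact hu0 i
    · exact hu1 i j
  · rw [det_eq_pow_mul_det θ (Matrix.of u) (fun i => rfl) (fun i j => rfl)]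
    refine mul_ne_zero (pow_ne_zero _ (X_ne_zero 0)) fun hu => h0 ?_
    have h1 : (Matrix.of v).det = 0 := by
      have : Matrix.of v = (rho : S K (r + 1) →ₐ[K] S K r).mapMatrix (Matrix.of u) := by
        ext1 i j
        exact (congrFun (huv i) j).symm
      rw [this, ← AlgHom.map_det, hu, map_zero]
    rw [Matrix.det_succ_column_zero, Fin.sum_univ_succ] at h1
    have h2 : (Matrix.of v).submatrix (Fin.succAbove 0) Fin.succ = η := by
      ext1 i j
      simp [v]
    rw [h2] at h1
    simpa [v] using h1

/-- Liftability is automatic for a single class. -/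
lemma WF.good_of_forall_cl_eq (hD : D.WF s) (k : κ) (hk : ∀ h ∈ s, D.cl h = k) : D.Good s := by
  intro v hv
  rcases s.eq_empty_or_nonempty with rfl | ⟨h0, hh0⟩
  · exact ⟨fun j => sig (v j), fun h hh => by simp at hh, by simp⟩
  have hkt : k ∈ D.t := hk h0 hh0 ▸ hD.cl_mem h0 hh0
  obtain ⟨P, -, hP, hPs⟩ := hD.interp k hkt
  obtain ⟨g, hg⟩ := hv k hkt
  obtain ⟨j0, hj0⟩ := Function.ne_iff.mp (hD.np.1 k hkt)
  rw [Pi.zero_apply] at hj0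
  set Q := ∏ h ∈ s, D.al h ^ D.m h with hQ
  have hsk : (s.filter fun h => D.cl h = k) = s := Finset.filter_true_of_mem hk
  have hQr : rho Q = linForm (D.β k) ^ D.mu s k := by rw [← rho_prod_class, hsk]
  set w := P * sig (v 0) + Q * sig g - ev (D.β k) (fun j => sig (v j.succ)) with hw
  have hwr : rho w = 0 := by
    rw [hw, map_sub, map_add, map_mul, map_mul, hP, hQr, map_ev, rho_sig, rho_sig,
      ← hg]
    simp
  refine ⟨Fin.cons (sig (v 0)) fun j => sig (v j.succ) + (Pi.single j0 (C (D.β k j0)⁻¹ * w) :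
    Fin r → S K (r + 1)) j, fun h hh => ?_, ?_⟩
  · have h1 : ev (D.β k) (Pi.single j0 (C (D.β k j0)⁻¹ * w) : Fin r → S K (r + 1)) = w := by
      rw [ev, Finset.sum_eq_single j0]
      · rw [Pi.single_eq_same, smul_eq_C_mul, ← mul_assoc, ← C_mul, mul_inv_cancel₀ hj0, C_1,
          one_mul]
      · intro b _ hb
        rw [Pi.single_eq_of_ne hb, smul_zero]
      · simp
    have h2 := ev_add (D.β k) (fun j => sig (v j.succ))
      (Pi.single j0 (C (D.β k j0)⁻¹ * w) : Fin r → S K (r + 1))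
    rw [h1] at h2
    rw [bv_apply, hk h hh]
    simp only [Fin.cons_zero, Fin.cons_succ]
    have h3 : (fun j => sig (v j.succ) + (Pi.single j0 (C (D.β k j0)⁻¹ * w) :
      Fin r → S K (r + 1)) j) = (fun j => sig (v j.succ)) +
        (Pi.single j0 (C (D.β k j0)⁻¹ * w) : Fin r → S K (r + 1)) := rfl
    rw [h3, h2, hw]
    have h4 := (hPs h hh (hk h hh)).mul_right (sig (v 0))
    have h5 : D.al h ^ D.m h ∣ Q * sig g := (Finset.dvd_prod_of_mem _ hh).mul_right _
    convert dvd_add h4 h5 using 1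
    ring
  · funext j
    refine Fin.cases ?_ (fun j => ?_) j
    · simp
    · rcases eq_or_ne j j0 with rfl | h
      · simp [hwr]
      · simp [Pi.single_eq_of_ne h]

end PD

section change
variable {r : ℕ} {ι : Type*}

/-- Data describing a family of forms not involving the first coordinate. -/
def cylData (s : Finset ι) (a : ι → Fin r → K) (m : ι → ℕ) : PD K r ι ι where
  cl := id
  av := 0
  m := m
  m0 := 0
  β := a
  t := s

lemma cylData_wf {s : Finset ι} {a : ι → Fin r → K} (hs : NP s a) (m : ι → ℕ) :
    (cylData s a m).WF s where
  cl_mem := fun h hh => hh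
  np := hs
  inj := fun h _ h' _ hcl _ => hcl
  interp := fun k _ => ⟨0, isHomogeneous_zero _ _ _, map_zero _, fun h _ _ => by
    simp [cylData]⟩

lemma cylData_mu {s : Finset ι} {a : ι → Fin r → K} {m : ι → ℕ} {k : ι} (hk : k ∈ s) :
    (cylData s a m).mu s k = m k := by
  have : (s.filter fun h => (cylData s a m).cl h = k) = {k} := by
    ext h
    simp only [Finset.mem_filter, Finset.mem_singleton]
    exact ⟨fun hh => hh.2, fun hh => ⟨hh ▸ hk, hh⟩⟩
  rw [PD.mu, this, Finset.sum_singleton]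
  rfl

lemma cylData_hasExp_iff {s : Finset ι} {a : ι → Fin r → K} {m : ι → ℕ} {e : Fin r → ℕ} :
    HasExp (cylData s a m).t (cylData s a m).β ((cylData s a m).mu s) e ↔ HasExp s a m e := by
  have hsum : ∑ k ∈ s, m k = ∑ k ∈ s, (cylData s a m).mu s k :=
    Finset.sum_congr rfl fun k hk => (cylData_mu hk).symm
  exact ⟨fun h => h.congr hsum fun k hk => Or.inr ⟨k, hk, cylData_mu hk, 1, one_ne_zero,
    (one_smul K _).symm⟩, fun h => h.congr hsum.symm fun k hk => Or.inr ⟨k, hk,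
    (cylData_mu hk).symm, 1, one_ne_zero, (one_smul K _).symm⟩⟩

lemma cylData_hasExp_full_iff {s : Finset ι} {a : ι → Fin r → K} {m : ι → ℕ}
    {d : Fin (r + 1) → ℕ} :
    HasExp (Finset.insertNone s) (cylData s a m).full (cylData s a m).fm d ↔
      HasExp s (fun k => (Fin.cons 0 (a k) : Fin (r + 1) → K)) m d := by
  have hsum : ∑ k ∈ s, m k = ∑ k ∈ Finset.insertNone s, (cylData s a m).fm k := by
    rw [PD.sum_fm]; simp [cylData]
  refine ⟨fun h => h.congr hsum fun k hk => Or.inr ⟨some k, by simpa using hk, rfl, 1, one_ne_zero,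
    (one_smul K _).symm⟩, fun h => h.congr hsum.symm fun k hk => ?_⟩
  cases k with
  | none => exact Or.inl rfl
  | some k => exact Or.inr ⟨k, by simpa using hk, rfl, 1, one_ne_zero, (one_smul K _).symm⟩

lemma HasExp.of_cons_zero {s : Finset ι} {a : ι → Fin r → K} {m : ι → ℕ} {d : Fin (r + 1) → ℕ}
    (hs : NP s a) (h : HasExp s (fun k => (Fin.cons 0 (a k) : Fin (r + 1) → K)) m d) :
    ∃ i, d i = 0 ∧ HasExp s a m (d ∘ i.succAbove) := by
  obtain ⟨⟨i, hi, h⟩, -⟩ := (cylData_wf hs m).good_of_hasExp (cylData_hasExp_full_iff.mpr h)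
  exact ⟨i, hi, cylData_hasExp_iff.mp h⟩

lemma HasExp.cons_zero {s : Finset ι} {a : ι → Fin r → K} {m : ι → ℕ} {e : Fin r → ℕ}
    (hs : NP s a) (h : HasExp s a m e) :
    HasExp s (fun k => (Fin.cons 0 (a k) : Fin (r + 1) → K)) m (Fin.cons 0 e : Fin (r + 1) → ℕ) := by
  refine cylData_hasExp_full_iff.mp ((cylData_wf hs m).hasExp_of_good (fun v hv => ?_)
    (cylData_hasExp_iff.mpr h))
  refine ⟨fun j => sig (v j), fun k hk => ?_, by simp⟩
  have h1 := map_dvd (sig : S K r →ₐ[K] S K (r + 1)) (hv k hk)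
  rw [cylData_mu hk, map_pow, sig_linForm, map_ev] at h1
  rw [PD.bv_apply]
  simpa [PD.al, PD.cov, cylData] using h1

lemma NP.comp_injective {s : Finset ι} {a : ι → Fin r → K} (hs : NP s a) {r' : ℕ}
    {J : (Fin r → K) →ₗ[K] (Fin r' → K)} (hJ : Function.Injective J) :
    NP s fun k => J (a k) := by
  refine ⟨fun h hh h0 => hs.1 h hh (hJ (h0.trans (map_zero J).symm)),
    fun h hh h' hh' hne u heq => hs.2 h hh h' hh' hne u (hJ ?_)⟩
  rw [map_smul]
  exact heq

/-- A linear change of covectors whose first coordinate is evaluation at a given vector. -/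
lemma exists_coordEquiv {v : Fin (r + 1) → K} (hv : v ≠ 0) :
    ∃ L : (Fin (r + 1) → K) ≃ₗ[K] (Fin (r + 1) → K), ∀ c, L c 0 = ∑ i, c i * v i := by
  obtain ⟨i, hi⟩ := Function.ne_iff.mp hv
  let f : (Fin (r + 1) → K) →ₗ[K] (Fin (r + 1) → K) :=
    { toFun := fun c => Fin.cons (∑ i, c i * v i) fun j => c (i.succAbove j)
      map_add' := fun c c' => by
        ext j
        refine Fin.cases ?_ (fun j => ?_) j <;> simp [add_mul, Finset.sum_add_distrib]
      map_smul' := fun u c => by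
        ext j
        refine Fin.cases ?_ (fun j => ?_) j <;> simp [Finset.mul_sum, mul_assoc] }
  have hf : Function.Injective f := by
    rw [injective_iff_map_eq_zero]
    intro c hc
    have h1 : ∀ j, c (i.succAbove j) = 0 := fun j => by simpa [f] using congrFun hc j.succ
    have h2 : ∑ i, c i * v i = 0 := by simpa [f] using congrFun hc 0
    rw [Fin.sum_univ_succAbove _ i] at h2
    have h3 : c i = 0 := by
      simp only [h1, zero_mul, Finset.sum_const_zero, add_zero] at h2
      exact (mul_eq_zero.mp h2).resolve_right hi
    ext j
    rcases Fin.eq_self_or_eq_succAbove i j with rfl | ⟨j', rfl⟩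
    · exact h3
    · exact h1 j'
  refine ⟨LinearEquiv.ofInjectiveEndo f hf, fun c => ?_⟩
  simp [f]

lemma exists_vector_of_functional (f : (Fin r → K) →ₗ[K] K) :
    ∃ v : Fin r → K, ∀ c, f c = ∑ i, c i * v i := by
  refine ⟨fun i => f (Pi.single i 1), fun c => ?_⟩
  conv_lhs => rw [pi_eq_sum_univ' c]
  simp

lemma exists_cons_factor {k : ℕ} {J : (Fin k → K) →ₗ[K] (Fin (r + 1) → K)}
    (hJ : Function.Injective J) (hk : k < r + 1) :
    ∃ (L : (Fin (r + 1) → K) ≃ₗ[K] (Fin (r + 1) → K)) (J' : (Fin k → K) →ₗ[K] (Fin r → K)),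
      Function.Injective J' ∧ ∀ c, L (J c) = (Fin.cons 0 (J' c) : Fin (r + 1) → K) := by
  have hlt : LinearMap.range J < ⊤ := by
    rw [lt_top_iff_ne_top]
    intro h
    have := LinearMap.finrank_range_of_inj hJ
    rw [h, finrank_top] at this
    simp at this
    omega
  obtain ⟨f, hf0, hf⟩ := Submodule.exists_le_ker_of_lt_top _ hlt
  obtain ⟨v, hv⟩ := exists_vector_of_functional f
  have hv0 : v ≠ 0 := by
    rintro rfl
    exact hf0 (LinearMap.ext fun c => by simp [hv])
  obtain ⟨L, hL⟩ := exists_coordEquiv hv0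
  have h0 : ∀ c, L (J c) 0 = 0 := fun c => by
    rw [hL, ← hv]
    exact hf (LinearMap.mem_range_self J c)
  let J' : (Fin k → K) →ₗ[K] (Fin r → K) := LinearMap.funLeft K K Fin.succ ∘ₗ L.toLinearMap ∘ₗ J
  have hJ' : ∀ c, L (J c) = (Fin.cons 0 (J' c) : Fin (r + 1) → K) := fun c => by
    ext j
    refine Fin.cases ?_ (fun j => ?_) j
    · simpa using h0 c
    · simp [J', LinearMap.funLeft]
  refine ⟨L, J', fun c c' h => hJ (L.injective ?_), hJ'⟩
  rw [hJ', hJ', h]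

/-- Exponents of a family pulled back from fewer variables. -/
theorem HasExp.of_injective {k : ℕ} {s : Finset ι} {a : ι → Fin k → K} {m : ι → ℕ} (hs : NP s a) :
    ∀ {r : ℕ} {J : (Fin k → K) →ₗ[K] (Fin r → K)} {d : Fin r → ℕ}, Function.Injective J →
      HasExp s (fun h => J (a h)) m d → ∃ σ : Fin k → Fin r, Function.Injective σ ∧
        (∀ i, i ∉ Set.range σ → d i = 0) ∧ HasExp s a m (d ∘ σ) := by
  intro r
  induction r with
  | zero =>
    intro J d hJ h
    have := LinearMap.finrank_le_finrank_of_injective hJ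
    simp at this
    subst this
    exact ⟨id, Function.injective_id, fun i => i.elim0, h.congr rfl fun h hh =>
      Or.inr ⟨h, hh, rfl, 1, one_ne_zero, Subsingleton.elim _ _⟩⟩
  | succ r ih =>
    intro J d hJ h
    have hle := LinearMap.finrank_le_finrank_of_injective hJ
    simp at hle
    rcases hle.lt_or_eq with hlt | rfl
    · obtain ⟨L, J', hJ', hL⟩ := exists_cons_factor hJ hlt
      have h1 := h.linearEquiv L
      simp only [hL] at h1
      obtain ⟨i, hi, h2⟩ := h1.of_cons_zero (hs.comp_injective hJ')
      obtain ⟨σ, hσ, hσ0, h3⟩ := ih hJ' h2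
      refine ⟨i.succAbove ∘ σ, Fin.succAbove_right_injective.comp hσ, fun j hj => ?_, h3⟩
      rcases Fin.eq_self_or_eq_succAbove i j with rfl | ⟨j', rfl⟩
      · exact hi
      · refine hσ0 j' fun ⟨l, hl⟩ => hj ⟨l, by simp [hl]⟩
    · have h1 := h.linearEquiv (LinearEquiv.ofInjectiveEndo J hJ).symm
      refine ⟨id, Function.injective_id, fun i hi => absurd ⟨i, rfl⟩ hi, ?_⟩
      refine h1.congr rfl fun k hk => Or.inr ⟨k, hk, rfl, 1, one_ne_zero, ?_⟩
      rw [one_smul, LinearEquiv.eq_symm_apply]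
      rfl

theorem HasExp.map_injective {k : ℕ} {s : Finset ι} {a : ι → Fin k → K} {m : ι → ℕ} (hs : NP s a)
    {e : Fin k → ℕ} (h : HasExp s a m e) :
    ∀ {r : ℕ} {J : (Fin k → K) →ₗ[K] (Fin r → K)}, Function.Injective J →
      ∃ d, HasExp s (fun h => J (a h)) m d := by
  intro r
  induction r with
  | zero =>
    intro J hJ
    have := LinearMap.finrank_le_finrank_of_injective hJ
    simp at this
    subst this
    exact ⟨e, h.congr rfl fun h hh =>
      Or.inr ⟨h, hh, rfl, 1, one_ne_zero, Subsingleton.elim _ _⟩⟩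
  | succ r ih =>
    intro J hJ
    have hle := LinearMap.finrank_le_finrank_of_injective hJ
    simp at hle
    rcases hle.lt_or_eq with hlt | rfl
    · obtain ⟨L, J', hJ', hL⟩ := exists_cons_factor hJ hlt
      obtain ⟨d, hd⟩ := ih hJ'
      refine ⟨_, ((hd.cons_zero (hs.comp_injective hJ')).linearEquiv L.symm).congr rfl
        fun h hh => Or.inr ⟨h, hh, rfl, 1, one_ne_zero, ?_⟩⟩
      rw [one_smul, ← hL, L.symm_apply_apply]
    · exact ⟨e, h.linearEquiv (LinearEquiv.ofInjectiveEndo J hJ)⟩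

end change

section localization
variable {r : ℕ} {ι : Type*}

/-- A nonzero coefficient of a determinant of polynomials comes from a determinant of
coefficients. -/
lemma exists_det_coeff_ne_zero {R : Type*} [CommRing R] {n : ℕ}
    (N : Matrix (Fin n) (Fin n) (Polynomial R)) {M : ℕ} (h : N.det.coeff M ≠ 0) :
    ∃ k : Fin n → ℕ, ∑ i, k i = M ∧ (Matrix.of fun i j => (N i j).coeff (k i)).det ≠ 0 := by
  obtain ⟨B, hB⟩ : ∃ B, ∀ i j, (N i j).natDegree < B := by
    refine ⟨(∑ i, ∑ j, (N i j).natDegree) + 1, fun i j => Nat.lt_succ_of_le ?_⟩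
    exact (Finset.single_le_sum (f := fun j => (N i j).natDegree) (fun _ _ => Nat.zero_le _)
      (Finset.mem_univ j)).trans (Finset.single_le_sum
        (f := fun i => ∑ j, (N i j).natDegree) (fun _ _ => Nat.zero_le _) (Finset.mem_univ i))
  have hrow : N = fun i => ∑ k ∈ Finset.range B,
      ((Polynomial.X : Polynomial R) ^ k) • fun j => Polynomial.C ((N i j).coeff k) := by
    funext i j
    rw [Finset.sum_apply]
    conv_lhs => rw [(N i j).as_sum_range_C_mul_X_pow' (hB i j)]
    exact Finset.sum_congr rfl fun k _ => mul_comm _ _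
  have hdet : N.det = ∑ k ∈ Fintype.piFinset fun _ : Fin n => Finset.range B,
      Polynomial.X ^ (∑ i, k i) *
        Polynomial.C (Matrix.of fun i j => (N i j).coeff (k i)).det := by
    conv_lhs => rw [hrow]
    have h1 := (Matrix.detRowAlternating (n := Fin n) (R := Polynomial R)).toMultilinearMap.map_sum_finset
      (fun i k => ((Polynomial.X : Polynomial R) ^ k) • fun j => Polynomial.C ((N i j).coeff k))
      (fun _ => Finset.range B)
    refine h1.trans (Finset.sum_congr rfl fun k _ => ?_)
    rw [MultilinearMap.map_smul_univ, Finset.prod_pow_eq_pow_sum, smul_eq_mul]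
    congr 1
    rw [RingHom.map_det]
    rfl
  rw [hdet, Polynomial.finsetSum_coeff] at h
  obtain ⟨k, -, hk⟩ := Finset.exists_ne_zero_of_sum_ne_zero h
  rw [Polynomial.coeff_X_pow_mul'] at hk
  split_ifs at hk with hle
  · rw [Polynomial.coeff_C] at hk
    split_ifs at hk with h0
    · exact ⟨k, by omega, hk⟩
    · exact absurd rfl hk
  · exact absurd rfl hk

lemma finSuccEquiv_C (x : K) : finSuccEquiv K r (C x) = Polynomial.C (C x) := by
  simp [MvPolynomial.finSuccEquiv_apply]

lemma finSuccEquiv_linForm (c : Fin (r + 1) → K) :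
    finSuccEquiv K r (linForm c) =
      Polynomial.C (C (c 0)) * Polynomial.X + Polynomial.C (linForm (Fin.tail c)) := by
  simp [linForm, Fin.sum_univ_succ, finSuccEquiv_X_zero, finSuccEquiv_X_succ, Fin.tail, finSuccEquiv_C]

lemma HasExp.filter_zero {s : Finset ι} {a : ι → Fin (r + 1) → K} {m : ι → ℕ}
    {d : Fin (r + 1) → ℕ} (hs : NP s a) (h : HasExp s a m d) :
    ∃ d', HasExp (s.filter fun h => a h 0 = 0) a m d' := by
  obtain ⟨hd, θ, hθ, hhom, h0⟩ := h
  obtain ⟨c, hc, hdet⟩ := det_eq_C_mul_defPoly hs hd hθ hhom h0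
  let N : Matrix (Fin (r + 1)) (Fin (r + 1)) (Polynomial (S K r)) :=
    fun i j => finSuccEquiv K r (θ i j)
  have hN : N.det = finSuccEquiv K r θ.det := by
    have : N = (finSuccEquiv K r).toAlgHom.mapMatrix θ := rfl
    rw [this, ← AlgHom.map_det]
    rfl
  have hN0 : N.det ≠ 0 := by
    rw [hN]
    exact fun h => h0 ((finSuccEquiv K r).injective (h.trans (map_zero _).symm))
  have hdeg : N.det.natDegree = ∑ h ∈ s with a h 0 ≠ 0, m h := by
    have hne : ∀ h ∈ s, finSuccEquiv K r (linForm (a h)) ≠ 0 := fun h hh h0 =>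
      linForm_ne_zero (hs.1 h hh) ((finSuccEquiv K r).injective (h0.trans (map_zero _).symm))
    rw [hN, hdet, map_mul, defPoly, map_prod, finSuccEquiv_C,
      Polynomial.natDegree_C_mul (by simpa using hc)]
    simp only [map_pow]
    rw [Polynomial.natDegree_prod _ _ fun h hh => pow_ne_zero _ (hne h hh), Finset.sum_filter]
    refine Finset.sum_congr rfl fun h hh => ?_
    rw [Polynomial.natDegree_pow, finSuccEquiv_linForm]
    split_ifs with h0
    · rw [Polynomial.natDegree_linear (by simpa using h0), mul_one]
    · rw [not_not.mp h0]
      simp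
  obtain ⟨k, hk, hkdet⟩ := exists_det_coeff_ne_zero N (M := N.det.natDegree)
    (by rw [Polynomial.coeff_natDegree]; exact Polynomial.leadingCoeff_ne_zero.mpr hN0)
  have hkd : ∀ i, k i ≤ d i := by
    intro i
    by_contra hlt
    refine hkdet (Matrix.det_eq_zero_of_row_eq_zero i fun j => ?_)
    refine Polynomial.coeff_eq_zero_of_natDegree_lt (lt_of_eq_of_lt (natDegree_finSuccEquiv _) ?_)
    have h1 := degreeOf_le_totalDegree (θ i j) 0
    have h2 := (hhom i j).totalDegree_le
    omega
  refine ⟨fun i => d i - k i, ?_, fun i j => sig ((N i j).coeff (k i)), fun i h hh => ?_,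
    fun i j => ?_, ?_⟩
  · have h1 : ∑ i, (d i - k i) + ∑ i, k i = ∑ i, d i := by
      rw [← Finset.sum_add_distrib]
      exact Finset.sum_congr rfl fun i _ => Nat.sub_add_cancel (hkd i)
    have h2 := Finset.sum_filter_add_sum_filter_not s (fun h => a h 0 = 0) m
    rw [hk, hdeg, hd, ← h2] at h1
    exact Nat.add_right_cancel h1
  · obtain ⟨hh, ha⟩ := Finset.mem_filter.mp hh
    have hcons : a h = (Fin.cons 0 (Fin.tail (a h)) : Fin (r + 1) → K) := by
      rw [← ha, Fin.cons_self_tail]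
    have h1 := map_dvd (finSuccEquiv K r) (hθ i h hh)
    rw [map_pow, finSuccEquiv_linForm, ha, C_0, Polynomial.C_0, zero_mul, zero_add,
      ← Polynomial.C_pow, Polynomial.C_dvd_iff_dvd_coeff] at h1
    have h2 := map_dvd (sig : S K r →ₐ[K] S K (r + 1)) (h1 (k i))
    rw [map_pow, sig_linForm, ← hcons] at h2
    convert h2 using 1
    have h3 : finSuccEquiv K r (ev (a h) (θ i)) = ev (a h) (N i) :=
      map_ev (finSuccEquiv K r).toAlgHom _ _
    rw [h3]
    simp [ev, Polynomial.finsetSum_coeff]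
  · have h1 := (hhom i j).finSuccEquiv_coeff_isHomogeneous (k i) (d i - k i)
      (Nat.add_sub_cancel' (hkd i))
    exact h1.rename_isHomogeneous
  · have h1 : (fun i j => sig ((N i j).coeff (k i)) : Matrix (Fin (r + 1)) (Fin (r + 1)) _) =
        (sig : S K r →ₐ[K] S K (r + 1)).mapMatrix (Matrix.of fun i j => (N i j).coeff (k i)) := rfl
    rw [h1, ← AlgHom.map_det]
    exact fun h => hkdet (rename_injective _ (Fin.succ_injective r) (h.trans (map_zero _).symm))

/-- Localization at the members vanishing on a vector. -/
lemma HasExp.filter_vector {s : Finset ι} {a : ι → Fin r → K} {m : ι → ℕ}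
    {d : Fin r → ℕ} (hs : NP s a) (h : HasExp s a m d) (v : Fin r → K) :
    ∃ d', HasExp (s.filter fun h => ∑ i, a h i * v i = 0) a m d' := by
  by_cases hv : v = 0
  · refine ⟨d, ?_⟩
    rw [Finset.filter_true_of_mem fun h _ => by simp [hv]]
    exact h
  cases r with
  | zero => exact absurd (Subsingleton.elim _ _) hv
  | succ r =>
    obtain ⟨L, hL⟩ := exists_coordEquiv hv
    obtain ⟨d', hd'⟩ := (h.linearEquiv L).filter_zero
      (hs.comp_injective (J := L.toLinearMap) L.injective)
    have h2 := hd'.linearEquiv L.symm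
    refine ⟨d', ?_⟩
    convert h2 using 2
    · rw [← hL]
      rfl
    · exact (L.symm_apply_apply _).symm

/-- Localization at a subspace of covectors. -/
theorem HasExp.filter_subspace {s : Finset ι} {a : ι → Fin r → K} {m : ι → ℕ}
    {d : Fin r → ℕ} (hs : NP s a) (h : HasExp s a m d) (W : Submodule K (Fin r → K)) :
    ∃ d', HasExp (s.filter fun h => a h ∈ W) a m d' := by
  induction s using Finset.strongInduction generalizing d with
  | H s ih =>
    by_cases hall : ∀ k ∈ s, a k ∈ W
    · rw [Finset.filter_true_of_mem hall]
      exact ⟨d, h⟩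
    push Not at hall
    obtain ⟨k, hk, hkW⟩ := hall
    obtain ⟨f, hf, hfW⟩ := Submodule.exists_le_ker_of_notMem hkW
    obtain ⟨v, hv⟩ := exists_vector_of_functional f
    obtain ⟨d', hd'⟩ := h.filter_vector hs v
    have hsub : (s.filter fun h => ∑ i, a h i * v i = 0) ⊂ s :=
      Finset.filter_ssubset.mpr ⟨k, hk, by rwa [← hv]⟩
    obtain ⟨d'', hd''⟩ := ih _ hsub (hs.mono hsub.1) hd'
    refine ⟨d'', ?_⟩
    rw [Finset.filter_filter] at hd''
    convert hd'' using 2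
    refine ⟨fun h => ⟨?_, h⟩, fun h => h.2⟩
    rw [← hv]
    exact hfW h

end localization

section interpolation
variable {ι : Type*}

/-- Interpolation with prescribed residues modulo powers of linear polynomials. -/
lemma exists_interpolation (s : Finset ι) (a : ι → K) (m : ι → ℕ)
    (hinj : ∀ h ∈ s, ∀ h' ∈ s, a h = a h' → h = h') {m0 : ℕ} (hm0 : 0 < m0)
    (hle : ∑ h ∈ s, m h ≤ m0) :
    ∃ q : Polynomial K, q.natDegree < m0 ∧
      ∀ h ∈ s, (Polynomial.X + Polynomial.C (a h)) ^ m h ∣ q + Polynomial.C (a h) := by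
  have hcop : Pairwise (Function.onFun IsCoprime fun h : s =>
      Ideal.span {(Polynomial.X + Polynomial.C (a h)) ^ m h}) := by
    intro h h' hne
    rw [Function.onFun, Ideal.isCoprime_span_singleton_iff]
    refine IsCoprime.pow ?_
    have hna : -a h ≠ -a h' := fun heq =>
      hne (Subtype.ext (hinj h h.2 h' h'.2 (neg_injective heq)))
    simpa [sub_neg_eq_add] using
      Polynomial.isCoprime_X_sub_C_of_isUnit_sub (sub_ne_zero.mpr hna).isUnit
  obtain ⟨q, hq⟩ := Ideal.exists_forall_sub_mem_ideal hcop fun h => -Polynomial.C (a h)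
  let M := ∏ h ∈ s, (Polynomial.X + Polynomial.C (a h)) ^ m h
  have hM : M.Monic := Polynomial.monic_prod_of_monic _ _ fun h _ =>
    (Polynomial.monic_X_add_C _).pow _
  have hdeg : M.natDegree = ∑ h ∈ s, m h := by
    rw [Polynomial.natDegree_prod_of_monic _ _ fun h _ => (Polynomial.monic_X_add_C _).pow _]
    exact Finset.sum_congr rfl fun h _ => by simp
  refine ⟨q %ₘ M, ?_, fun h hh => ?_⟩
  · by_cases h0 : q %ₘ M = 0
    · rw [h0]; simpa using hm0
    · exact lt_of_lt_of_le (Polynomial.natDegree_lt_natDegree h0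
        (Polynomial.degree_modByMonic_lt q hM)) (hdeg.trans_le hle)
  · have h1 := Ideal.mem_span_singleton.mp (hq ⟨h, hh⟩)
    have h2 : (Polynomial.X + Polynomial.C (a h)) ^ m h ∣ M * (q /ₘ M) :=
      (Finset.dvd_prod_of_mem _ hh).mul_right _
    have h3 := dvd_sub h1 h2
    convert h3 using 1
    nth_rewrite 2 [← Polynomial.modByMonic_add_div q M]
    ring

end interpolation

namespace PD
variable {r : ℕ} {ι κ : Type*} {D : PD K r ι κ} {s : Finset ι}

/-- Interpolating polynomials exist for classes which are singletons or have small total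
multiplicity. -/
lemma exists_interp {s' : Finset ι} {k : κ} (hcl : ∀ h ∈ s', D.cl h = k)
    (hinj : ∀ h ∈ s', ∀ h' ∈ s', D.av h = D.av h' → h = h') (hm0 : 0 < D.m0)
    (hle : s'.card ≤ 1 ∨ ∑ h ∈ s', D.m h ≤ D.m0) :
    ∃ P : S K (r + 1), P.IsHomogeneous D.m0 ∧ rho P = 0 ∧
      ∀ h ∈ s', D.al h ^ D.m h ∣ P + C (D.av h) * X 0 ^ D.m0 := by
  rcases hle with hle | hle
  · rcases s'.eq_empty_or_nonempty with rfl | ⟨h, hh⟩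
    · exact ⟨0, isHomogeneous_zero _ _ _, map_zero _, by simp⟩
    · refine ⟨-(C (D.av h) * X 0 ^ D.m0), ?_, ?_, fun h' hh' => ?_⟩
      · simpa using (((isHomogeneous_C (Fin (r + 1)) (D.av h)).mul
          ((isHomogeneous_X K (0 : Fin (r + 1))).pow D.m0))).neg
      · simp [hm0.ne']
      · rw [Finset.card_le_one.mp hle h' hh' h hh, neg_add_cancel]
        exact dvd_zero _
  · obtain ⟨q, hq, hqs⟩ := exists_interpolation s' D.av D.m hinj hm0 hle
    let y : S K (r + 1) := linForm (Fin.cons 0 (D.β k) : Fin (r + 1) → K)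
    let Φ : MvPolynomial (Fin 2) K →ₐ[K] S K (r + 1) := aeval ![y, X 0]
    have hal : ∀ h ∈ s', D.al h = Φ (X 0 + C (D.av h) * X 1) := by
      intro h hh
      have h1 : D.cov h = (Fin.cons 0 (D.β k) : Fin (r + 1) → K) +
          D.av h • (Fin.cons 1 0 : Fin (r + 1) → K) := by
        rw [cov, hcl h hh]
        funext j
        refine Fin.cases ?_ (fun j => ?_) j <;> simp
      rw [al, h1, linForm_add, linForm_smul, linForm_cons_one_zero]
      simp only [Φ, map_add, map_mul, aeval_X, algHom_C, Matrix.cons_val_zero,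
        Matrix.cons_val_one]
      rfl
    refine ⟨Φ (q.homogenize D.m0), ?_, ?_, fun h hh => ?_⟩
    · have h1 := (Polynomial.isHomogeneous_homogenize (n := D.m0) q).aeval (n := 1) ![y, X 0]
        (S := K) (fun i => ?_)
      · rwa [one_mul] at h1
      · refine Fin.cases (linForm_isHomogeneous _) (fun j => ?_) i
        have : j = 0 := Subsingleton.elim _ _
        subst this
        exact isHomogeneous_X _ _
    · have h1 : (rho.comp Φ : MvPolynomial (Fin 2) K →ₐ[K] S K r) =
          aeval ![linForm (D.β k), 0] := by
        apply algHom_ext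
        intro i
        refine Fin.cases ?_ (fun j => ?_) i
        · simp only [Φ, AlgHom.comp_apply, aeval_X, Matrix.cons_val_zero, y, rho_linForm]
          rfl
        · have : j = 0 := Subsingleton.elim _ _
          subst this
          simp [Φ]
      have h2 := DFunLike.congr_fun h1 (q.homogenize D.m0)
      rw [AlgHom.comp_apply] at h2
      rw [h2, Polynomial.homogenize, map_sum]
      refine Finset.sum_eq_zero fun p hp => ?_
      obtain ⟨i, j⟩ := p
      have hp' : i + j = D.m0 := by simpa using hp
      by_cases hj : j = 0
      · have : q.coeff i = 0 := Polynomial.coeff_eq_zero_of_natDegree_lt (by omega)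
        simp [this]
      · rw [aeval_monomial, Finsupp.prod_fintype _ _ (by simp)]
        simp [Fin.prod_univ_two, hj]
    · obtain ⟨g, hg⟩ := hqs h hh
      have hmh : D.m h ≤ D.m0 := (Finset.single_le_sum (fun _ _ => Nat.zero_le _) hh).trans hle
      have hXdeg : ((Polynomial.X + Polynomial.C (D.av h)) ^ D.m h).natDegree = D.m h := by simp
      have hgdeg : g.natDegree ≤ D.m0 - D.m h := by
        by_cases hg0 : g = 0
        · simp [hg0]
        have h1 := congrArg Polynomial.natDegree hg
        rw [Polynomial.natDegree_add_C, Polynomial.natDegree_mul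
          (pow_ne_zero _ (Polynomial.X_add_C_ne_zero _)) hg0, hXdeg] at h1
        omega
      have h1 := congrArg (fun p => Φ (Polynomial.homogenize p D.m0)) hg
      have h2 : Polynomial.homogenize ((Polynomial.X + Polynomial.C (D.av h)) ^ D.m h) (D.m h) =
          (X 0 + C (D.av h) * X 1) ^ D.m h := by
        refine Polynomial.homogenize_eq_of_isHomogeneous ?_ (by simp)
        have := (((isHomogeneous_X K (0 : Fin 2)).add (by
          simpa using (isHomogeneous_C (Fin 2) (D.av h)).mul
            (isHomogeneous_X K (1 : Fin 2))))).pow (D.m h)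
        rwa [one_mul] at this
      have h3 : D.m0 = D.m h + (D.m0 - D.m h) := by omega
      have h4 : Polynomial.homogenize ((Polynomial.X + Polynomial.C (D.av h)) ^ D.m h * g) D.m0 =
          (X 0 + C (D.av h) * X 1) ^ D.m h * Polynomial.homogenize g (D.m0 - D.m h) := by
        conv_lhs => rw [h3]
        rw [Polynomial.homogenize_mul _ _ hXdeg.le hgdeg, h2]
      simp only [h4, Polynomial.homogenize_add, Polynomial.homogenize_C, map_add, map_mul,
        map_pow] at h1
      have h5 : Φ (C (D.av h)) = C (D.av h) := algHom_C _ _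
      have h6 : Φ (X 1) = X 0 := by simp [Φ]
      rw [h5, h6] at h1
      rw [h1, hal h hh, map_add, map_mul, h5, h6]
      exact dvd_mul_right _ _

end PD

section koszul
variable {R V V' : Type*} [CommRing R] [AddCommGroup V] [Module R V] [AddCommGroup V'] [Module R V']

/-- Exactness in the middle of the Koszul complex of three elements on a submodule. -/
def KosExact (Y : Fin 3 → R) (M : Submodule R V) : Prop :=
  ∀ c ∈ M, ∀ c' ∈ M, ∀ c'' ∈ M, Y 2 • c + Y 0 • c' + Y 1 • c'' = 0 →
    ∃ p0 ∈ M, ∃ p1 ∈ M, ∃ p2 ∈ M, c = Y 1 • p0 - Y 0 • p1 ∧ c' = Y 2 • p1 - Y 1 • p2 ∧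
      c'' = Y 0 • p2 - Y 2 • p0

lemma KosExact.pi {Y : Fin 3 → R} {ι : Type*} (h : KosExact Y (⊤ : Submodule R R)) :
    KosExact Y (⊤ : Submodule R (ι → R)) := by
  intro c _ c' _ c'' _ hc
  have h1 : ∀ i, ∃ p : R × R × R, c i = Y 1 • p.1 - Y 0 • p.2.1 ∧
      c' i = Y 2 • p.2.1 - Y 1 • p.2.2 ∧ c'' i = Y 0 • p.2.2 - Y 2 • p.1 := by
    intro i
    obtain ⟨p0, -, p1, -, p2, -, h⟩ := h (c i) trivial (c' i) trivial (c'' i) trivial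
      (congrFun hc i)
    exact ⟨⟨p0, p1, p2⟩, h⟩
  choose p hp using h1
  exact ⟨fun i => (p i).1, trivial, fun i => (p i).2.1, trivial, fun i => (p i).2.2, trivial,
    funext fun i => (hp i).1, funext fun i => (hp i).2.1, funext fun i => (hp i).2.2⟩

lemma KosExact.map {Y : Fin 3 → R} (h : KosExact Y (⊤ : Submodule R V)) {f : V →ₗ[R] V'}
    (hf : Function.Injective f) : KosExact Y (LinearMap.range f) := by
  rintro _ ⟨c, rfl⟩ _ ⟨c', rfl⟩ _ ⟨c'', rfl⟩ hc
  simp only [← map_smul, ← map_add] at hc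
  obtain ⟨p0, -, p1, -, p2, -, rfl, rfl, rfl⟩ := h c trivial c' trivial c'' trivial
    (hf (hc.trans (map_zero f).symm))
  exact ⟨f p0, ⟨p0, rfl⟩, f p1, ⟨p1, rfl⟩, f p2, ⟨p2, rfl⟩, by simp, by simp, by simp⟩

lemma kosExact_top [IsDomain R] {Y : Fin 3 → R} (h0 : Y 0 ≠ 0)
    (h01 : ∀ p, Y 0 ∣ Y 1 * p → Y 0 ∣ p)
    (h2 : ∀ p, (∃ a b, Y 2 * p = Y 0 * a + Y 1 * b) → ∃ a b, p = Y 0 * a + Y 1 * b) :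
    KosExact Y (⊤ : Submodule R R) := by
  intro c _ c' _ c'' _ hc
  simp only [smul_eq_mul] at hc ⊢
  obtain ⟨a, b, hab⟩ := h2 c ⟨-c', -c'', by linear_combination hc⟩
  have h3 : Y 0 * (c' + Y 2 * a) = -Y 1 * (c'' + Y 2 * b) := by
    rw [hab] at hc
    linear_combination hc
  obtain ⟨q, hq⟩ := h01 (c'' + Y 2 * b) ⟨-(c' + Y 2 * a), by linear_combination h3⟩
  refine ⟨b, trivial, -a, trivial, q, trivial, by rw [hab]; ring, ?_, by linear_combination hq⟩
  apply mul_left_cancel₀ h0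
  rw [hq] at h3
  linear_combination h3

end koszul

section linearForms
variable {r : ℕ}

lemma exists_equiv_single {w : Fin 3 → Fin r → K} (hw : LinearIndependent K w) :
    ∃ (L : (Fin r → K) ≃ₗ[K] (Fin r → K)) (σ : Fin 3 → Fin r), Function.Injective σ ∧
      ∀ i, L (w i) = Pi.single (σ i) 1 := by
  have hli := hw.linearIndepOn_id
  let b := Module.Basis.extend hli
  have hfin : Finite (hli.extend (Set.subset_univ _)) := Module.Finite.finite_basis b
  have := Fintype.ofFinite (hli.extend (Set.subset_univ _))
  have hcard : Fintype.card (hli.extend (Set.subset_univ _)) = Fintype.card (Fin r) := by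
    rw [← Module.finrank_eq_card_basis b]
    simp
  let e := Fintype.equivOfCardEq hcard
  let x : Fin 3 → hli.extend (Set.subset_univ _) := fun i =>
    ⟨w i, hli.subset_extend _ ⟨i, rfl⟩⟩
  refine ⟨(b.reindex e).equivFun, fun i => e (x i),
    fun i j h => hw.injective (congrArg Subtype.val (e.injective h)), fun i => ?_⟩
  have h1 : w i = b.reindex e (e (x i)) := by
    rw [Module.Basis.reindex_apply, Equiv.symm_apply_apply]
    exact (Module.Basis.extend_apply_self hli (x i)).symm
  rw [h1]
  funext j
  rw [Module.Basis.equivFun_apply, Module.Basis.repr_self, Finsupp.single_apply, Pi.single_apply]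
  simp only [eq_comm]

lemma mem_span_X_pow_pair {σ : Type*} {i j : σ} {N : ℕ} {p : MvPolynomial σ K} :
    (∃ a b, p = X i ^ N * a + X j ^ N * b) ↔ ∀ x ∈ p.support, N ≤ x i ∨ N ≤ x j := by
  have h1 : (∃ a b, p = X i ^ N * a + X j ^ N * b) ↔
      p ∈ Ideal.span ((fun s => monomial s (1 : K)) ''
        {Finsupp.single i N, Finsupp.single j N}) := by
    rw [Set.image_pair, Ideal.mem_span_pair, ← X_pow_eq_monomial, ← X_pow_eq_monomial]
    constructor
    · rintro ⟨a, b, h⟩; exact ⟨a, b, by rw [h]; ring⟩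
    · rintro ⟨a, b, h⟩; exact ⟨a, b, by rw [← h]; ring⟩
  rw [h1, mem_ideal_span_monomial_image]
  simp [Finsupp.single_le_iff]

lemma X_pow_regular {σ : Type*} {i j k : σ} (hik : i ≠ k) (hjk : j ≠ k) {N : ℕ}
    {p : MvPolynomial σ K} (h : ∃ a b, X k ^ N * p = X i ^ N * a + X j ^ N * b) :
    ∃ a b, p = X i ^ N * a + X j ^ N * b := by
  rw [mem_span_X_pow_pair] at h ⊢
  intro x hx
  have h1 : x + Finsupp.single k N ∈ (X k ^ N * p).support := by
    rw [mem_support_iff, X_pow_eq_monomial, add_comm, coeff_monomial_mul, one_mul]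
    exact mem_support_iff.mp hx
  simpa [Finsupp.single_apply, hik.symm, hjk.symm] using h _ h1

lemma kosExact_linForm {w : Fin 3 → Fin r → K} (hw : LinearIndependent K w) (N : ℕ) :
    KosExact (fun i => linForm (w i) ^ N) (⊤ : Submodule (S K r) (S K r)) := by
  have h01 : ∀ u : K, w 1 ≠ u • w 0 := by
    intro u hu
    have h1 := Fintype.linearIndependent_iff.mp hw ![u, -1, 0] (by simp [Fin.sum_univ_three, hu]) 1
    simp at h1
  refine kosExact_top (pow_ne_zero _ (linForm_ne_zero (hw.ne_zero 0))) (fun p hp => ?_)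
    fun p hp => ?_
  · exact (isRelPrime_pow_linForm (hw.ne_zero 0) h01 N N).dvd_of_dvd_mul_left hp
  · obtain ⟨L, σ, hσ, hL⟩ := exists_equiv_single hw
    obtain ⟨a, b, hab⟩ := hp
    have h1 := congrArg (covMap L.toLinearMap) hab
    simp only [map_add, map_mul, map_pow, covMap_linForm, LinearEquiv.coe_coe, hL,
      linForm_single] at h1
    obtain ⟨a', b', h2⟩ := X_pow_regular (hσ.ne (by decide)) (hσ.ne (by decide)) ⟨_, _, h1⟩
    refine ⟨covMap L.symm.toLinearMap a', covMap L.symm.toLinearMap b', ?_⟩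
    have h3 := congrArg (covMap L.symm.toLinearMap) h2
    have h4 : ∀ i, L.symm (Pi.single (σ i) 1) = w i := fun i => by rw [← hL, L.symm_apply_apply]
    simpa only [map_add, map_mul, map_pow, ← linForm_single, covMap_linForm, LinearEquiv.coe_coe,
      h4, covMap_comp, LinearEquiv.symm_comp, covMap_id] using h3

lemma HasExp.kosExact {ι : Type*} {s : Finset ι} {a : ι → Fin r → K} {m : ι → ℕ} {d : Fin r → ℕ}
    (hs : NP s a) (h : HasExp s a m d) {Y : Fin 3 → S K r}
    (hY : KosExact Y (⊤ : Submodule (S K r) (S K r))) : KosExact Y (LD s a m) := by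
  obtain ⟨hd, θ, hθ, hhom, h0⟩ := h
  obtain ⟨c, hc, hdet⟩ := det_eq_C_mul_defPoly hs hd hθ hhom h0
  have hinj : Function.Injective θ.vecMulLinear := by
    refine (injective_iff_map_eq_zero _).mpr fun v hv => ?_
    exact Matrix.eq_zero_of_vecMul_eq_zero h0 hv
  have happ : ∀ f, θ.vecMulLinear f = ∑ i, f i • θ i := fun f => by
    funext j
    simp [Matrix.vecMul, dotProduct]
  have hrange : LinearMap.range θ.vecMulLinear = LD s a m := by
    refine le_antisymm ?_ fun b hb => ?_
    · rintro _ ⟨f, rfl⟩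
      rw [happ]
      exact Submodule.sum_mem _ fun i _ => Submodule.smul_mem _ _ (hθ i)
    · obtain ⟨f, hf⟩ := exists_combination_of_mem_LD hs hc hθ hdet hb
      exact ⟨f, (happ f).trans hf.symm⟩
  rw [← hrange]
  exact hY.pi.map hinj

end linearForms

namespace PD
variable {r : ℕ} {ι κ : Type*} {D : PD K r ι κ} {s : Finset ι}

lemma mem_E_iff {v : Fin (r + 1) → S K r} :
    v ∈ D.E s ↔ Fin.tail v ∈ LD D.t D.β (D.mu s) := Iff.rfl

lemma WF.kosExact_E (hD : D.WF s) {e : Fin r → ℕ} (h : HasExp D.t D.β (D.mu s) e)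
    {Y : Fin 3 → S K r} (hY : KosExact Y (⊤ : Submodule (S K r) (S K r))) :
    KosExact Y (D.E s) := by
  intro c hc c' hc' c'' hc'' heq
  obtain ⟨p0, -, p1, -, p2, -, h1, h2, h3⟩ := hY (c 0) trivial (c' 0) trivial (c'' 0) trivial
    (congrFun heq 0)
  obtain ⟨q0, hq0, q1, hq1, q2, hq2, h1', h2', h3'⟩ := h.kosExact hD.np hY _ hc _ hc' _ hc''
    (funext fun j => congrFun heq j.succ)
  refine ⟨Fin.cons p0 q0, mem_E_iff.mpr (by simpa using hq0), Fin.cons p1 q1,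
    mem_E_iff.mpr (by simpa using hq1), Fin.cons p2 q2, mem_E_iff.mpr (by simpa using hq2),
    ?_, ?_, ?_⟩
  · funext j
    exact Fin.cases h1 (fun j => congrFun h1' j) j
  · funext j
    exact Fin.cases h2 (fun j => congrFun h2' j) j
  · funext j
    exact Fin.cases h3 (fun j => congrFun h3' j) j

end PD

namespace PD
variable {r : ℕ} {ι κ : Type*} {D : PD K r ι κ} {s : Finset ι}

/-- The restrictions of reduced logarithmic vector fields. -/
def rhoImg (D : PD K r ι κ) (s : Finset ι) : Submodule (S K r) (Fin (r + 1) → S K r) where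
  carrier := {v | ∃ u ∈ D.Dh s, (fun j => rho (u j)) = v}
  zero_mem' := ⟨0, Submodule.zero_mem _, by funext j; simp⟩
  add_mem' := by
    rintro _ _ ⟨u, hu, rfl⟩ ⟨v, hv, rfl⟩
    exact ⟨u + v, Submodule.add_mem _ hu hv, by funext j; simp⟩
  smul_mem' := by
    rintro g _ ⟨u, hu, rfl⟩
    exact ⟨sig g • u, Submodule.smul_mem _ _ hu, by funext j; simp⟩

lemma mu_mono {s' : Finset ι} (h : s' ⊆ s) (k : κ) : D.mu s' k ≤ D.mu s k :=
  Finset.sum_le_sum_of_subset (Finset.filter_subset_filter _ h)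

lemma E_anti {s' : Finset ι} (h : s' ⊆ s) : D.E s ≤ D.E s' := fun _ hv k hk =>
  (pow_dvd_pow _ (mu_mono h k)).trans (hv k hk)

lemma m_le_mu {h : ι} (hh : h ∈ s) : D.m h ≤ D.mu s (D.cl h) :=
  Finset.single_le_sum (f := D.m) (fun _ _ => Nat.zero_le _) (Finset.mem_filter.mpr ⟨hh, rfl⟩)

/-- If all proper localizations are good, candidates become restrictions after multiplication by
powers of the linear forms in the ambient space of covectors. -/
lemma exists_pow_smul_mem_rhoImg {W : Submodule K (Fin r → K)}
    (hsW : ∀ h ∈ s, D.β (D.cl h) ∈ W)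
    (hgood : ∀ N : Submodule K (Fin r → K), N < W → D.Good (s.filter fun h => D.β (D.cl h) ∈ N))
    {v : Fin (r + 1) → S K r} (hv : v ∈ D.E s) {w : Fin r → K} (hw : w ∈ W) :
    ∃ M, linForm w ^ M • v ∈ D.rhoImg s := by
  let J : Ideal (S K r) := (D.rhoImg s).comap (LinearMap.toSpanSingleton (S K r) _ v)
  suffices h : linForm w ∈ J.radical by
    obtain ⟨M, hM⟩ := h
    exact ⟨M, hM⟩
  rw [Ideal.radical_eq_sInf, Ideal.mem_sInf]
  rintro P ⟨hJP, hP⟩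
  let N : Submodule K (Fin r → K) :=
    { carrier := {w | w ∈ W ∧ linForm w ∈ P}
      zero_mem' := ⟨W.zero_mem, by rw [linForm_zero]; exact P.zero_mem⟩
      add_mem' := fun {x y} hx hy => ⟨W.add_mem hx.1 hy.1, by
        rw [linForm_add]; exact P.add_mem hx.2 hy.2⟩
      smul_mem' := fun c x hx => ⟨W.smul_mem c hx.1, by
        rw [linForm_smul]; exact P.mul_mem_left _ hx.2⟩ }
  have hNW : N ≤ W := fun x hx => hx.1
  by_cases hN : N = W
  · have : w ∈ N := hN ▸ hw
    exact this.2
  exfalso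
  obtain ⟨u, hu, huv⟩ := hgood N (lt_of_le_of_ne hNW hN) v (E_anti (Finset.filter_subset _ _) hv)
  let g : S K (r + 1) := ∏ h ∈ s with ¬ D.β (D.cl h) ∈ N, D.al h ^ D.m h
  have hg : g • u ∈ D.Dh s := by
    intro h hh
    rw [map_smul, smul_eq_mul]
    by_cases hb : D.β (D.cl h) ∈ N
    · exact (hu h (Finset.mem_filter.mpr ⟨hh, hb⟩)).mul_left _
    · exact (Finset.dvd_prod_of_mem (fun h => D.al h ^ D.m h)
        (Finset.mem_filter.mpr ⟨hh, hb⟩)).mul_right _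
  have hgJ : rho g ∈ J := ⟨g • u, hg, by rw [← huv]; funext j; simp⟩
  have hgP := hJP hgJ
  rw [map_prod, hP.prod_mem_iff] at hgP
  obtain ⟨h, hh, hhP⟩ := hgP
  obtain ⟨hhs, hhN⟩ := Finset.mem_filter.mp hh
  rw [map_pow, rho_al] at hhP
  exact hhN ⟨hsW h hhs, hP.mem_of_pow_mem _ hhP⟩

/-- Tuples of residues induced by vector fields. -/
def Qt (D : PD K r ι κ) (s : Finset ι) : Submodule (S K (r + 1)) (s → S K (r + 1)) where
  carrier := {γ | ∃ f, ∀ h : s, D.al h ^ D.m h ∣ γ h - D.bv h f}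
  zero_mem' := ⟨0, fun h => by simp⟩
  add_mem' := by
    rintro γ γ' ⟨f, hf⟩ ⟨f', hf'⟩
    refine ⟨f + f', fun h => ?_⟩
    convert dvd_add (hf h) (hf' h) using 1
    rw [map_add, Pi.add_apply]; ring
  smul_mem' := by
    rintro g γ ⟨f, hf⟩
    refine ⟨g • f, fun h => ?_⟩
    convert (hf h).mul_left g using 1
    rw [map_smul, Pi.smul_apply, smul_eq_mul, smul_eq_mul]; ring

lemma mem_Qt {γ : s → S K (r + 1)} :
    γ ∈ D.Qt s ↔ ∃ f, ∀ h : s, D.al h ^ D.m h ∣ γ h - D.bv h f := Iff.rfl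

/-- Tuples of residues becoming induced by vector fields after multiplication by powers of
given elements. -/
def Qsat (D : PD K r ι κ) (s : Finset ι) (y : Fin 3 → S K (r + 1)) :
    Submodule (S K (r + 1)) (s → S K (r + 1)) where
  carrier := {γ | ∀ i, ∃ N, y i ^ N • γ ∈ D.Qt s}
  zero_mem' := fun i => ⟨0, by simp⟩
  add_mem' := by
    rintro γ γ' h h' i
    obtain ⟨N, hN⟩ := h i
    obtain ⟨N', hN'⟩ := h' i
    refine ⟨N + N', ?_⟩
    have h1 := Submodule.add_mem _ (Submodule.smul_mem _ (y i ^ N') hN)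
      (Submodule.smul_mem _ (y i ^ N) hN')
    convert h1 using 1
    rw [smul_smul, smul_smul, ← pow_add, ← pow_add, add_comm N' N, ← smul_add]
  smul_mem' := by
    rintro g γ h i
    obtain ⟨N, hN⟩ := h i
    exact ⟨N, by rw [smul_comm]; exact Submodule.smul_mem _ g hN⟩

lemma rho_bv (hm0 : 0 < D.m0) (h : ι) (u : Fin (r + 1) → S K (r + 1)) :
    rho (D.bv h u) = ev (D.β (D.cl h)) fun j => rho (u j.succ) := by
  rw [bv_apply, map_add, map_mul, map_mul, map_pow, rho_X_zero, zero_pow hm0.ne', zero_mul,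
    mul_zero, zero_add, map_ev]

lemma exists_of_rho_dvd {h : ι} {p : S K (r + 1)}
    (hp : linForm (D.β (D.cl h)) ^ D.m h ∣ rho p) :
    ∃ q, D.al h ^ D.m h ∣ p - X 0 * q := by
  obtain ⟨q, hq⟩ := hp
  have h1 : (X 0 : S K (r + 1)) ∣ p - D.al h ^ D.m h * sig q := by
    refine X_zero_dvd_of_rho_eq_zero ?_
    rw [map_sub, map_mul, map_pow, rho_al, rho_sig, hq, sub_self]
  obtain ⟨g, hg⟩ := h1
  exact ⟨g, sig q, by linear_combination hg⟩

lemma isRelPrime_al_X (hb : D.β (D.cl h) ≠ 0) (m : ℕ) : IsRelPrime (D.al h ^ m) (X 0) := by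
  have h0 : (Fin.cons 1 0 : Fin (r + 1) → K) ≠ 0 := fun h =>
    one_ne_zero (α := K) (by simpa using congrFun h 0)
  have := isRelPrime_pow_linForm (c := (Fin.cons 1 0 : Fin (r + 1) → K)) (c' := D.cov h) h0
    (fun u hu => hb (by
      funext j
      simpa [cov] using congrFun hu j.succ)) 1 m
  rw [pow_one, linForm_cons_one_zero] at this
  exact this.symm

/-- Dividing a residue tuple of a candidate by the first coordinate. -/
lemma WF.exists_pow_smul_mem_Qt (hD : D.WF s) {y : S K (r + 1)} {g : Fin (r + 1) → S K (r + 1)}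
    {M : ℕ} (hM : rho y ^ M • (fun j => rho (g j)) ∈ D.rhoImg s) {c : S K (r + 1)}
    {γ : s → S K (r + 1)}
    (hγ : ∀ h : s, D.al h ^ D.m h ∣ X 0 * (c * γ h) - D.bv h g) :
    y ^ M • c • γ ∈ D.Qt s := by
  obtain ⟨u, hu, huM⟩ := hM
  have h1 : ∀ j, (X 0 : S K (r + 1)) ∣ (y ^ M • g - u) j := fun j => by
    refine X_zero_dvd_of_rho_eq_zero ?_
    have := congrFun huM j
    simp only [Pi.smul_apply, smul_eq_mul] at this
    rw [Pi.sub_apply, Pi.smul_apply, smul_eq_mul, map_sub, map_mul, map_pow, this, sub_self]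
  choose f hf using h1
  have hf' : y ^ M • g = u + (X 0 : S K (r + 1)) • f := by
    funext j
    have := hf j
    simp only [Pi.add_apply, Pi.sub_apply, Pi.smul_apply, smul_eq_mul] at this ⊢
    rw [← this]
    ring
  refine ⟨f, fun h => ?_⟩
  refine (isRelPrime_al_X (hD.np.1 _ (hD.cl_mem h h.2)) (D.m h)).dvd_of_dvd_mul_left ?_
  have h2 := congrArg (D.bv h) hf'
  rw [map_smul, map_add, map_smul, smul_eq_mul, smul_eq_mul] at h2
  have h3 := dvd_add ((hγ h).mul_left (y ^ M)) (hu h h.2)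
  convert h3 using 1
  simp only [Pi.smul_apply, smul_eq_mul]
  linear_combination h2

lemma linForm_rel {w : Fin 3 → Fin r → K} (hw : LinearIndependent K w) {i j : Fin 3} (hij : i ≠ j)
    (u : K) : w j ≠ u • w i := by
  intro hu
  have h1 := Fintype.linearIndependent_iff.mp hw (Pi.single i u - Pi.single j 1) (by
    simp [sub_smul, Finset.sum_sub_distrib, Pi.single_apply, ite_smul, hu])
  have h2 := h1 j
  simp [hij.symm] at h2

lemma exists_not_smul {w : Fin 3 → Fin r → K} (hw : LinearIndependent K w) (b : Fin r → K) :
    ∃ i, ∀ u : K, w i ≠ u • b := by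
  by_contra hcon
  push Not at hcon
  obtain ⟨u, hu⟩ := hcon 0
  obtain ⟨u', hu'⟩ := hcon 1
  have h1 := Fintype.linearIndependent_iff.mp hw ![u', -u, 0] (by
    simp [Fin.sum_univ_three, hu, hu', smul_smul, mul_comm])
  have h2 : u' = 0 := by simpa using h1 0
  exact hw.ne_zero 1 (by rw [hu', h2, zero_smul])

/-- Gluing of vector fields whose cross differences are candidates. -/
lemma WF.exists_sub_mem_E (hD : D.WF s) {e : Fin r → ℕ} (hE : HasExp D.t D.β (D.mu s) e)
    {w : Fin 3 → Fin r → K} (hw : LinearIndependent K w) (N : ℕ)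
    (g : Fin 3 → Fin (r + 1) → S K r)
    (hg : ∀ i j, linForm (w j) ^ N • g i - linForm (w i) ^ N • g j ∈ D.E s) :
    ∃ f, ∀ i, g i - linForm (w i) ^ N • f ∈ D.E s := by
  obtain ⟨a0, ha0, a1, ha1, a2, ha2, h01, h12, h20⟩ :=
    hD.kosExact_E hE (kosExact_linForm hw N) _ (hg 0 1) _ (hg 1 2) _ (hg 2 0) (by
      simp only [smul_sub, smul_smul]
      rw [mul_comm (linForm (w 2) ^ N) (linForm (w 1) ^ N),
        mul_comm (linForm (w 0) ^ N) (linForm (w 2) ^ N),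
        mul_comm (linForm (w 1) ^ N) (linForm (w 0) ^ N)]
      abel)
  have h0 : linForm (w 0) ^ N ≠ 0 := pow_ne_zero _ (linForm_ne_zero (hw.ne_zero 0))
  have hdvd : ∀ k, linForm (w 0) ^ N ∣ g 0 k - a0 k := by
    intro k
    refine (isRelPrime_pow_linForm (hw.ne_zero 0)
      (linForm_rel hw (by decide : (0 : Fin 3) ≠ 1)) N N).dvd_of_dvd_mul_left ⟨g 1 k - a1 k, ?_⟩
    have := congrFun h01 k
    simp only [Pi.sub_apply, Pi.smul_apply, smul_eq_mul] at this ⊢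
    linear_combination this
  choose f hf using hdvd
  have hf0 : g 0 - linForm (w 0) ^ N • f = a0 := by
    funext k
    simp only [Pi.sub_apply, Pi.smul_apply, smul_eq_mul]
    linear_combination hf k
  have hf1 : g 1 - linForm (w 1) ^ N • f = a1 := by
    funext k
    apply mul_left_cancel₀ h0
    have := congrFun h01 k
    simp only [Pi.sub_apply, Pi.smul_apply, smul_eq_mul] at this ⊢
    linear_combination linForm (w 1) ^ N * hf k - this
  have hf2 : g 2 - linForm (w 2) ^ N • f = a2 := by
    funext k
    apply mul_left_cancel₀ h0
    have := congrFun h20 k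
    simp only [Pi.sub_apply, Pi.smul_apply, smul_eq_mul] at this ⊢
    linear_combination linForm (w 2) ^ N * hf k + this
  refine ⟨f, fun i => ?_⟩
  fin_cases i
  · exact hf0 ▸ ha0
  · exact hf1 ▸ ha1
  · exact hf2 ▸ ha2

lemma exists_common_pow {y : Fin 3 → S K (r + 1)} {γ : s → S K (r + 1)} (hγ : γ ∈ D.Qsat s y) :
    ∃ N, ∀ i, y i ^ N • γ ∈ D.Qt s := by
  choose N hN using hγ
  refine ⟨∑ i, N i, fun i => ?_⟩
  rw [← Nat.sub_add_cancel (Finset.single_le_sum (f := N) (fun _ _ => Nat.zero_le _)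
    (Finset.mem_univ i)), pow_add, mul_smul]
  exact Submodule.smul_mem _ _ (hN i)

lemma WF.Qsat_le (hD : D.WF s) (hm0 : 0 < D.m0) {e : Fin r → ℕ}
    (hE : HasExp D.t D.β (D.mu s) e) {w : Fin 3 → Fin r → K} (hw : LinearIndependent K w)
    {y : Fin 3 → S K (r + 1)} (hy : ∀ i, rho (y i) = linForm (w i))
    (hpow : ∀ v ∈ D.E s, ∀ i, ∃ M, rho (y i) ^ M • v ∈ D.rhoImg s) :
    D.Qsat s y ≤ D.Qt s ⊔ Ideal.span {(X 0 : S K (r + 1))} • D.Qsat s y := by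
  intro γ hγ
  obtain ⟨N, hN⟩ := exists_common_pow hγ
  choose g hg using hN
  obtain ⟨f, hf⟩ := hD.exists_sub_mem_E hE hw N (fun i k => rho (g i k)) fun i j => by
    have h1 : y j ^ N • g i - y i ^ N • g j ∈ D.Dh s := by
      intro h hh
      have h2 := dvd_sub ((hg j ⟨h, hh⟩).mul_left (y i ^ N))
        ((hg i ⟨h, hh⟩).mul_left (y j ^ N))
      convert h2 using 1
      simp only [map_sub, map_smul, Pi.smul_apply, smul_eq_mul]
      ring
    convert hD.rho_mem_E h1 using 1
    funext k
    simp [hy]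
  let fh : Fin (r + 1) → S K (r + 1) := fun k => sig (f k)
  have hred : ∀ h : s, ∃ q, D.al h ^ D.m h ∣ (γ h - D.bv h fh) - X 0 * q := by
    intro h
    have hb := hD.np.1 _ (hD.cl_mem h h.2)
    obtain ⟨i, hi⟩ := exists_not_smul hw (D.β (D.cl h))
    refine exists_of_rho_dvd ?_
    refine (isRelPrime_pow_linForm hb hi (D.m h) N).dvd_of_dvd_mul_left ?_
    have h1 := map_dvd (rho : S K (r + 1) →ₐ[K] S K r) (hg i h)
    rw [map_pow, rho_al, Pi.smul_apply, smul_eq_mul, map_sub, map_mul, map_pow, hy,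
      rho_bv hm0] at h1
    have h2 := (pow_dvd_pow (linForm (D.β (D.cl h))) (m_le_mu h.2)).trans
      (hf i _ (hD.cl_mem h h.2))
    have h3 := dvd_add h1 h2
    rw [map_sub, rho_bv hm0]
    convert h3 using 1
    have h4 : (fun j : Fin r => ((fun k => rho (g i k)) - linForm (w i) ^ N • f) j.succ) =
        (fun j : Fin r => rho (g i j.succ)) - linForm (w i) ^ N • fun j : Fin r => f j.succ := rfl
    rw [h4, ev_sub, ev_smul]
    simp only [fh, rho_sig]
    ring
  choose γ' hγ' using hred
  have hmem : γ' ∈ D.Qsat s y := by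
    intro i
    obtain ⟨M, hM⟩ := hpow _ (hf i) i
    refine ⟨M + N, ?_⟩
    rw [pow_add, mul_smul]
    refine hD.exists_pow_smul_mem_Qt (g := g i - y i ^ N • fh) ?_ fun h => ?_
    · convert hM using 2
      funext k
      simp only [Pi.sub_apply, Pi.smul_apply, smul_eq_mul, map_sub, map_mul, map_pow, hy, fh,
        rho_sig]
    · have h1 := dvd_sub (hg i h) ((hγ' h).mul_left (y i ^ N))
      convert h1 using 1
      rw [map_sub, map_smul, Pi.smul_apply, smul_eq_mul, smul_eq_mul]
      ring
  refine Submodule.mem_sup.mpr ⟨γ - (X 0 : S K (r + 1)) • γ', ⟨fh, fun h => ?_⟩,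
    (X 0 : S K (r + 1)) • γ',
    Submodule.smul_mem_smul (Ideal.mem_span_singleton_self _) hmem, by abel⟩
  convert hγ' h using 1
  rw [Pi.sub_apply, Pi.smul_apply, smul_eq_mul]
  ring

lemma exists_smul_mem_Qt {y : Fin 3 → S K (r + 1)}
    (h : D.Qsat s y ≤ D.Qt s ⊔ Ideal.span {(X 0 : S K (r + 1))} • D.Qsat s y) :
    ∃ z : S K (r + 1), rho z = 1 ∧ ∀ γ ∈ D.Qsat s y, z • γ ∈ D.Qt s := by
  obtain ⟨z, hz, hzQ⟩ := Submodule.exists_sub_one_mem_and_smul_le_of_fg_of_le_sup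
    (IsNoetherian.noetherian (D.Qsat s y)) le_rfl h
  refine ⟨z, ?_, fun γ hγ => hzQ (Submodule.smul_mem_pointwise_smul γ z _ hγ)⟩
  obtain ⟨q, hq⟩ := Ideal.mem_span_singleton.mp hz
  rw [sub_eq_iff_eq_add.mp hq]
  simp

lemma exists_rho_eq {k : ℕ} (v : Fin k → S K r) :
    ∃ u : Fin k → S K (r + 1), (fun j => rho (u j)) = v := by
  refine ⟨fun j => sig (v j), ?_⟩
  funext j
  rw [rho_sig]

lemma WF.exists_reduction (hD : D.WF s) (hm0 : 0 < D.m0) {v : Fin (r + 1) → S K r}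
    (hv : v ∈ D.E s) {vh : Fin (r + 1) → S K (r + 1)} (hvh : (fun j => rho (vh j)) = v) (h : s) :
    ∃ q, D.al h ^ D.m h ∣ D.bv h vh - X 0 * q := by
  refine exists_of_rho_dvd ?_
  rw [rho_bv hm0]
  have h2 := (pow_dvd_pow (linForm (D.β (D.cl h))) (m_le_mu h.2)).trans
    (hv _ (hD.cl_mem h h.2))
  subst hvh
  exact h2

lemma WF.reduction_mem_Qsat (hD : D.WF s) {y : Fin 3 → S K (r + 1)}
    {vh : Fin (r + 1) → S K (r + 1)}
    (hpow : ∀ i, ∃ M, rho (y i) ^ M • (fun j => rho (vh j)) ∈ D.rhoImg s)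
    {γ : s → S K (r + 1)} (hγ : ∀ h : s, D.al h ^ D.m h ∣ D.bv h vh - X 0 * γ h) :
    γ ∈ D.Qsat s y := by
  intro i
  obtain ⟨M, hM⟩ := hpow i
  refine ⟨M, ?_⟩
  have h1 := hD.exists_pow_smul_mem_Qt (c := 1) hM (γ := γ) fun h => by
    rw [one_mul]
    exact (dvd_sub_comm).mp (hγ h)
  rwa [one_smul] at h1

/-- Goodness propagates from proper localizations in rank at least three. -/
theorem WF.good_of_forall_lt (hD : D.WF s) (hm0 : 0 < D.m0) {e : Fin r → ℕ}
    (hE : HasExp D.t D.β (D.mu s) e) {W : Submodule K (Fin r → K)}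
    (hsW : ∀ h ∈ s, D.β (D.cl h) ∈ W)
    (hgood : ∀ N : Submodule K (Fin r → K), N < W → D.Good (s.filter fun h => D.β (D.cl h) ∈ N))
    {w : Fin 3 → Fin r → K} (hw : LinearIndependent K w) (hwW : ∀ i, w i ∈ W) : D.Good s := by
  obtain ⟨y, hy⟩ : ∃ y : Fin 3 → S K (r + 1), ∀ i, rho (y i) = linForm (w i) :=
    ⟨fun i => sig (linForm (w i)), fun i => rho_sig _⟩
  have hpow : ∀ v ∈ D.E s, ∀ i, ∃ M, rho (y i) ^ M • v ∈ D.rhoImg s := fun v hv i => by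
    rw [hy]; exact exists_pow_smul_mem_rhoImg hsW hgood hv (hwW i)
  obtain ⟨z, hz, hzQ⟩ := exists_smul_mem_Qt (hD.Qsat_le hm0 hE hw hy hpow)
  intro v hv
  obtain ⟨vh, hvh⟩ := exists_rho_eq v
  choose γ hγ using hD.exists_reduction hm0 hv hvh
  have hmem : γ ∈ D.Qsat s y := hD.reduction_mem_Qsat (fun i => by rw [hvh]; exact hpow v hv i) hγ
  obtain ⟨f, hf⟩ := mem_Qt.mp (hzQ γ hmem)
  refine ⟨z • vh - (X 0 : S K (r + 1)) • f, fun h hh => ?_, ?_⟩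
  · have h1 := dvd_add ((hγ ⟨h, hh⟩).mul_left z) ((hf ⟨h, hh⟩).mul_left (X 0))
    convert h1 using 1
    rw [map_sub, map_smul, map_smul, Pi.smul_apply, smul_eq_mul, smul_eq_mul, smul_eq_mul]
    ring
  · rw [← hvh]
    funext j
    rw [Pi.sub_apply, Pi.smul_apply, Pi.smul_apply, smul_eq_mul, smul_eq_mul, map_sub, map_mul,
      map_mul, rho_X_zero, zero_mul, sub_zero, hz, one_mul]

end PD

namespace PD
variable {r : ℕ} {ι κ : Type*} {D : PD K r ι κ} {s : Finset ι}

lemma mu_filter_of_mem {W : Submodule K (Fin r → K)} {k : κ} (hk : D.β k ∈ W) :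
    D.mu (s.filter fun h => D.β (D.cl h) ∈ W) k = D.mu s k := by
  rw [mu, mu, Finset.filter_filter]
  refine Finset.sum_congr (Finset.filter_congr fun h _ => ?_) fun _ _ => rfl
  exact ⟨fun h => h.2, fun h => ⟨h ▸ hk, h⟩⟩

lemma mu_filter_of_notMem {W : Submodule K (Fin r → K)} {k : κ} (hk : D.β k ∉ W) :
    D.mu (s.filter fun h => D.β (D.cl h) ∈ W) k = 0 := by
  rw [mu, Finset.filter_filter, Finset.filter_eq_empty_iff.mpr, Finset.sum_empty]
  rintro h - ⟨h1, h2⟩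
  exact hk (h2 ▸ h1)

/-- Localizing the family localizes its restriction. -/
lemma hasExp_mu_filter (hnp : NP D.t D.β) {e : Fin r → ℕ} (hE : HasExp D.t D.β (D.mu s) e)
    (W : Submodule K (Fin r → K)) :
    ∃ e', HasExp D.t D.β (D.mu (s.filter fun h => D.β (D.cl h) ∈ W)) e' := by
  obtain ⟨e', he'⟩ := hE.filter_subspace hnp W
  refine ⟨e', he'.congr ?_ fun k hk => ?_⟩
  · rw [Finset.sum_filter]
    refine Finset.sum_congr rfl fun k _ => ?_
    split_ifs with h
    · exact mu_filter_of_mem h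
    · exact mu_filter_of_notMem h
  · by_cases h : D.β k ∈ W
    · exact Or.inr ⟨k, Finset.mem_filter.mpr ⟨hk, h⟩, (mu_filter_of_mem h).symm, 1, one_ne_zero,
        (one_smul _ _).symm⟩
    · exact Or.inl (mu_filter_of_notMem h)

/-- Goodness can be checked on localizations of rank at most two. -/
theorem WF.good_of_finrank_le_two (hD : D.WF s) (hm0 : 0 < D.m0) {e : Fin r → ℕ}
    (hE : HasExp D.t D.β (D.mu s) e)
    (h2 : ∀ W : Submodule K (Fin r → K), Module.finrank K W ≤ 2 →
      D.Good (s.filter fun h => D.β (D.cl h) ∈ W)) : D.Good s := by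
  have key : ∀ n, ∀ W : Submodule K (Fin r → K), Module.finrank K W = n →
      D.Good (s.filter fun h => D.β (D.cl h) ∈ W) := by
    intro n
    induction n using Nat.strong_induction_on with
    | _ n ih =>
      intro W hW
      by_cases hn : n ≤ 2
      · exact h2 W (hW ▸ hn)
      obtain ⟨e', he'⟩ := hasExp_mu_filter hD.np hE W
      obtain ⟨b⟩ : Nonempty (Module.Basis (Fin (Module.finrank K W)) K W) :=
        ⟨Module.finBasis K W⟩
      have hle : 3 ≤ Module.finrank K W := by omega
      refine (hD.mono (Finset.filter_subset _ _)).good_of_forall_lt hm0 he' (W := W)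
        (fun h hh => (Finset.mem_filter.mp hh).2) (fun N hN => ?_)
        (w := fun i => (b (Fin.castLE hle i) : Fin r → K)) ?_ fun i => (b _).2
      · have hlt := Submodule.finrank_lt_finrank_of_lt hN
        have := ih _ (hW ▸ hlt) N rfl
        rwa [Finset.filter_filter, Finset.filter_congr (q := fun h => D.β (D.cl h) ∈ N)
          fun h _ => ⟨fun h => h.2, fun h => ⟨hN.le h, h⟩⟩]
      · exact (b.linearIndependent.map' W.subtype W.ker_subtype).comp _
          (Fin.castLE_injective hle)
  have := key _ ⊤ rfl
  rwa [Finset.filter_true_of_mem fun _ _ => Submodule.mem_top] at this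

end PD

section degree
variable {r : ℕ}

/-- Polynomials of degree less than `n`. -/
noncomputable def degLT (K : Type*) [Field K] (r n : ℕ) : Submodule K (S K r) :=
  restrictSupport K {x | x.degree < n}

lemma mem_degLT {n : ℕ} {f : S K r} : f ∈ degLT K r n ↔ ∀ x, coeff x f ≠ 0 → x.degree < n := by
  rw [degLT, mem_restrictSupport_iff]
  exact ⟨fun h x hx => h (mem_support_iff.mpr hx), fun h x hx => h x (mem_support_iff.mp hx)⟩

lemma mem_degLT_iff_homogeneousComponent {n : ℕ} {f : S K r} :
    f ∈ degLT K r n ↔ ∀ j, n ≤ j → homogeneousComponent j f = 0 := by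
  rw [mem_degLT]
  constructor
  · intro h j hj
    ext x
    rw [coeff_homogeneousComponent, coeff_zero]
    split_ifs with hx
    · by_contra hc
      have := h x hc
      omega
    · rfl
  · intro h x hx
    by_contra hc
    have := congrArg (coeff x) (h x.degree (not_lt.mp hc))
    rw [coeff_homogeneousComponent, if_pos rfl, coeff_zero] at this
    exact hx this

lemma degLT_mono {n n' : ℕ} (h : n ≤ n') : degLT K r n ≤ degLT K r n' :=
  restrictSupport_mono _ fun _ hx => lt_of_lt_of_le hx h

lemma mem_degLT_succ {n : ℕ} {f : S K r} : f ∈ degLT K r (n + 1) ↔ f.totalDegree ≤ n := by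
  rw [mem_degLT]
  constructor
  · intro h
    refine Finset.sup_le fun x hx => Nat.lt_succ_iff.mp ?_
    have := h x (mem_support_iff.mp hx)
    rwa [Finsupp.degree_eq_sum, ← Finsupp.sum_fintype x (fun _ e => e) (fun _ => rfl)] at this
  · intro h x hx
    have := (le_totalDegree (mem_support_iff.mpr hx)).trans h
    rw [Finsupp.sum_fintype x (fun _ e => e) (fun _ => rfl), ← Finsupp.degree_eq_sum] at this
    omega

lemma totalDegree_lt_of_mem_degLT {n : ℕ} {f : S K r} (hf : f ∈ degLT K r n) (h0 : f ≠ 0) :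
    f.totalDegree < n := by
  rcases n with _ | n
  · obtain ⟨x, hx⟩ := exists_coeff_ne_zero h0
    exact absurd (mem_degLT.mp hf x hx) (Nat.not_lt_zero _)
  · exact Nat.lt_succ_iff.mpr (mem_degLT_succ.mp hf)

lemma mem_degLT_of_totalDegree_lt {n : ℕ} {f : S K r} (hf : f.totalDegree < n) :
    f ∈ degLT K r n :=
  degLT_mono hf (mem_degLT_succ.mpr le_rfl)

lemma mem_degLT_of_isHomogeneous {n d : ℕ} {f : S K r} (hf : f.IsHomogeneous d) (hd : d < n) :
    f ∈ degLT K r n :=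
  mem_degLT_of_totalDegree_lt (hf.totalDegree_le.trans_lt hd)

lemma mul_mem_degLT {a b : ℕ} {f g : S K r} (hf : f.totalDegree ≤ a) (hg : g ∈ degLT K r b) :
    f * g ∈ degLT K r (a + b) := by
  by_cases h0 : g = 0
  · rw [h0, mul_zero]; exact Submodule.zero_mem _
  · have := totalDegree_lt_of_mem_degLT hg h0
    exact mem_degLT_of_totalDegree_lt ((totalDegree_mul _ _).trans_lt (by omega))

lemma mem_degLT_of_mul_mem {n : ℕ} {f g : S K r} (hf : f ≠ 0) (h : f * g ∈ degLT K r n) :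
    g ∈ degLT K r (n - f.totalDegree) := by
  by_cases h0 : g = 0
  · rw [h0]; exact Submodule.zero_mem _
  · have := totalDegree_lt_of_mem_degLT h (mul_ne_zero hf h0)
    rw [totalDegree_mul_of_isDomain hf h0] at this
    exact mem_degLT_of_totalDegree_lt (by omega)

lemma ev_mem_degLT {n : ℕ} (c : Fin r → K) {θ : Fin r → S K ℓ} (h : ∀ j, θ j ∈ degLT K ℓ n) :
    ev c θ ∈ degLT K ℓ n :=
  Submodule.sum_mem _ fun j _ => Submodule.smul_mem _ _ (h j)

lemma exists_mem_degLT {ι : Type*} [Finite ι] (f : ι → S K r) : ∃ n, ∀ i, f i ∈ degLT K r n := by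
  have := Fintype.ofFinite ι
  refine ⟨∑ i, (f i).totalDegree + 1, fun i => mem_degLT_of_totalDegree_lt ?_⟩
  exact Nat.lt_succ_iff.mpr
    (Finset.single_le_sum (f := fun i => (f i).totalDegree) (fun _ _ => Nat.zero_le _)
      (Finset.mem_univ i))

/-- `g` is the homogeneous part of degree `n` of `f`, and `f` has no higher part. -/
def IsTop (f g : S K r) (n : ℕ) : Prop := g.IsHomogeneous n ∧ f - g ∈ degLT K r n

lemma IsTop.totalDegree_le {f g : S K r} {n : ℕ} (h : IsTop f g n) : f.totalDegree ≤ n := by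
  rw [← mem_degLT_succ, ← sub_add_cancel f g]
  exact Submodule.add_mem _ (degLT_mono n.le_succ h.2)
    (mem_degLT_of_isHomogeneous h.1 n.lt_succ_self)

lemma IsTop.mul {f g f' g' : S K r} {n n' : ℕ} (h : IsTop f g n) (h' : IsTop f' g' n') :
    IsTop (f * f') (g * g') (n + n') := by
  refine ⟨h.1.mul h'.1, ?_⟩
  have : f * f' - g * g' = f * (f' - g') + g' * (f - g) := by ring
  rw [this]
  refine Submodule.add_mem _ (mul_mem_degLT h.totalDegree_le h'.2) ?_
  rw [add_comm n]
  exact mul_mem_degLT h'.1.totalDegree_le h.2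

lemma IsTop.one : IsTop (1 : S K r) 1 0 :=
  ⟨isHomogeneous_one _ _, by rw [sub_self]; exact Submodule.zero_mem _⟩

lemma IsTop.pow {f g : S K r} {n : ℕ} (h : IsTop f g n) (k : ℕ) :
    IsTop (f ^ k) (g ^ k) (k * n) := by
  induction k with
  | zero => simpa using IsTop.one
  | succ k ih => rw [pow_succ, pow_succ, Nat.succ_mul]; exact ih.mul h

lemma IsTop.prod {ι : Type*} (s : Finset ι) {f g : ι → S K r} {n : ι → ℕ}
    (h : ∀ i ∈ s, IsTop (f i) (g i) (n i)) :
    IsTop (∏ i ∈ s, f i) (∏ i ∈ s, g i) (∑ i ∈ s, n i) := by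
  induction s using Finset.induction_on with
  | empty => simpa using IsTop.one
  | insert a s ha ih =>
    rw [Finset.prod_insert ha, Finset.prod_insert ha, Finset.sum_insert ha]
    exact (h a (Finset.mem_insert_self _ _)).mul
      (ih fun i hi => h i (Finset.mem_insert_of_mem hi))

lemma IsTop.aff (c : Fin r → K) (a : K) : IsTop (aff c a) (linForm c) 1 := by
  refine ⟨linForm_isHomogeneous c, ?_⟩
  rw [ArrPaper.aff, add_sub_cancel_left]
  exact mem_degLT_of_totalDegree_lt (by simp)

lemma IsTop.totalDegree_eq {f g : S K r} {n : ℕ} (h : IsTop f g n) (hg : g ≠ 0) :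
    f.totalDegree = n := by
  refine le_antisymm h.totalDegree_le (not_lt.mp fun hlt => ?_)
  have h1 := Submodule.sub_mem _ (mem_degLT_of_totalDegree_lt hlt) h.2
  rw [sub_sub_cancel] at h1
  have := totalDegree_lt_of_mem_degLT h1 hg
  rw [h.1.totalDegree hg] at this
  exact lt_irrefl _ this

/-- The substitution translating by a point. -/
noncomputable def translate (p : Fin r → K) : S K r →ₐ[K] S K r := aeval fun i => X i - C (p i)

lemma translate_X (p : Fin r → K) (i : Fin r) : translate p (X i) = X i - C (p i) := aeval_X _ _

lemma IsTop.translate (p : Fin r → K) {f : S K r} {n : ℕ} (hf : f.IsHomogeneous n) :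
    IsTop (ArrPaper.translate p f) f n := by
  refine ⟨hf, ?_⟩
  have hsum : ArrPaper.translate p f - f = ∑ x ∈ f.support,
      (ArrPaper.translate p (monomial x (coeff x f)) - monomial x (coeff x f)) := by
    rw [Finset.sum_sub_distrib, ← map_sum, ← f.as_sum]
  rw [hsum]
  refine Submodule.sum_mem _ fun x hx => ?_
  have hdeg : x.degree = n := by
    have := hf (mem_support_iff.mp hx)
    rwa [Pi.one_def, ← Finsupp.degree_eq_weight_one] at this
  have htop : IsTop (∏ i, (X i - C (p i)) ^ x i : S K r) (∏ i, X i ^ x i) (∑ i, x i * 1) :=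
    IsTop.prod _ fun i _ => IsTop.pow ⟨isHomogeneous_X _ _, by
      rw [sub_sub_cancel_left]
      exact Submodule.neg_mem _ (mem_degLT_of_totalDegree_lt (by simp))⟩ _
  simp only [mul_one, ← Finsupp.degree_eq_sum, hdeg] at htop
  have h1 : ArrPaper.translate p (monomial x (coeff x f)) =
      coeff x f • ∏ i, (X i - C (p i)) ^ x i := by
    rw [ArrPaper.translate, aeval_monomial, Finsupp.prod_fintype _ _ fun i => pow_zero _,
      Algebra.smul_def]
  have h2 : monomial x (coeff x f) = coeff x f • (∏ i, X i ^ x i : S K r) := by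
    rw [monomial_eq, Finsupp.prod_fintype _ _ fun i => pow_zero _, smul_eq_C_mul]
  rw [h1, h2, ← smul_sub]
  exact Submodule.smul_mem _ _ htop.2

lemma card_degree_lt_two (n : ℕ) :
    2 * Nat.card {x : Fin 2 →₀ ℕ | x.degree < n} = n * (n + 1) := by
  have h : {x : Fin 2 →₀ ℕ | x.degree < n} =
      ((Finset.range n).biUnion fun j => Finset.finsuppAntidiag (Finset.univ : Finset (Fin 2)) j :
        Finset (Fin 2 →₀ ℕ)) := by
    ext x
    simp [Finset.mem_finsuppAntidiag, Finsupp.degree_eq_sum]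
  rw [h, Nat.card_coe_set_eq, Set.ncard_coe_finset, Finset.card_biUnion]
  · clear h
    simp only [Finset.card_finsuppAntidiag_nat_eq_choose]
    induction n with
    | zero => simp
    | succ n ih =>
      rw [Finset.sum_range_succ, mul_add, ih, Finset.card_univ, Fintype.card_fin]
      have h2 : 2 + n - 1 = n + 1 := by omega
      rw [h2, Nat.choose_succ_self_right]
      ring
  · intro i _ j _ hij
    refine Finset.disjoint_left.mpr fun x hx hx' => ?_
    rw [Finset.mem_finsuppAntidiag] at hx hx'
    exact hij (hx.1.symm.trans hx'.1)

instance degLT_finite (n : ℕ) : Module.Finite K (degLT K r n) := by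
  have : Finite {x : Fin r →₀ ℕ | x.degree < n} := Finsupp.finite_of_degree_lt n
  exact Module.Finite.of_basis (basisRestrictSupport K _)

lemma finrank_degLT_two (n : ℕ) : 2 * Module.finrank K (degLT K 2 n) = n * (n + 1) := by
  rw [degLT, Module.finrank_eq_nat_card_basis (basisRestrictSupport K _), card_degree_lt_two]

end degree

section graded
variable {r : ℕ} {τ : Type*}

/-- Tuples of polynomials of degree less than `n`. -/
noncomputable def tupLT (K : Type*) [Field K] (r : ℕ) (τ : Type*) (n : ℕ) :
    Submodule K (τ → S K r) :=
  Submodule.pi Set.univ fun _ => degLT K r n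

lemma mem_tupLT {n : ℕ} {f : τ → S K r} : f ∈ tupLT K r τ n ↔ ∀ i, f i ∈ degLT K r n := by
  simp [tupLT, Submodule.mem_pi]

instance tupLT_finite [Finite τ] (n : ℕ) : Module.Finite K (tupLT K r τ n) := by
  refine Module.Finite.of_injective
    (LinearMap.pi fun i => ((LinearMap.proj i).comp (tupLT K r τ n).subtype).codRestrict
      (degLT K r n) fun f => mem_tupLT.mp f.2 i : tupLT K r τ n →ₗ[K] (τ → degLT K r n)) ?_
  intro f g h
  ext1
  funext i
  exact congrArg Subtype.val (congrFun h i)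

/-- The homogeneous component of a tuple. -/
noncomputable def tupComp (K : Type*) [Field K] (r : ℕ) (τ : Type*) (n : ℕ) :
    (τ → S K r) →ₗ[K] (τ → S K r) := (homogeneousComponent n).compLeft τ

lemma tupComp_apply (n : ℕ) (f : τ → S K r) (i : τ) :
    tupComp K r τ n f i = homogeneousComponent n (f i) := rfl

lemma tupComp_isHomogeneous (n : ℕ) (f : τ → S K r) (i : τ) :
    (tupComp K r τ n f i).IsHomogeneous n := homogeneousComponent_isHomogeneous _ _

lemma tupComp_of_isHomogeneous {n : ℕ} {f : τ → S K r} (hf : ∀ i, (f i).IsHomogeneous n) :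
    tupComp K r τ n f = f := by
  funext i
  rw [tupComp_apply, homogeneousComponent_of_isHomogeneous (hf i), if_pos rfl]

lemma tupComp_of_mem_tupLT {n : ℕ} {f : τ → S K r} (hf : f ∈ tupLT K r τ n) :
    tupComp K r τ n f = 0 :=
  funext fun i => mem_degLT_iff_homogeneousComponent.mp (mem_tupLT.mp hf i) n le_rfl

lemma tupLT_mono {n n' : ℕ} (h : n ≤ n') : tupLT K r τ n ≤ tupLT K r τ n' := fun _ hf =>
  mem_tupLT.mpr fun i => degLT_mono h (mem_tupLT.mp hf i)

lemma mem_tupLT_of_tupComp_eq_zero {n : ℕ} {f : τ → S K r} (hf : f ∈ tupLT K r τ (n + 1))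
    (h0 : tupComp K r τ n f = 0) : f ∈ tupLT K r τ n := by
  refine mem_tupLT.mpr fun i => mem_degLT_iff_homogeneousComponent.mpr fun j hj => ?_
  rcases hj.lt_or_eq with hj | rfl
  · exact mem_degLT_iff_homogeneousComponent.mp (mem_tupLT.mp hf i) j hj
  · exact congrFun h0 i

lemma tupComp_mem_tupLT (n : ℕ) (f : τ → S K r) : tupComp K r τ n f ∈ tupLT K r τ (n + 1) :=
  mem_tupLT.mpr fun i => mem_degLT_of_isHomogeneous (tupComp_isHomogeneous n f i) n.lt_succ_self

lemma finrank_inf_tupLT_succ [Finite τ] (A : Submodule K (τ → S K r)) (n : ℕ) :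
    Module.finrank K ↥(A ⊓ tupLT K r τ (n + 1)) = Module.finrank K ↥(A ⊓ tupLT K r τ n) +
      Module.finrank K ↥((A ⊓ tupLT K r τ (n + 1)).map (tupComp K r τ n)) := by
  have h := LinearMap.finrank_range_add_finrank_ker
    ((tupComp K r τ n).domRestrict (A ⊓ tupLT K r τ (n + 1)))
  rw [← h, LinearMap.range_domRestrict, add_comm]
  congr 1
  have hle : A ⊓ tupLT K r τ n ≤ A ⊓ tupLT K r τ (n + 1) :=
    inf_le_inf_left _ (tupLT_mono n.le_succ)
  have hker : LinearMap.ker ((tupComp K r τ n).domRestrict (A ⊓ tupLT K r τ (n + 1))) =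
      (A ⊓ tupLT K r τ n).comap (A ⊓ tupLT K r τ (n + 1)).subtype := by
    ext f
    rw [LinearMap.mem_ker, Submodule.mem_comap]
    exact ⟨fun h0 => ⟨f.2.1, mem_tupLT_of_tupComp_eq_zero f.2.2 h0⟩,
      fun h0 => tupComp_of_mem_tupLT h0.2⟩
  rw [hker]
  exact (Submodule.comapSubtypeEquivOfLe hle).finrank_eq

lemma tupLT_zero (r : ℕ) (τ : Type*) : tupLT K r τ 0 = ⊥ :=
  (Submodule.eq_bot_iff _).mpr fun f hf => funext fun i => by
    by_contra hne
    exact absurd (totalDegree_lt_of_mem_degLT (mem_tupLT.mp hf i) hne) (Nat.not_lt_zero _)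

/-- The leading parts of `A` lie in the graded subspace `B`. -/
def LeadIn (A B : Submodule K (τ → S K r)) : Prop :=
  (∀ n, ∀ b ∈ B, tupComp K r τ n b ∈ B) ∧
    ∀ n, ∀ a ∈ A, a ∈ tupLT K r τ (n + 1) → tupComp K r τ n a ∈ B

lemma LeadIn.map_le {A B : Submodule K (τ → S K r)} (h : LeadIn A B) (n : ℕ) :
    (A ⊓ tupLT K r τ (n + 1)).map (tupComp K r τ n) ≤
      (B ⊓ tupLT K r τ (n + 1)).map (tupComp K r τ n) := by
  rintro _ ⟨a, ha, rfl⟩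
  exact ⟨tupComp K r τ n a, ⟨h.2 n a ha.1 ha.2, tupComp_mem_tupLT n a⟩,
    tupComp_of_isHomogeneous (tupComp_isHomogeneous n a)⟩

lemma LeadIn.finrank_le [Finite τ] {A B : Submodule K (τ → S K r)} (h : LeadIn A B) (n : ℕ) :
    Module.finrank K ↥(A ⊓ tupLT K r τ n) ≤ Module.finrank K ↥(B ⊓ tupLT K r τ n) := by
  induction n with
  | zero => rw [tupLT_zero, inf_bot_eq, inf_bot_eq]
  | succ n ih =>
    rw [finrank_inf_tupLT_succ, finrank_inf_tupLT_succ B]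
    exact Nat.add_le_add ih (Submodule.finrank_mono (h.map_le n))

/-- If the dimensions agree then every graded piece consists of leading parts. -/
lemma LeadIn.exists_of_finrank_eq [Finite τ] {A B : Submodule K (τ → S K r)} (h : LeadIn A B) {n : ℕ}
    (heq : Module.finrank K ↥(B ⊓ tupLT K r τ n) ≤ Module.finrank K ↥(A ⊓ tupLT K r τ n))
    {j : ℕ} (hj : j < n) {b : τ → S K r} (hb : b ∈ B) (hbj : ∀ i, (b i).IsHomogeneous j) :
    ∃ a ∈ A, a - b ∈ tupLT K r τ j := by
  induction n with
  | zero => exact absurd hj (Nat.not_lt_zero _)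
  | succ n ih =>
    rw [finrank_inf_tupLT_succ A, finrank_inf_tupLT_succ B] at heq
    have h1 := h.finrank_le n
    have h2 := Submodule.finrank_mono (h.map_le n)
    rcases (Nat.lt_succ_iff.mp hj).lt_or_eq with hlt | rfl
    · exact ih (by omega) hlt
    · have heq' := Submodule.eq_of_le_of_finrank_le (h.map_le j) (by omega)
      have hmem : b ∈ (B ⊓ tupLT K r τ (j + 1)).map (tupComp K r τ j) :=
        ⟨b, ⟨hb, mem_tupLT.mpr fun i => mem_degLT_of_isHomogeneous (hbj i) j.lt_succ_self⟩,
          tupComp_of_isHomogeneous hbj⟩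
      rw [← heq'] at hmem
      obtain ⟨a, ha, hab⟩ := hmem
      refine ⟨a, ha.1, mem_tupLT_of_tupComp_eq_zero (Submodule.sub_mem _ ha.2
        (mem_tupLT.mpr fun i => mem_degLT_of_isHomogeneous (hbj i) j.lt_succ_self)) ?_⟩
      rw [map_sub, hab, tupComp_of_isHomogeneous hbj, sub_self]

/-- If every graded piece consists of leading parts then the dimensions agree. -/
lemma LeadIn.finrank_eq [Finite τ] {A B : Submodule K (τ → S K r)} (h : LeadIn A B)
    (hex : ∀ j, ∀ b ∈ B, (∀ i, (b i).IsHomogeneous j) → ∃ a ∈ A, a - b ∈ tupLT K r τ j) (n : ℕ) :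
    Module.finrank K ↥(A ⊓ tupLT K r τ n) = Module.finrank K ↥(B ⊓ tupLT K r τ n) := by
  induction n with
  | zero => rw [tupLT_zero, inf_bot_eq, inf_bot_eq]
  | succ n ih =>
    rw [finrank_inf_tupLT_succ, finrank_inf_tupLT_succ B, ih]
    rw [le_antisymm (h.map_le n) ?_]
    rintro _ ⟨b, hb, rfl⟩
    have hhom := tupComp_isHomogeneous n b
    obtain ⟨a, ha, hab⟩ := hex n _ (h.1 n b hb.1) hhom
    refine ⟨a, ⟨ha, ?_⟩, ?_⟩
    · have := Submodule.add_mem _ (tupLT_mono n.le_succ hab) (tupComp_mem_tupLT n b)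
      rwa [sub_add_cancel] at this
    · have := tupComp_of_mem_tupLT hab
      rwa [map_sub, tupComp_of_isHomogeneous hhom, sub_eq_zero] at this

end graded

section dimension
variable {r : ℕ} {ι : Type*}

lemma eq_zero_of_sum_smul_eq_zero {R : Type*} [CommRing R] [IsDomain R] {n : ℕ}
    {θ : Matrix (Fin n) (Fin n) R} (hdet : θ.det ≠ 0) {f : Fin n → R}
    (h : ∑ i, f i • θ i = 0) : f = 0 := by
  refine Matrix.eq_zero_of_vecMul_eq_zero hdet ?_
  rw [← h]
  funext j
  simp [Matrix.vecMul, dotProduct, Finset.sum_apply]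

lemma homogeneousComponent_sum_smul {e : Fin r → ℕ} {θ : Matrix (Fin r) (Fin r) (S K r)}
    (hhom : ∀ i j, (θ i j).IsHomogeneous (e i)) (f : Fin r → S K r) (d : ℕ) :
    tupComp K r (Fin r) d (∑ i, f i • θ i) =
      ∑ i, (if e i ≤ d then homogeneousComponent (d - e i) (f i) else 0) • θ i := by
  rw [map_sum]
  refine Finset.sum_congr rfl fun i _ => ?_
  funext j
  rw [tupComp_apply, Pi.smul_apply, Pi.smul_apply, smul_eq_mul, smul_eq_mul, mul_comm]
  split_ifs with h
  · conv_lhs => rw [← Nat.sub_add_cancel h]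
    rw [homogeneousComponent_mul_left (hhom i j), mul_comm]
  · rw [homogeneousComponent_mul_left_of_lt (hhom i j) _ _ (not_le.mp h), zero_mul]

/-- The coefficients of a combination of a homogeneous basis have controlled degree. -/
lemma mem_degLT_of_sum_smul_mem {e : Fin r → ℕ} {θ : Matrix (Fin r) (Fin r) (S K r)}
    (hhom : ∀ i j, (θ i j).IsHomogeneous (e i)) (hdet : θ.det ≠ 0) {f : Fin r → S K r} {n : ℕ}
    (h : ∑ i, f i • θ i ∈ tupLT K r (Fin r) n) (i : Fin r) : f i ∈ degLT K r (n - e i) := by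
  refine mem_degLT_iff_homogeneousComponent.mpr fun l hl => ?_
  have h1 := homogeneousComponent_sum_smul hhom f (l + e i)
  rw [tupComp_of_mem_tupLT (tupLT_mono (by omega) h)] at h1
  have := congrFun (eq_zero_of_sum_smul_eq_zero hdet h1.symm) i
  rwa [if_pos (Nat.le_add_left _ _), Nat.add_sub_cancel] at this

lemma sum_smul_mem_tupLT {e : Fin r → ℕ} {θ : Matrix (Fin r) (Fin r) (S K r)}
    (hhom : ∀ i j, (θ i j).IsHomogeneous (e i)) {f : Fin r → S K r} {n : ℕ}
    (h : ∀ i, f i ∈ degLT K r (n - e i)) : ∑ i, f i • θ i ∈ tupLT K r (Fin r) n := by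
  refine Submodule.sum_mem _ fun i _ => mem_tupLT.mpr fun j => ?_
  rw [Pi.smul_apply, smul_eq_mul]
  by_cases h0 : f i = 0
  · rw [h0, zero_mul]; exact Submodule.zero_mem _
  · have := totalDegree_lt_of_mem_degLT (h i) h0
    rw [mul_comm]
    exact degLT_mono (by omega) (mul_mem_degLT (hhom i j).totalDegree_le (h i))

lemma HasExp.finrank_LD {s : Finset ι} {a : ι → Fin r → K} {m : ι → ℕ} {e : Fin r → ℕ}
    (hs : NP s a) (h : HasExp s a m e) (n : ℕ) :
    Module.finrank K ↥((LD s a m).restrictScalars K ⊓ tupLT K r (Fin r) n) =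
      ∑ i, Module.finrank K (degLT K r (n - e i)) := by
  obtain ⟨hsum, θ, hθ, hhom, hdet⟩ := h
  obtain ⟨c, hc, hdet'⟩ := det_eq_C_mul_defPoly hs hsum hθ hhom hdet
  let Φ : (∀ i, degLT K r (n - e i)) →ₗ[K] (Fin r → S K r) :=
    { toFun := fun f => ∑ i, (f i : S K r) • θ i
      map_add' := fun f g => by
        simp only [Pi.add_apply, Submodule.coe_add, add_smul, Finset.sum_add_distrib]
      map_smul' := fun u f => by
        simp only [Pi.smul_apply, Submodule.coe_smul, smul_assoc, Finset.smul_sum,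
          RingHom.id_apply] }
  have hΦ : ∀ f, Φ f = ∑ i, (f i : S K r) • θ i := fun _ => rfl
  have hinj : Function.Injective Φ := by
    rw [← LinearMap.ker_eq_bot, LinearMap.ker_eq_bot']
    intro f hf
    funext i
    exact Subtype.ext (congrFun (eq_zero_of_sum_smul_eq_zero hdet hf) i)
  have hrange : LinearMap.range Φ = (LD s a m).restrictScalars K ⊓ tupLT K r (Fin r) n := by
    ext η
    constructor
    · rintro ⟨f, rfl⟩
      rw [hΦ]
      exact ⟨Submodule.sum_mem _ fun i _ => Submodule.smul_mem _ _ (hθ i),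
        sum_smul_mem_tupLT hhom fun i => (f i).2⟩
    · rintro ⟨h1, h2⟩
      obtain ⟨f, rfl⟩ := exists_combination_of_mem_LD hs hc hθ hdet' h1
      exact ⟨fun i => ⟨f i, mem_degLT_of_sum_smul_mem hhom hdet h2 i⟩, rfl⟩
  rw [← hrange, LinearMap.finrank_range_of_inj hinj, Module.finrank_pi_fintype]

end dimension

namespace PD
variable {r : ℕ} {ι κ : Type*} (D : PD K r ι κ) (s : Finset ι)

/-- The affine form obtained by setting the first coordinate to one. -/
noncomputable def af (h : ι) : S K r := aff (D.β (D.cl h)) (D.av h)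

/-- The product of the affine forms of a class. -/
noncomputable def cp (k : κ) : S K r := ∏ h ∈ s with D.cl h = k, D.af h ^ D.m h

/-- Logarithmic vector fields of the affine family. -/
def AM : Submodule (S K r) (Fin r → S K r) where
  carrier := {φ | ∀ k ∈ D.t, D.cp s k ∣ ev (D.β k) φ}
  zero_mem' := fun k _ => by simp
  add_mem' := fun {x y} hx hy k hk => by rw [ev_add]; exact dvd_add (hx k hk) (hy k hk)
  smul_mem' := fun g x hx k hk => by rw [ev_smul]; exact (hx k hk).mul_left _

/-- Every homogeneous logarithmic vector field at infinity is a leading part of an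
affine one. -/
def Lead : Prop := ∀ j, ∀ e ∈ LD D.t D.β (D.mu s), (∀ i, (e i).IsHomogeneous j) →
  ∃ φ ∈ D.AM s, φ - e ∈ tupLT K r (Fin r) j

/-- Tuples of functions interpolated by a vector field. -/
def AN : Submodule (S K r) (D.t → S K r) where
  carrier := {w | ∃ φ, ∀ k : D.t, D.cp s k ∣ w k - ev (D.β k) φ}
  zero_mem' := ⟨0, fun k => by simp⟩
  add_mem' := by
    rintro x y ⟨φ, hφ⟩ ⟨ψ, hψ⟩
    refine ⟨φ + ψ, fun k => ?_⟩
    rw [ev_add, Pi.add_apply, add_sub_add_comm]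
    exact dvd_add (hφ k) (hψ k)
  smul_mem' := by
    rintro g x ⟨φ, hφ⟩
    refine ⟨g • φ, fun k => ?_⟩
    rw [ev_smul, Pi.smul_apply, smul_eq_mul, ← mul_sub]
    exact (hφ k).mul_left _

variable {D s}

lemma mem_AN {w : D.t → S K r} :
    w ∈ D.AN s ↔ ∃ φ, ∀ k : D.t, D.cp s k ∣ w k - ev (D.β k) φ := Iff.rfl

lemma af_dvd_cp {h : ι} (hh : h ∈ s) : D.af h ^ D.m h ∣ D.cp s (D.cl h) :=
  Finset.dvd_prod_of_mem (fun h => D.af h ^ D.m h) (Finset.mem_filter.mpr ⟨hh, rfl⟩)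

lemma WF.cp_dvd_iff (hD : D.WF s) {k : κ} (hk : k ∈ D.t) {f : S K r} :
    D.cp s k ∣ f ↔ ∀ h ∈ s, D.cl h = k → D.af h ^ D.m h ∣ f := by
  constructor
  · rintro hf h hh rfl
    exact (af_dvd_cp hh).trans hf
  · intro hf
    refine Finset.prod_dvd_of_isRelPrime (fun h hh h' hh' hne => ?_) fun h hh =>
      hf h (Finset.mem_filter.mp hh).1 (Finset.mem_filter.mp hh).2
    obtain ⟨hs, rfl⟩ := Finset.mem_filter.mp hh
    obtain ⟨hs', hcl⟩ := Finset.mem_filter.mp hh'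
    have hb := hD.np.1 _ hk
    refine isRelPrime_pow_aff hb (fun u hu ha => hne (hD.inj h hs h' hs' hcl.symm ?_)) _ _
    have h1 : (1 - u) • D.β (D.cl h) = 0 := by rw [sub_smul, one_smul, ← hu, hcl, sub_self]
    rw [ha, ← sub_eq_zero.mp ((smul_eq_zero.mp h1).resolve_right hb), one_mul]

lemma isTop_cp (D : PD K r ι κ) (s : Finset ι) (k : κ) :
    IsTop (D.cp s k) (linForm (D.β k) ^ D.mu s k) (D.mu s k) := by
  have h := IsTop.prod (s.filter fun h => D.cl h = k) (f := fun h => D.af h ^ D.m h)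
    (g := fun h => linForm (D.β (D.cl h)) ^ D.m h) (n := fun h => D.m h * 1)
    fun h _ => (IsTop.aff _ _).pow _
  have h2 : ∏ h ∈ s with D.cl h = k, linForm (D.β (D.cl h)) ^ D.m h =
      linForm (D.β k) ^ D.mu s k := by
    rw [mu, ← Finset.prod_pow_eq_pow_sum]
    exact Finset.prod_congr rfl fun h hh => by rw [(Finset.mem_filter.mp hh).2]
  rw [h2] at h
  simpa [mu, cp] using h

lemma cp_totalDegree (hnp : NP D.t D.β) {k : κ} (hk : k ∈ D.t) :
    (D.cp s k).totalDegree = D.mu s k :=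
  (isTop_cp D s k).totalDegree_eq (pow_ne_zero _ (linForm_ne_zero (hnp.1 k hk)))

lemma cp_ne_zero (hnp : NP D.t D.β) (hcl : ∀ h ∈ s, D.cl h ∈ D.t) (k : κ) : D.cp s k ≠ 0 :=
  Finset.prod_ne_zero_iff.mpr fun h hh =>
    pow_ne_zero _ (aff_ne_zero (hnp.1 _ (hcl h (Finset.mem_filter.mp hh).1)) _)

/-- The leading part of an interpolating vector field of large degree is logarithmic. -/
lemma WF.tupComp_mem_LD (hD : D.WF s) {n : ℕ} {φ : Fin r → S K r}
    (hφ : φ ∈ tupLT K r (Fin r) (n + 1)) {w : D.t → S K r} (hw : w ∈ tupLT K r D.t n)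
    (h : ∀ k : D.t, D.cp s k ∣ w k - ev (D.β k) φ) :
    tupComp K r (Fin r) n φ ∈ LD D.t D.β (D.mu s) := by
  intro k hk
  obtain ⟨q, hq⟩ := h ⟨k, hk⟩
  have hb := hD.np.1 k hk
  have hw0 := mem_tupLT.mp hw ⟨k, hk⟩
  have hev : homogeneousComponent n (ev (D.β k) φ) = - homogeneousComponent n (D.cp s k * q) := by
    rw [← hq, map_sub, mem_degLT_iff_homogeneousComponent.mp hw0 n le_rfl]
    ring
  have hgoal : ev (D.β k) (tupComp K r (Fin r) n φ) = homogeneousComponent n (ev (D.β k) φ) :=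
    (homogeneousComponent_ev _ _ _).symm
  rw [hgoal, hev, dvd_neg]
  by_cases hq0 : q = 0
  · rw [hq0, mul_zero, map_zero]; exact dvd_zero _
  have hmem : D.cp s k * q ∈ degLT K r (n + 1) := by
    rw [← hq]
    exact Submodule.sub_mem _ (degLT_mono n.le_succ hw0) (ev_mem_degLT _ (mem_tupLT.mp hφ))
  have hq1 := mem_degLT_of_mul_mem (cp_ne_zero hD.np hD.cl_mem k) hmem
  rw [cp_totalDegree hD.np hk] at hq1
  have hq2 := totalDegree_lt_of_mem_degLT hq1 hq0
  have htop := isTop_cp D s k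
  have hlow : q * (D.cp s k - linForm (D.β k) ^ D.mu s k) ∈ degLT K r n :=
    degLT_mono (by omega) (mul_mem_degLT (Nat.le_sub_of_add_le (by omega) :
      q.totalDegree ≤ n - D.mu s k) htop.2)
  have h0 := mem_degLT_iff_homogeneousComponent.mp hlow n le_rfl
  have h1 : D.cp s k * q = q * (D.cp s k - linForm (D.β k) ^ D.mu s k) +
      linForm (D.β k) ^ D.mu s k * q := by ring
  rw [h1, map_add, h0, zero_add]
  exact dvd_homogeneousComponent htop.1 (dvd_mul_right _ _) n

lemma WF.leadIn (hD : D.WF s) : LeadIn ((D.AM s).restrictScalars K)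
    ((LD D.t D.β (D.mu s)).restrictScalars K) := by
  constructor
  · intro n b hb k hk
    have hgoal : ev (D.β k) (tupComp K r (Fin r) n b) = homogeneousComponent n (ev (D.β k) b) :=
      (homogeneousComponent_ev _ _ _).symm
    rw [hgoal]
    exact dvd_homogeneousComponent (isTop_cp D s k).1 (hb k hk) n
  · intro n a ha han
    refine hD.tupComp_mem_LD (w := 0) han (Submodule.zero_mem _) fun k => ?_
    rw [Pi.zero_apply, zero_sub, dvd_neg]
    exact ha k k.2

/-- Under the lifting property interpolation does not raise the degree. -/
lemma WF.exists_of_lead (hD : D.WF s) (hL : D.Lead s) {n : ℕ} {w : D.t → S K r}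
    (hw : w ∈ D.AN s) (hwn : w ∈ tupLT K r D.t n) :
    ∃ φ ∈ tupLT K r (Fin r) n, ∀ k : D.t, D.cp s k ∣ w k - ev (D.β k) φ := by
  obtain ⟨φ, hφ⟩ := hw
  obtain ⟨N, hN⟩ := exists_mem_degLT φ
  have hN' : φ ∈ tupLT K r (Fin r) (n + N) := tupLT_mono (Nat.le_add_left _ _) (mem_tupLT.mpr hN)
  clear hN
  induction N generalizing φ with
  | zero => exact ⟨φ, hN', hφ⟩
  | succ N ih =>
    have hLD := hD.tupComp_mem_LD (n := n + N) hN' (tupLT_mono (Nat.le_add_right _ _) hwn) hφ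
    obtain ⟨ψ, hψ, hψ'⟩ := hL _ _ hLD (tupComp_isHomogeneous _ φ)
    refine ih (φ - ψ) (fun k => ?_) ?_
    · rw [ev_sub, ← sub_add]
      exact dvd_add (hφ k) (hψ k k.2)
    · have h1 : φ - tupComp K r (Fin r) (n + N) φ ∈ tupLT K r (Fin r) (n + N) := by
        refine mem_tupLT_of_tupComp_eq_zero (Submodule.sub_mem _ hN' (tupComp_mem_tupLT _ _)) ?_
        rw [map_sub, tupComp_of_isHomogeneous (tupComp_isHomogeneous _ φ), sub_self]
      have := Submodule.sub_mem _ h1 hψ'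
      rwa [sub_sub_sub_cancel_right] at this

end PD

/-- A bounded exhausting filtration of a vector space becomes stationary. -/
lemma exists_eq_top_of_finrank_le {M : Type*} [AddCommGroup M] [Module K M]
    (F : ℕ → Submodule K M) [∀ n, Module.Finite K (F n)] (hF : Monotone F)
    (hx : ∀ x, ∃ n, x ∈ F n) (N c : ℕ) (hc : ∀ n, N ≤ n → Module.finrank K (F n) ≤ c) :
    ∃ d, ∀ n, d ≤ n → F n = ⊤ := by
  have hb : ∀ n, Module.finrank K (F n) ≤ c := fun n =>
    (Submodule.finrank_mono (hF (le_max_left n N))).trans (hc _ (le_max_right n N))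
  obtain ⟨d, hd⟩ : ∃ d, ∀ n, Module.finrank K (F n) ≤ Module.finrank K (F d) := by
    have hbdd : BddAbove (Set.range fun n => Module.finrank K (F n)) :=
      ⟨c, by rintro _ ⟨n, rfl⟩; exact hb n⟩
    obtain ⟨d, hd⟩ := Nat.sSup_mem (Set.range_nonempty fun n => Module.finrank K (F n)) hbdd
    exact ⟨d, fun n => by
      have := le_csSup hbdd (Set.mem_range_self n)
      rw [← hd] at this
      exact this⟩
  have htop : F d = ⊤ := by
    refine eq_top_iff.mpr fun x _ => ?_
    obtain ⟨n, hn⟩ := hx x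
    rw [Submodule.eq_of_le_of_finrank_le (hF (le_max_left d n)) (hd _)]
    exact hF (le_max_right d n) hn
  exact ⟨d, fun n hn => eq_top_iff.mpr (htop ▸ hF hn)⟩

lemma finrank_tupLT {r : ℕ} {τ : Type*} [Fintype τ] (n : ℕ) :
    Module.finrank K (tupLT K r τ n) = Fintype.card τ * Module.finrank K (degLT K r n) := by
  let f : (τ → degLT K r n) →ₗ[K] (τ → S K r) :=
    { toFun := fun x i => x i
      map_add' := fun _ _ => rfl
      map_smul' := fun _ _ => rfl }
  have hinj : Function.Injective f := fun x y h => funext fun i => Subtype.ext (congrFun h i)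
  have hrange : LinearMap.range f = tupLT K r τ n := by
    ext x
    rw [mem_tupLT]
    constructor
    · rintro ⟨y, rfl⟩ i
      exact (y i).2
    · intro h
      exact ⟨fun i => ⟨x i, h i⟩, rfl⟩
  rw [← hrange, LinearMap.finrank_range_of_inj hinj, Module.finrank_pi_fintype]
  simp

lemma finrank_map_mkQ_add {M : Type*} [AddCommGroup M] [Module K M] (N U : Submodule K M)
    [Module.Finite K U] :
    Module.finrank K ↥(U.map N.mkQ) + Module.finrank K ↥(N ⊓ U) = Module.finrank K U := by
  have h := LinearMap.finrank_range_add_finrank_ker (N.mkQ.domRestrict U)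
  rw [LinearMap.range_domRestrict] at h
  have hk : Module.finrank K (LinearMap.ker (N.mkQ.domRestrict U)) =
      Module.finrank K ↥(N ⊓ U) := by
    have e : (LinearMap.ker (N.mkQ.domRestrict U)).map U.subtype = N ⊓ U := by
      ext x
      simp [LinearMap.domRestrict_apply]
    rw [← e]
    exact (LinearEquiv.finrank_eq (Submodule.equivMapOfInjective _ U.injective_subtype _))
  rw [← hk]
  exact h

namespace PD
variable {r : ℕ} {ι κ : Type*} (D : PD K r ι κ) (s : Finset ι)

/-- The map recording the values of a vector field together with multiples of the class
products, in bounded degree. -/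
noncomputable def psi (n : ℕ) :
    ((Fin r → degLT K r n) × (∀ k : D.t, degLT K r (n - D.mu s k))) →ₗ[K] (D.t → S K r) where
  toFun x k := ev (D.β k) (fun j => (x.1 j : S K r)) + D.cp s k * (x.2 k : S K r)
  map_add' x y := by
    funext k
    have : ev (D.β k) (fun j => ((x + y).1 j : S K r)) =
        ev (D.β k) (fun j => (x.1 j : S K r)) + ev (D.β k) (fun j => (y.1 j : S K r)) := by
      rw [← ev_add]; rfl
    simp only [this, Pi.add_apply, Prod.snd_add, Submodule.coe_add]
    ring
  map_smul' c x := by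
    funext k
    have : ev (D.β k) (fun j => ((c • x).1 j : S K r)) =
        c • ev (D.β k) (fun j => (x.1 j : S K r)) := by
      simp only [ev, Prod.smul_fst, Pi.smul_apply, Submodule.coe_smul, Finset.smul_sum]
      exact Finset.sum_congr rfl fun j _ => smul_comm _ _ _
    simp only [this, Pi.smul_apply, Prod.smul_snd, Submodule.coe_smul, smul_add,
      mul_smul_comm, RingHom.id_apply]

/-- The defect module of the affine family, as a vector space. -/
abbrev Tor : Type _ := (D.t → S K r) ⧸ (D.AN s).restrictScalars K

variable {D s}

lemma psi_apply {n : ℕ}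
    (x : (Fin r → degLT K r n) × (∀ k : D.t, degLT K r (n - D.mu s k))) (k : D.t) :
    D.psi s n x k = ev (D.β k) (fun j => (x.1 j : S K r)) + D.cp s k * (x.2 k : S K r) := rfl

lemma WF.finrank_ker_psi (hD : D.WF s) (n : ℕ) :
    Module.finrank K (LinearMap.ker (D.psi s n)) =
      Module.finrank K ↥((D.AM s).restrictScalars K ⊓ tupLT K r (Fin r) n) := by
  let f : LinearMap.ker (D.psi s n) →ₗ[K] (Fin r → S K r) :=
    { toFun := fun x j => (x.1.1 j : S K r)
      map_add' := fun _ _ => rfl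
      map_smul' := fun _ _ => rfl }
  have hcp : ∀ k, D.cp s k ≠ 0 := cp_ne_zero hD.np hD.cl_mem
  have hker : ∀ x : LinearMap.ker (D.psi s n), ∀ k : D.t,
      ev (D.β k) (fun j => (x.1.1 j : S K r)) + D.cp s k * (x.1.2 k : S K r) = 0 := fun x k =>
    congrFun (LinearMap.mem_ker.mp x.2) k
  have hinj : Function.Injective f := by
    intro x y h
    have h1 : ∀ j, (x.1.1 j : S K r) = y.1.1 j := fun j => congrFun h j
    have h2 : ∀ k, (x.1.2 k : S K r) = y.1.2 k := by
      intro k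
      have hx := hker x k
      have hy := hker y k
      simp only [h1] at hx
      exact mul_left_cancel₀ (hcp k) (add_left_cancel (hx.trans hy.symm))
    exact Subtype.ext (Prod.ext (funext fun j => Subtype.ext (h1 j))
      (funext fun k => Subtype.ext (h2 k)))
  have hrange : LinearMap.range f = (D.AM s).restrictScalars K ⊓ tupLT K r (Fin r) n := by
    ext φ
    constructor
    · rintro ⟨x, rfl⟩
      refine ⟨fun k hk => ?_, mem_tupLT.mpr fun j => (x.1.1 j).2⟩
      have h : ev (D.β k) (f x) = -(D.cp s k * (x.1.2 ⟨k, hk⟩ : S K r)) :=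
        eq_neg_of_add_eq_zero_left (hker x ⟨k, hk⟩)
      rw [h]
      exact (dvd_mul_right _ _).neg_right
    · rintro ⟨h1, h2⟩
      have hq : ∀ k : D.t, ∃ q : degLT K r (n - D.mu s k), ev (D.β k) φ + D.cp s k * q = 0 := by
        intro k
        obtain ⟨q, hq⟩ := h1 k k.2
        have hmem : D.cp s k * q ∈ degLT K r n := by
          rw [← hq]
          exact ev_mem_degLT _ (mem_tupLT.mp h2)
        have hq1 := mem_degLT_of_mul_mem (hcp k) hmem
        rw [cp_totalDegree hD.np k.2] at hq1
        refine ⟨-⟨q, hq1⟩, ?_⟩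
        rw [hq]
        simp
      choose q hq using hq
      exact ⟨⟨(fun j => ⟨φ j, mem_tupLT.mp h2 j⟩, q),
        LinearMap.mem_ker.mpr (funext fun k => hq k)⟩, rfl⟩
  rw [← hrange, LinearMap.finrank_range_of_inj hinj]

lemma WF.finrank_range_psi (hD : D.WF s) (n : ℕ) :
    Module.finrank K (LinearMap.range (D.psi s n)) +
      Module.finrank K ↥((D.AM s).restrictScalars K ⊓ tupLT K r (Fin r) n) =
      r * Module.finrank K (degLT K r n) +
        ∑ k : D.t, Module.finrank K (degLT K r (n - D.mu s k)) := by
  rw [← hD.finrank_ker_psi, LinearMap.finrank_range_add_finrank_ker, Module.finrank_prod,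
    Module.finrank_pi_fintype, Module.finrank_pi_fintype]
  simp

lemma WF.range_psi_le (hD : D.WF s) {n : ℕ} (hn : ∀ k ∈ D.t, D.mu s k ≤ n) :
    LinearMap.range (D.psi s n) ≤ (D.AN s).restrictScalars K ⊓ tupLT K r D.t n := by
  rintro _ ⟨x, rfl⟩
  refine ⟨⟨fun j => x.1 j, fun k => ?_⟩, mem_tupLT.mpr fun k => ?_⟩
  · rw [psi_apply, add_sub_cancel_left]
    exact dvd_mul_right _ _
  · rw [psi_apply]
    refine Submodule.add_mem _ (ev_mem_degLT _ fun j => (x.1 j).2) ?_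
    have := mul_mem_degLT (cp_totalDegree (s := s) hD.np k.2).le (x.2 k).2
    rwa [Nat.add_sub_cancel' (hn k k.2)] at this

lemma WF.range_psi_eq (hD : D.WF s) (hL : D.Lead s) {n : ℕ} (hn : ∀ k ∈ D.t, D.mu s k ≤ n) :
    LinearMap.range (D.psi s n) = (D.AN s).restrictScalars K ⊓ tupLT K r D.t n := by
  refine le_antisymm (hD.range_psi_le hn) ?_
  rintro w ⟨hw, hwn⟩
  obtain ⟨φ, hφ, hdvd⟩ := hD.exists_of_lead hL hw hwn
  have hq : ∀ k : D.t, ∃ q : degLT K r (n - D.mu s k), ev (D.β k) φ + D.cp s k * q = w k := by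
    intro k
    obtain ⟨q, hq⟩ := hdvd k
    have hmem : D.cp s k * q ∈ degLT K r n := by
      rw [← hq]
      exact Submodule.sub_mem _ (mem_tupLT.mp hwn k) (ev_mem_degLT _ (mem_tupLT.mp hφ))
    have hq1 := mem_degLT_of_mul_mem (cp_ne_zero hD.np hD.cl_mem k) hmem
    rw [cp_totalDegree hD.np k.2] at hq1
    exact ⟨⟨q, hq1⟩, by simp [← hq]⟩
  choose q hq using hq
  exact ⟨(fun j => ⟨φ j, mem_tupLT.mp hφ j⟩, q), funext fun k => hq k⟩

/-- The part of the defect module represented in bounded degree. -/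
noncomputable def torLT (D : PD K r ι κ) (s : Finset ι) (n : ℕ) : Submodule K (D.Tor s) :=
  (tupLT K r D.t n).map ((D.AN s).restrictScalars K).mkQ

lemma WF.finrank_torLT_le (hD : D.WF s) {n : ℕ} (hn : ∀ k ∈ D.t, D.mu s k ≤ n) :
    Module.finrank K (D.torLT s n) + r * Module.finrank K (degLT K r n) +
        ∑ k ∈ D.t, Module.finrank K (degLT K r (n - D.mu s k)) ≤
      D.t.card * Module.finrank K (degLT K r n) +
        Module.finrank K ↥((D.AM s).restrictScalars K ⊓ tupLT K r (Fin r) n) := by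
  have h1 := finrank_map_mkQ_add ((D.AN s).restrictScalars K) (tupLT K r D.t n)
  rw [finrank_tupLT, Fintype.card_coe] at h1
  have h2 := hD.finrank_range_psi n
  rw [Finset.sum_coe_sort D.t fun k => Module.finrank K (degLT K r (n - D.mu s k))] at h2
  have : Module.Finite K ↥((D.AN s).restrictScalars K ⊓ tupLT K r D.t n) :=
    Submodule.finiteDimensional_of_le inf_le_right
  have h3 := Submodule.finrank_mono (hD.range_psi_le hn)
  change Module.finrank K (D.torLT s n) + _ = _ at h1
  omega

lemma WF.finrank_torLT_eq (hD : D.WF s) (hL : D.Lead s) {n : ℕ}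
    (hn : ∀ k ∈ D.t, D.mu s k ≤ n) :
    Module.finrank K (D.torLT s n) + r * Module.finrank K (degLT K r n) +
        ∑ k ∈ D.t, Module.finrank K (degLT K r (n - D.mu s k)) =
      D.t.card * Module.finrank K (degLT K r n) +
        Module.finrank K ↥((D.AM s).restrictScalars K ⊓ tupLT K r (Fin r) n) := by
  have h1 := finrank_map_mkQ_add ((D.AN s).restrictScalars K) (tupLT K r D.t n)
  rw [finrank_tupLT, Fintype.card_coe] at h1
  have h2 := hD.finrank_range_psi n
  rw [Finset.sum_coe_sort D.t fun k => Module.finrank K (degLT K r (n - D.mu s k)),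
    hD.range_psi_eq hL hn] at h2
  change Module.finrank K (D.torLT s n) + _ = _ at h1
  omega

instance torLT_finite (D : PD K r ι κ) (s : Finset ι) (n : ℕ) :
    Module.Finite K (D.torLT s n) :=
  inferInstanceAs (Module.Finite K ↥((tupLT K r D.t n).map ((D.AN s).restrictScalars K).mkQ))

lemma torLT_mono (D : PD K r ι κ) (s : Finset ι) : Monotone (D.torLT s) := fun _ _ h =>
  Submodule.map_mono (tupLT_mono h)

lemma exists_mem_torLT (x : D.Tor s) : ∃ n, x ∈ D.torLT s n := by
  obtain ⟨w, rfl⟩ := Submodule.mkQ_surjective _ x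
  obtain ⟨n, hn⟩ := exists_mem_degLT w
  exact ⟨n, w, mem_tupLT.mpr hn, rfl⟩

end PD

/-- The quadratic identity behind the dimension count in two variables. -/
lemma two_mul_finrank_degLT_sub {n e : ℕ} (h : e ≤ n) :
    2 * Module.finrank K (degLT K 2 (n - e)) + 2 * n * e + e =
      2 * Module.finrank K (degLT K 2 n) + e ^ 2 := by
  rw [finrank_degLT_two, finrank_degLT_two]
  obtain ⟨c, rfl⟩ := Nat.exists_eq_add_of_le h
  rw [Nat.add_sub_cancel_left]
  ring

lemma two_mul_sum_finrank_degLT_sub {α : Type*} (u : Finset α) (e : α → ℕ) {n : ℕ}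
    (h : ∀ i ∈ u, e i ≤ n) :
    2 * ∑ i ∈ u, Module.finrank K (degLT K 2 (n - e i)) + (2 * n + 1) * ∑ i ∈ u, e i =
      2 * (u.card * Module.finrank K (degLT K 2 n)) + ∑ i ∈ u, e i ^ 2 := by
  have : ∑ i ∈ u, (2 * Module.finrank K (degLT K 2 (n - e i)) + 2 * n * e i + e i) =
      ∑ i ∈ u, (2 * Module.finrank K (degLT K 2 n) + e i ^ 2) :=
    Finset.sum_congr rfl fun i hi => two_mul_finrank_degLT_sub (h i hi)
  simp only [Finset.sum_add_distrib, ← Finset.mul_sum, Finset.sum_const, smul_eq_mul] at this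
  linarith

namespace PD
variable {ι κ : Type*} {D : PD K 2 ι κ} {s : Finset ι}

lemma WF.two_mul_finrank_torLT_le (hD : D.WF s) {e : Fin 2 → ℕ}
    (hE : HasExp D.t D.β (D.mu s) e) {n : ℕ} (hn : ∀ k ∈ D.t, D.mu s k ≤ n)
    (hen : ∀ i, e i ≤ n) :
    2 * Module.finrank K (D.torLT s n) + ∑ k ∈ D.t, D.mu s k ^ 2 +
      2 * Module.finrank K ↥((LD D.t D.β (D.mu s)).restrictScalars K ⊓ tupLT K 2 (Fin 2) n) ≤
      ∑ i, e i ^ 2 +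
        2 * Module.finrank K ↥((D.AM s).restrictScalars K ⊓ tupLT K 2 (Fin 2) n) := by
  have h1 := hD.finrank_torLT_le hn
  have h2 := hE.finrank_LD hD.np n
  have h3 := two_mul_sum_finrank_degLT_sub (K := K) D.t (D.mu s) hn
  have h4 := two_mul_sum_finrank_degLT_sub (K := K) Finset.univ e (n := n) fun i _ => hen i
  have h5 := hE.1
  rw [Finset.card_univ, Fintype.card_fin, h5] at h4
  omega

lemma WF.two_mul_finrank_torLT_eq (hD : D.WF s) (hL : D.Lead s) {e : Fin 2 → ℕ}
    (hE : HasExp D.t D.β (D.mu s) e) {n : ℕ} (hn : ∀ k ∈ D.t, D.mu s k ≤ n)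
    (hen : ∀ i, e i ≤ n) :
    2 * Module.finrank K (D.torLT s n) + ∑ k ∈ D.t, D.mu s k ^ 2 = ∑ i, e i ^ 2 := by
  have h1 := hD.finrank_torLT_eq hL hn
  have h2 := hE.finrank_LD hD.np n
  rw [← hD.leadIn.finrank_eq (fun j b hb hbj => hL j b hb hbj) n] at h2
  have h3 := two_mul_sum_finrank_degLT_sub (K := K) D.t (D.mu s) hn
  have h4 := two_mul_sum_finrank_degLT_sub (K := K) Finset.univ e (n := n) fun i _ => hen i
  have h5 := hE.1
  rw [Finset.card_univ, Fintype.card_fin, h5] at h4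
  omega

lemma exists_degree_bound (D : PD K 2 ι κ) (s : Finset ι) (e : Fin 2 → ℕ) :
    ∃ N, ∀ n, N ≤ n → (∀ k ∈ D.t, D.mu s k ≤ n) ∧ ∀ i, e i ≤ n :=
  ⟨∑ k ∈ D.t, D.mu s k + ∑ i, e i, fun _ hn =>
    ⟨fun _ hk => (Finset.single_le_sum (fun _ _ => Nat.zero_le _) hk).trans
      ((Nat.le_add_right _ _).trans hn),
    fun i => (Finset.single_le_sum (fun _ _ => Nat.zero_le _) (Finset.mem_univ i)).trans
      ((Nat.le_add_left _ _).trans hn)⟩⟩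

lemma WF.exists_torLT_eq_top (hD : D.WF s) {e : Fin 2 → ℕ}
    (hE : HasExp D.t D.β (D.mu s) e) : ∃ d, ∀ n, d ≤ n → D.torLT s n = ⊤ := by
  obtain ⟨N, hN⟩ := exists_degree_bound D s e
  refine exists_eq_top_of_finrank_le _ (torLT_mono D s) exists_mem_torLT N (∑ i, e i ^ 2)
    fun n hn => ?_
  have h1 := hD.two_mul_finrank_torLT_le hE (hN n hn).1 (hN n hn).2
  have h2 := hD.leadIn.finrank_le n
  omega

lemma WF.finite_tor (hD : D.WF s) {e : Fin 2 → ℕ} (hE : HasExp D.t D.β (D.mu s) e) :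
    Module.Finite K (D.Tor s) := by
  obtain ⟨d, hd⟩ := hD.exists_torLT_eq_top hE
  have h := torLT_finite D s d
  rw [hd d le_rfl] at h
  exact Module.finite_def.mpr (Module.Finite.iff_fg.mp h)

lemma WF.two_mul_finrank_tor_le (hD : D.WF s) {e : Fin 2 → ℕ}
    (hE : HasExp D.t D.β (D.mu s) e) :
    2 * Module.finrank K (D.Tor s) + ∑ k ∈ D.t, D.mu s k ^ 2 ≤ ∑ i, e i ^ 2 := by
  obtain ⟨d, hd⟩ := hD.exists_torLT_eq_top hE
  obtain ⟨N, hN⟩ := exists_degree_bound D s e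
  obtain ⟨hn, hen⟩ := hN (max d N) (le_max_right _ _)
  have h1 := hD.two_mul_finrank_torLT_le hE hn hen
  have h2 := hD.leadIn.finrank_le (max d N)
  rw [hd _ (le_max_left _ _), finrank_top] at h1
  omega

/-- Dimension count for the defect module: the leading part property is equivalent to
the extremal value of its dimension. -/
lemma WF.lead_iff (hD : D.WF s) {e : Fin 2 → ℕ} (hE : HasExp D.t D.β (D.mu s) e) :
    D.Lead s ↔ 2 * Module.finrank K (D.Tor s) + ∑ k ∈ D.t, D.mu s k ^ 2 = ∑ i, e i ^ 2 := by
  obtain ⟨d, hd⟩ := hD.exists_torLT_eq_top hE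
  obtain ⟨N, hN⟩ := exists_degree_bound D s e
  constructor
  · intro hL
    obtain ⟨hn, hen⟩ := hN (max d N) (le_max_right _ _)
    have h1 := hD.two_mul_finrank_torLT_eq hL hE hn hen
    rwa [hd _ (le_max_left _ _), finrank_top] at h1
  · intro heq j b hb hbj
    obtain ⟨hn, hen⟩ := hN (max d N + (j + 1)) ((le_max_right _ _).trans (Nat.le_add_right _ _))
    have h1 := hD.two_mul_finrank_torLT_le hE hn hen
    rw [hd _ ((le_max_left _ _).trans (Nat.le_add_right _ _)), finrank_top] at h1
    refine hD.leadIn.exists_of_finrank_eq (n := max d N + (j + 1)) ?_ (by omega) hb hbj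
    omega

end PD

lemma eval_linForm {r : ℕ} (p c : Fin r → K) : eval p (linForm c) = ∑ i, c i * p i := by
  simp [linForm]

lemma eval_aff {r : ℕ} (p c : Fin r → K) (a : K) :
    eval p (aff c a) = ∑ i, c i * p i + a := by
  rw [aff, map_add, eval_linForm, eval_C]

lemma translate_linForm {r : ℕ} (p c : Fin r → K) :
    translate p (linForm c) = aff c (-∑ i, c i * p i) := by
  rw [aff, linForm, map_sum, map_neg, map_sum, ← sub_eq_add_neg, ← Finset.sum_sub_distrib]
  refine Finset.sum_congr rfl fun i _ => ?_
  rw [map_mul, translate_X, ← algebraMap_eq, AlgHom.commutes, map_mul, mul_sub]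

lemma sub_C_eval_mem {r : ℕ} {I : Ideal (S K r)} {p : Fin r → K}
    (h : ∀ i, X i - C (p i) ∈ I) (f : S K r) : f - C (eval p f) ∈ I := by
  induction f using MvPolynomial.induction_on with
  | C a => rw [eval_C, sub_self]; exact I.zero_mem
  | add f g hf hg =>
    rw [map_add, map_add, add_sub_add_comm]
    exact I.add_mem hf hg
  | mul_X f i hf =>
    have : f * X i - C (eval p (f * X i)) =
        X i * (f - C (eval p f)) + C (eval p f) * (X i - C (p i)) := by
      rw [map_mul, eval_X, map_mul]; ring
    rw [this]
    exact I.add_mem (I.mul_mem_left _ hf) (I.mul_mem_left _ (h i))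

lemma eval_eq_zero_of_mem {r : ℕ} {I : Ideal (S K r)} (hI : I ≠ ⊤) {p : Fin r → K}
    (h : ∀ i, X i - C (p i) ∈ I) {f : S K r} (hf : f ∈ I) : eval p f = 0 := by
  by_contra hne
  refine hI (Ideal.eq_top_of_isUnit_mem I (x := C (eval p f)) ?_
    ((isUnit_iff_ne_zero.mpr hne).map C))
  have := I.sub_mem hf (sub_C_eval_mem h f)
  rwa [sub_sub_cancel] at this

lemma det_ne_zero_of_ne_smul {c c' : Fin 2 → K} (hc : c ≠ 0) (h : ∀ u : K, c' ≠ u • c) :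
    c 0 * c' 1 - c 1 * c' 0 ≠ 0 := by
  intro h0
  by_cases h1 : c 0 = 0
  · have h2 : c 1 ≠ 0 := fun h2 => hc (funext fun i => by fin_cases i <;> assumption)
    refine h (c' 1 / c 1) (funext fun i => ?_)
    fin_cases i
    · have : c' 0 = 0 := by
        rw [h1, zero_mul, zero_sub, neg_eq_zero] at h0
        exact (mul_eq_zero.mp h0).resolve_left h2
      simp [h1, this]
    · simp [h2]
  · refine h (c' 0 / c 0) (funext fun i => ?_)
    fin_cases i
    · simp [h1]
    · simp only [Fin.mk_one, Pi.smul_apply, smul_eq_mul]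
      field_simp
      linear_combination h0

/-- An ideal containing two transversal lines through a point contains the equations of
that point. -/
lemma X_sub_C_mem_of_aff_mem {I : Ideal (S K 2)} {c c' : Fin 2 → K} {a a' : K} {p : Fin 2 → K}
    (hc : c ≠ 0) (h : ∀ u : K, c' ≠ u • c) (hm : aff c a ∈ I) (hm' : aff c' a' ∈ I)
    (hp : eval p (aff c a) = 0) (hp' : eval p (aff c' a') = 0) (i : Fin 2) :
    X i - C (p i) ∈ I := by
  have hdet := det_ne_zero_of_ne_smul hc h
  have hexp : ∀ (b : Fin 2 → K) (e : K), eval p (aff b e) = 0 →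
      aff b e = C (b 0) * (X 0 - C (p 0)) + C (b 1) * (X 1 - C (p 1)) := by
    intro b e hb
    rw [eval_aff, Fin.sum_univ_two] at hb
    have : e = -(b 0 * p 0 + b 1 * p 1) := by linear_combination hb
    rw [this, aff, linForm, Fin.sum_univ_two]
    simp only [map_neg, map_add, map_mul]
    ring
  rw [hexp c a hp] at hm
  rw [hexp c' a' hp'] at hm'
  have hunit : IsUnit (C (c 0 * c' 1 - c 1 * c' 0) : S K 2) :=
    (isUnit_iff_ne_zero.mpr hdet).map C
  have key : C (c 0 * c' 1 - c 1 * c' 0) * (X i - C (p i)) ∈ I := by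
    fin_cases i
    · have := I.sub_mem (I.mul_mem_left (C (c' 1)) hm) (I.mul_mem_left (C (c 1)) hm')
      convert this using 1
      simp only [map_sub, map_mul, Fin.zero_eta]
      ring
    · have := I.sub_mem (I.mul_mem_left (C (c 0)) hm') (I.mul_mem_left (C (c' 0)) hm)
      convert this using 1
      simp only [map_sub, map_mul, Fin.mk_one]
      ring
  exact (Ideal.unit_mul_mem_iff_mem I hunit).mp key

namespace PD
variable {r : ℕ} {ι κ : Type*} {D : PD K r ι κ} {s s' : Finset ι}

/-- The members of the family passing through a point. -/
noncomputable def at' (D : PD K r ι κ) (s : Finset ι) (p : Fin r → K) : Finset ι :=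
  s.filter fun h => eval p (D.af h) = 0

lemma mem_at' {p : Fin r → K} {h : ι} : h ∈ D.at' s p ↔ h ∈ s ∧ eval p (D.af h) = 0 := by
  rw [at', Finset.mem_filter]

lemma at'_subset (D : PD K r ι κ) (s : Finset ι) (p : Fin r → K) : D.at' s p ⊆ s :=
  Finset.filter_subset _ _

/-- A central family has the leading part property. -/
lemma lead_of_eval_eq_zero {p : Fin r → K} (h : ∀ h ∈ s, eval p (D.af h) = 0) : D.Lead s := by
  intro j e he hej
  refine ⟨fun i => translate p (e i), fun k hk => ?_, mem_tupLT.mpr fun i =>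
    (IsTop.translate p (hej i)).2⟩
  have h1 : D.cp s k = translate p (linForm (D.β k) ^ D.mu s k) := by
    rw [map_pow, mu, ← Finset.prod_pow_eq_pow_sum]
    refine Finset.prod_congr rfl fun h' hh => ?_
    obtain ⟨hs, rfl⟩ := Finset.mem_filter.mp hh
    rw [translate_linForm, af]
    have := h h' hs
    rw [af, eval_aff] at this
    rw [eq_neg_of_add_eq_zero_right this]
  have h2 : ev (D.β k) (fun i => translate p (e i)) = translate p (ev (D.β k) e) :=
    (map_ev _ _ _).symm
  rw [h1, h2]
  exact map_dvd _ (he k hk)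

lemma cp_dvd_cp (hs : s' ⊆ s) (k : κ) : D.cp s' k ∣ D.cp s k :=
  Finset.prod_dvd_prod_of_subset _ _ _ (Finset.filter_subset_filter _ hs)

lemma AN_anti (hs : s' ⊆ s) : D.AN s ≤ D.AN s' := by
  intro w hw
  obtain ⟨φ, hφ⟩ := mem_AN.mp hw
  exact mem_AN.mpr ⟨φ, fun k => (cp_dvd_cp hs k.1).trans (hφ k)⟩

/-- Interpolation is a local condition. -/
lemma exists_smul_mem_AN {I : Ideal (S K r)} [I.IsPrime] (hs : s' ⊆ s)
    (h : ∀ h ∈ s, h ∉ s' → D.af h ∉ I) : ∃ g ∉ I, ∀ w ∈ D.AN s', g • w ∈ D.AN s := by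
  refine ⟨∏ h ∈ s \ s', D.af h ^ D.m h, fun hg => ?_, ?_⟩
  · obtain ⟨h', hh, hmem⟩ := (Ideal.IsPrime.prod_mem_iff).mp hg
    rw [Finset.mem_sdiff] at hh
    exact h h' hh.1 hh.2 (Ideal.IsPrime.mem_of_pow_mem inferInstance _ hmem)
  · rintro w ⟨φ, hφ⟩
    refine ⟨(∏ h ∈ s \ s', D.af h ^ D.m h) • φ, fun k => ?_⟩
    rw [ev_smul, Pi.smul_apply, smul_eq_mul, ← mul_sub]
    refine dvd_trans ?_ (mul_dvd_mul_left _ (hφ k))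
    have : D.cp s k = (∏ h ∈ s \ s' with D.cl h = k, D.af h ^ D.m h) * D.cp s' k := by
      rw [cp, cp, ← Finset.prod_union, ← Finset.filter_union, Finset.sdiff_union_of_subset hs]
      exact Finset.disjoint_filter_filter Finset.sdiff_disjoint
    rw [this]
    exact mul_dvd_mul_right
      (Finset.prod_dvd_prod_of_subset _ _ _ (Finset.filter_subset _ _)) _

lemma exists_ev_eq_one {c : Fin r → K} (hc : c ≠ 0) : ∃ v : Fin r → S K r, ev c v = 1 := by
  obtain ⟨i, hi⟩ := Function.ne_iff.mp hc
  refine ⟨Pi.single i (C (c i)⁻¹), ?_⟩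
  rw [ev, Finset.sum_eq_single i (fun j _ hj => by rw [Pi.single_eq_of_ne hj, smul_zero])
    (by simp)]
  rw [Pi.single_eq_same, smul_eq_C_mul, ← map_mul, mul_inv_cancel₀ hi, map_one]

/-- Interpolation along a single class is always possible. -/
lemma mem_AN_of_forall_cl_eq (hnp : NP D.t D.β) (hcl : ∀ h ∈ s, D.cl h ∈ D.t)
    (h : ∀ h ∈ s, ∀ h' ∈ s, D.cl h = D.cl h') (w : D.t → S K r) : w ∈ D.AN s := by
  rcases s.eq_empty_or_nonempty with rfl | ⟨h₀, hs⟩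
  · exact ⟨0, fun k => by simp [cp]⟩
  · obtain ⟨v, hv⟩ := exists_ev_eq_one (hnp.1 _ (hcl h₀ hs))
    refine ⟨w ⟨D.cl h₀, hcl h₀ hs⟩ • v, fun k => ?_⟩
    by_cases hk : D.cl h₀ = k
    · obtain ⟨k, hk'⟩ := k
      subst hk
      rw [ev_smul, hv, mul_one, sub_self]
      exact dvd_zero _
    · rw [cp, Finset.filter_false_of_mem fun h' hh' he => hk ((h _ hs _ hh').trans he),
        Finset.prod_empty]
      exact one_dvd _

end PD

namespace PD
variable {ι κ : Type*} {D : PD K 2 ι κ} {s : Finset ι} {P : Finset (Fin 2 → K)}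

/-- Two members of different classes of the family meet in a point of `P`. -/
def Covers (D : PD K 2 ι κ) (s : Finset ι) (P : Finset (Fin 2 → K)) : Prop :=
  ∀ h ∈ s, ∀ h' ∈ s, D.cl h ≠ D.cl h' → ∃ p ∈ P, eval p (D.af h) = 0 ∧ eval p (D.af h') = 0

lemma WF.X_sub_C_mem (hD : D.WF s) {I : Ideal (S K 2)} {h h' : ι} (hh : h ∈ s) (hh' : h' ∈ s)
    (hne : D.cl h ≠ D.cl h') (hI : D.af h ∈ I) (hI' : D.af h' ∈ I) {p : Fin 2 → K}
    (hp : eval p (D.af h) = 0) (hp' : eval p (D.af h') = 0) (i : Fin 2) : X i - C (p i) ∈ I :=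
  X_sub_C_mem_of_aff_mem (hD.np.1 _ (hD.cl_mem h hh))
    (hD.np.2 _ (hD.cl_mem h hh) _ (hD.cl_mem h' hh') hne) hI hI' hp hp' i

lemma WF.eq_of_eval_eq_zero (hD : D.WF s) {h h' : ι} (hh : h ∈ s) (hh' : h' ∈ s)
    (hne : D.cl h ≠ D.cl h') {p q : Fin 2 → K}
    (hp : eval p (D.af h) = 0) (hp' : eval p (D.af h') = 0)
    (hq : eval q (D.af h) = 0) (hq' : eval q (D.af h') = 0) : p = q := by
  funext i
  have := hD.X_sub_C_mem (I := RingHom.ker (eval q)) hh hh' hne hq hq' hp hp' i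
  rw [RingHom.mem_ker, map_sub, eval_X, eval_C] at this
  exact (sub_eq_zero.mp this).symm

/-- Interpolation can be checked at the points of a covering set. -/
lemma WF.mem_AN_of_forall_at' (hD : D.WF s) (hP : D.Covers s P) {w : D.t → S K 2}
    (hw : ∀ p ∈ P, w ∈ D.AN (D.at' s p)) : w ∈ D.AN s := by
  let I : Ideal (S K 2) := (D.AN s).comap (LinearMap.toSpanSingleton (S K 2) _ w)
  have hmem : ∀ f, f ∈ I ↔ f • w ∈ D.AN s := fun f => Iff.rfl
  suffices hI : I = ⊤ by
    have := (hmem 1).mp (hI ▸ Submodule.mem_top)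
    rwa [one_smul] at this
  by_contra hI
  obtain ⟨M, hM, hIM⟩ := Ideal.exists_le_maximal I hI
  have := hM.isPrime
  have key : ∃ s' ⊆ s, (∀ h ∈ s, h ∉ s' → D.af h ∉ M) ∧ w ∈ D.AN s' := by
    by_cases hone : ∀ h ∈ s.filter (fun h => D.af h ∈ M), ∀ h' ∈ s.filter (fun h => D.af h ∈ M),
        D.cl h = D.cl h'
    · refine ⟨s.filter (fun h => D.af h ∈ M), Finset.filter_subset _ _, fun h hh hn hM' =>
        hn (Finset.mem_filter.mpr ⟨hh, hM'⟩), ?_⟩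
      exact mem_AN_of_forall_cl_eq hD.np
        (fun h hh => hD.cl_mem h (Finset.filter_subset _ _ hh)) hone w
    · push Not at hone
      obtain ⟨h, hh, h', hh', hne⟩ := hone
      obtain ⟨hs, hm⟩ := Finset.mem_filter.mp hh
      obtain ⟨hs', hm'⟩ := Finset.mem_filter.mp hh'
      obtain ⟨p, hp, hp1, hp2⟩ := hP h hs h' hs' hne
      refine ⟨D.at' s p, at'_subset D s p, fun h'' hh'' hn hM' => hn ?_, hw p hp⟩
      exact mem_at'.mpr ⟨hh'', eval_eq_zero_of_mem hM.ne_top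
        (hD.X_sub_C_mem hs hs' hne hm hm' hp1 hp2) hM'⟩
  obtain ⟨s', hs', hout, hw'⟩ := key
  obtain ⟨g, hg, hgw⟩ := exists_smul_mem_AN (I := M) hs' hout
  exact hg (hIM ((hmem g).mpr (hgw w hw')))

/-- The support of the defect module of a central family is the center. -/
lemma WF.X_sub_C_mem_of_annihilator_le (hD : D.WF s) {p : Fin 2 → K} {M : Ideal (S K 2)}
    (hM : M.IsPrime)
    (hle : Module.annihilator (S K 2) ((D.t → S K 2) ⧸ D.AN (D.at' s p)) ≤ M) (i : Fin 2) :
    X i - C (p i) ∈ M := by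
  by_cases hone : ∀ h ∈ (D.at' s p).filter (fun h => D.af h ∈ M),
      ∀ h' ∈ (D.at' s p).filter (fun h => D.af h ∈ M), D.cl h = D.cl h'
  · exfalso
    obtain ⟨g, hg, hgw⟩ := exists_smul_mem_AN (D := D) (s := D.at' s p) (I := M)
      (s' := (D.at' s p).filter (fun h => D.af h ∈ M)) (Finset.filter_subset _ _)
      fun h hh hn hM' => hn (Finset.mem_filter.mpr ⟨hh, hM'⟩)
    refine hg (hle (Module.mem_annihilator.mpr fun x => ?_))
    obtain ⟨w, rfl⟩ := Submodule.mkQ_surjective _ x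
    rw [← map_smul, Submodule.mkQ_apply, Submodule.Quotient.mk_eq_zero]
    refine hgw w (mem_AN_of_forall_cl_eq hD.np (fun h hh => hD.cl_mem h ?_) hone w)
    exact at'_subset D s p (Finset.filter_subset _ _ hh)
  · push Not at hone
    obtain ⟨h, hh, h', hh', hne⟩ := hone
    obtain ⟨hs, hm⟩ := Finset.mem_filter.mp hh
    obtain ⟨hs', hm'⟩ := Finset.mem_filter.mp hh'
    exact hD.X_sub_C_mem (mem_at'.mp hs).1 (mem_at'.mp hs').1 hne hm hm' (mem_at'.mp hs).2
      (mem_at'.mp hs').2 i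

lemma WF.exists_forall_sub_mem_AN (hD : D.WF s) (P : Finset (Fin 2 → K))
    (w : (Fin 2 → K) → D.t → S K 2) : ∃ v, ∀ p ∈ P, v - w p ∈ D.AN (D.at' s p) := by
  have hco : ∀ p q : Fin 2 → K, p ≠ q →
      IsCoprime (Module.annihilator (S K 2) ((D.t → S K 2) ⧸ D.AN (D.at' s p)))
        (Module.annihilator (S K 2) ((D.t → S K 2) ⧸ D.AN (D.at' s q))) := by
    intro p q hpq
    rw [Ideal.isCoprime_iff_sup_eq]
    by_contra hne
    obtain ⟨M, hM, hle⟩ := Ideal.exists_le_maximal _ hne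
    have h1 := hD.X_sub_C_mem_of_annihilator_le hM.isPrime (le_sup_left.trans hle)
    have h2 := hD.X_sub_C_mem_of_annihilator_le hM.isPrime (le_sup_right.trans hle)
    refine hpq (funext fun i => ?_)
    have := eval_eq_zero_of_mem hM.ne_top h1 (h2 i)
    rw [map_sub, eval_X, eval_C] at this
    exact sub_eq_zero.mp this
  have hε : ∀ p : Fin 2 → K, ∃ ε : S K 2, ∀ q ∈ P, ε - Pi.single (M := fun _ => S K 2) p 1 q ∈
      Module.annihilator (S K 2) ((D.t → S K 2) ⧸ D.AN (D.at' s q)) := by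
    intro p
    obtain ⟨ε, hε⟩ := Ideal.exists_forall_sub_mem_ideal
      (I := fun q : P => Module.annihilator (S K 2) ((D.t → S K 2) ⧸ D.AN (D.at' s q)))
      (fun q q' hq => hco q q' fun he => hq (Subtype.ext he))
      fun q => Pi.single (M := fun _ => S K 2) p 1 q.1
    exact ⟨ε, fun q hq => hε ⟨q, hq⟩⟩
  choose ε hε using hε
  refine ⟨∑ p ∈ P, ε p • w p, fun q hq => ?_⟩
  have hsum : ∑ p ∈ P, ε p • w p - w q =
      ∑ p ∈ P, (ε p - Pi.single (M := fun _ => S K 2) p 1 q) • w p := by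
    simp only [sub_smul, Finset.sum_sub_distrib]
    congr 1
    rw [Finset.sum_eq_single q (fun p _ hp => by rw [Pi.single_eq_of_ne hp.symm, zero_smul])
      (fun h => absurd hq h), Pi.single_eq_same, one_smul]
  rw [hsum]
  refine Submodule.sum_mem _ fun p _ => ?_
  have := Module.mem_annihilator.mp (hε p q hq) (Submodule.Quotient.mk (w p))
  rwa [← Submodule.Quotient.mk_smul, Submodule.Quotient.mk_eq_zero] at this

/-- The defect module is the direct sum of its localizations. -/
lemma WF.finrank_tor_eq_sum (hD : D.WF s) (hP : D.Covers s P)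
    (hfin : ∀ p ∈ P, Module.Finite K (D.Tor (D.at' s p))) :
    Module.finrank K (D.Tor s) = ∑ p ∈ P, Module.finrank K (D.Tor (D.at' s p)) := by
  let f : (D.t → S K 2) →ₗ[K] (∀ p : P, D.Tor (D.at' s p)) :=
    LinearMap.pi fun p => ((D.AN (D.at' s p)).restrictScalars K).mkQ
  have hsurj : Function.Surjective f := by
    intro x
    have hx : ∀ p : P, ∃ w, ((D.AN (D.at' s p)).restrictScalars K).mkQ w = x p := fun p =>
      Submodule.mkQ_surjective _ _
    choose w hw using hx
    obtain ⟨v, hv⟩ := hD.exists_forall_sub_mem_AN P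
      fun p => if hp : p ∈ P then w ⟨p, hp⟩ else 0
    refine ⟨v, funext fun p => ?_⟩
    rw [← hw p]
    have := hv p p.2
    rw [dif_pos p.2] at this
    exact (Submodule.Quotient.eq _).mpr this
  have hker : LinearMap.ker f = (D.AN s).restrictScalars K := by
    ext w
    rw [LinearMap.mem_ker]
    constructor
    · intro h
      refine hD.mem_AN_of_forall_at' hP fun p hp => ?_
      exact (Submodule.Quotient.mk_eq_zero _).mp (congrFun h ⟨p, hp⟩)
    · intro h
      exact funext fun p => (Submodule.Quotient.mk_eq_zero _).mpr (AN_anti (at'_subset D s p) h)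
  have hfin' : ∀ p : P, Module.Finite K (D.Tor (D.at' s p)) := fun p => hfin p p.2
  have h := LinearEquiv.finrank_eq (f.quotKerEquivOfSurjective hsurj)
  rw [hker, Module.finrank_pi_fintype] at h
  rw [h]
  exact Finset.sum_coe_sort P fun p => Module.finrank K (D.Tor (D.at' s p))

/-- The sum of the products of multiplicities over the ordered pairs of different classes. -/
noncomputable def pairSum (D : PD K 2 ι κ) (s : Finset ι) : ℕ :=
  ∑ h ∈ s, ∑ h' ∈ s, if D.cl h ≠ D.cl h' then D.m h * D.m h' else 0

lemma WF.sum_mu_sq_add_pairSum (hD : D.WF s) :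
    ∑ k ∈ D.t, D.mu s k ^ 2 + D.pairSum s = (∑ h ∈ s, D.m h) ^ 2 := by
  have h1 : ∑ k ∈ D.t, D.mu s k ^ 2 =
      ∑ h ∈ s, ∑ h' ∈ s, if D.cl h = D.cl h' then D.m h * D.m h' else 0 := by
    have : ∀ k, D.mu s k ^ 2 = ∑ h ∈ s with D.cl h = k, D.m h * D.mu s (D.cl h) := by
      intro k
      rw [sq]
      nth_rewrite 1 [mu]
      rw [Finset.sum_mul]
      exact Finset.sum_congr rfl fun h hh => by rw [(Finset.mem_filter.mp hh).2]
    rw [Finset.sum_congr rfl fun k _ => this k,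
      Finset.sum_fiberwise_of_maps_to (fun h hh => hD.cl_mem h hh)]
    refine Finset.sum_congr rfl fun h _ => ?_
    rw [mu, Finset.mul_sum, Finset.sum_filter]
    exact Finset.sum_congr rfl fun h' _ => by simp only [eq_comm]
  rw [h1, pairSum, ← Finset.sum_add_distrib, sq, Finset.sum_mul_sum]
  refine Finset.sum_congr rfl fun h _ => ?_
  rw [← Finset.sum_add_distrib]
  refine Finset.sum_congr rfl fun h' _ => ?_
  split_ifs <;> simp_all

lemma WF.sum_pairSum_at' (hD : D.WF s) (hP : D.Covers s P) :
    ∑ p ∈ P, D.pairSum (D.at' s p) = D.pairSum s := by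
  have h1 : ∀ p, D.pairSum (D.at' s p) = ∑ h ∈ s, ∑ h' ∈ s,
      if (eval p (D.af h) = 0 ∧ eval p (D.af h') = 0) ∧ D.cl h ≠ D.cl h' then
        D.m h * D.m h' else 0 := by
    intro p
    rw [pairSum, at', Finset.sum_filter]
    refine Finset.sum_congr rfl fun h _ => ?_
    by_cases hp : eval p (D.af h) = 0
    · rw [if_pos hp, Finset.sum_filter]
      refine Finset.sum_congr rfl fun h' _ => ?_
      by_cases hp' : eval p (D.af h') = 0 <;> simp [hp, hp']
    · rw [if_neg hp]
      simp [hp]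
  rw [Finset.sum_congr rfl fun p _ => h1 p, Finset.sum_comm, pairSum]
  refine Finset.sum_congr rfl fun h hh => ?_
  rw [Finset.sum_comm]
  refine Finset.sum_congr rfl fun h' hh' => ?_
  by_cases hne : D.cl h = D.cl h'
  · simp [hne]
  · obtain ⟨p, hp, hp1, hp2⟩ := hP h hh h' hh' hne
    rw [Finset.sum_eq_single_of_mem p hp, if_pos ⟨⟨hp1, hp2⟩, hne⟩, if_pos hne]
    intro q _ hq
    exact if_neg fun hc => hq (hD.eq_of_eval_eq_zero hh hh' hne hc.1.1 hc.1.2 hp1 hp2)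

/-- The two-dimensional inequality and its equality case. -/
theorem WF.mul_le_sum_and_lead_iff (hD : D.WF s) (hP : D.Covers s P) {e : Fin 2 → ℕ}
    (hE : HasExp D.t D.β (D.mu s) e) {d : (Fin 2 → K) → Fin 2 → ℕ}
    (hd : ∀ p ∈ P, HasExp D.t D.β (D.mu (D.at' s p)) (d p)) :
    e 0 * e 1 ≤ ∑ p ∈ P, d p 0 * d p 1 ∧
      (D.Lead s ↔ e 0 * e 1 = ∑ p ∈ P, d p 0 * d p 1) := by
  have hDp : ∀ p, D.WF (D.at' s p) := fun p => hD.mono (at'_subset D s p)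
  have hT := hD.finrank_tor_eq_sum hP fun p hp => (hDp p).finite_tor (hd p hp)
  have hexp : ∀ {u : Finset ι} {c : Fin 2 → ℕ}, D.WF u → HasExp D.t D.β (D.mu u) c →
      ∑ k ∈ D.t, D.mu u k ^ 2 + D.pairSum u = ∑ i, c i ^ 2 + 2 * (c 0 * c 1) := by
    intro u c hu hc
    rw [hu.sum_mu_sq_add_pairSum, ← hu.sum_mu, ← hc.1, Fin.sum_univ_two, Fin.sum_univ_two]
    ring
  have hp : ∀ p ∈ P, 2 * Module.finrank K (D.Tor (D.at' s p)) + 2 * (d p 0 * d p 1) =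
      D.pairSum (D.at' s p) := by
    intro p hp
    have h1 := ((hDp p).lead_iff (hd p hp)).mp
      (lead_of_eval_eq_zero fun h hh => (mem_at'.mp hh).2)
    have h2 := hexp (hDp p) (hd p hp)
    omega
  have hsum := Finset.sum_congr rfl hp
  rw [hD.sum_pairSum_at' hP, Finset.sum_add_distrib, ← Finset.mul_sum, ← Finset.mul_sum,
    ← hT] at hsum
  have h1 := hD.two_mul_finrank_tor_le hE
  have h2 := hexp hD hE
  refine ⟨by omega, ?_⟩
  rw [hD.lead_iff hE]
  omega

end PD

section dehomogenization
variable {r : ℕ}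

/-- Setting the first coordinate to one. -/
noncomputable def dehom : S K (r + 1) →ₐ[K] S K r := aeval (Fin.cons 1 X : Fin (r + 1) → S K r)

lemma dehom_X_zero : dehom (X 0 : S K (r + 1)) = 1 := by simp [dehom]

lemma dehom_X_succ (j : Fin r) : dehom (X j.succ : S K (r + 1)) = X j := by simp [dehom]

lemma dehom_C (a : K) : dehom (C a : S K (r + 1)) = C a := by simp [dehom]

lemma dehom_sig (f : S K r) : dehom (sig f) = f := by
  have : (dehom.comp sig : S K r →ₐ[K] S K r) = AlgHom.id K _ := by
    refine algHom_ext fun j => ?_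
    rw [AlgHom.comp_apply, sig_X, dehom_X_succ, AlgHom.id_apply]
  exact AlgHom.congr_fun this f

lemma dehom_linForm_cons (a : K) (c : Fin r → K) :
    dehom (linForm (Fin.cons a c : Fin (r + 1) → K)) = aff c a := by
  rw [linForm, Fin.sum_univ_succ, aff, linForm, map_add, map_sum, map_mul, dehom_X_zero, dehom_C,
    mul_one, Fin.cons_zero, add_comm]
  congr 1
  refine Finset.sum_congr rfl fun j _ => ?_
  rw [map_mul, dehom_C, dehom_X_succ, Fin.cons_succ]

/-- The homogenization in a given degree. -/
noncomputable def homz (d : ℕ) : S K r →ₗ[K] S K (r + 1) :=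
  ∑ j ∈ Finset.range (d + 1), (LinearMap.mulLeft K (X 0 ^ (d - j))).comp
    (sig.toLinearMap.comp (homogeneousComponent j))

lemma homz_apply (d : ℕ) (f : S K r) :
    homz d f = ∑ j ∈ Finset.range (d + 1), X 0 ^ (d - j) * sig (homogeneousComponent j f) := by
  simp [homz, LinearMap.sum_apply]

lemma sig_isHomogeneous {f : S K r} {j : ℕ} (hf : f.IsHomogeneous j) :
    (sig f).IsHomogeneous j := hf.rename_isHomogeneous

lemma X_zero_pow_isHomogeneous (n : ℕ) : (X 0 ^ n : S K (r + 1)).IsHomogeneous n := by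
  simpa using (isHomogeneous_X K (0 : Fin (r + 1))).pow n

lemma homz_isHomogeneous (d : ℕ) (f : S K r) : (homz d f).IsHomogeneous d := by
  rw [homz_apply]
  refine IsHomogeneous.sum _ _ _ fun j hj => ?_
  have := (X_zero_pow_isHomogeneous (K := K) (r := r) (d - j)).mul
    (sig_isHomogeneous (homogeneousComponent_isHomogeneous j f))
  rwa [Nat.sub_add_cancel (Nat.lt_succ_iff.mp (Finset.mem_range.mp hj))] at this

lemma homz_of_isHomogeneous {d j : ℕ} (hj : j ≤ d) {f : S K r} (hf : f.IsHomogeneous j) :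
    homz d f = X 0 ^ (d - j) * sig f := by
  rw [homz_apply, Finset.sum_eq_single_of_mem j (Finset.mem_range.mpr (Nat.lt_succ_of_le hj)),
    homogeneousComponent_of_isHomogeneous hf, if_pos rfl]
  intro i _ hi
  rw [homogeneousComponent_of_isHomogeneous hf, if_neg hi, map_zero, mul_zero]

lemma rho_homz (d : ℕ) (f : S K r) : rho (homz d f) = homogeneousComponent d f := by
  rw [homz_apply, map_sum, Finset.sum_eq_single_of_mem d (Finset.self_mem_range_succ d)]
  · rw [map_mul, Nat.sub_self, pow_zero, map_one, one_mul, rho_sig]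
  · intro j hj hjd
    have : d - j ≠ 0 := by
      have := Finset.mem_range.mp hj
      omega
    rw [map_mul, map_pow, rho_X_zero, zero_pow this, zero_mul]

lemma sum_homogeneousComponent_of_mem_degLT {n : ℕ} {f : S K r} (hf : f ∈ degLT K r n) :
    ∑ j ∈ Finset.range n, homogeneousComponent j f = f := by
  conv_rhs => rw [← sum_homogeneousComponent f]
  by_cases h0 : f = 0
  · simp [h0]
  · have h := totalDegree_lt_of_mem_degLT hf h0
    refine (Finset.sum_subset (Finset.range_subset_range.mpr h) fun j _ hj => ?_).symm
    exact homogeneousComponent_eq_zero _ _ (by simpa [Nat.lt_succ_iff] using hj)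

lemma dehom_homz {d : ℕ} {f : S K r} (hf : f ∈ degLT K r (d + 1)) : dehom (homz d f) = f := by
  rw [homz_apply, map_sum]
  refine Eq.trans (Finset.sum_congr rfl fun j _ => ?_) (sum_homogeneousComponent_of_mem_degLT hf)
  rw [map_mul, map_pow, dehom_X_zero, one_pow, one_mul, dehom_sig]

lemma monomial_eq_X_zero_mul (x : Fin (r + 1) →₀ ℕ) (c : K) :
    ∃ g : S K r, g.IsHomogeneous (x.degree - x 0) ∧ x 0 ≤ x.degree ∧
      monomial x c = X 0 ^ x 0 * sig g := by
  have hdeg : x.degree = x 0 + ∑ j : Fin r, x j.succ := by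
    rw [Finsupp.degree_eq_sum, Fin.sum_univ_succ]
  refine ⟨C c * ∏ j : Fin r, X j ^ x j.succ, ?_, by omega, ?_⟩
  · have := (isHomogeneous_C (Fin r) c).mul (IsHomogeneous.prod Finset.univ
      (fun j : Fin r => (X j : S K r) ^ x j.succ) (fun j => x j.succ) fun j _ => by
        simpa using (isHomogeneous_X K j).pow (x j.succ))
    rwa [zero_add, show ∑ j : Fin r, x j.succ = x.degree - x 0 by omega] at this
  · rw [monomial_eq, Finsupp.prod_fintype _ _ (fun i => pow_zero _), Fin.prod_univ_succ, map_mul,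
      sig_C, map_prod]
    simp only [map_pow, sig_X]
    ring

lemma dehom_monomial {d : ℕ} {x : Fin (r + 1) →₀ ℕ} (hx : x.degree = d) (c : K) :
    dehom (monomial x c) ∈ degLT K r (d + 1) ∧
      homz d (dehom (monomial x c)) = monomial x c := by
  obtain ⟨g, hg, hle, h⟩ := monomial_eq_X_zero_mul x c
  have h1 : dehom (monomial x c) = g := by
    rw [h, map_mul, map_pow, dehom_X_zero, one_pow, one_mul, dehom_sig]
  rw [h1]
  refine ⟨mem_degLT_of_isHomogeneous hg (by omega), ?_⟩
  rw [homz_of_isHomogeneous (by omega) hg, h]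
  congr 2
  omega

lemma degree_eq_of_mem_support {d : ℕ} {G : S K r} (hG : G.IsHomogeneous d) {x : Fin r →₀ ℕ}
    (hx : x ∈ G.support) : x.degree = d :=
  by_contra fun h => mem_support_iff.mp hx (hG.coeff_eq_zero h)

lemma dehom_mem_degLT {d : ℕ} {G : S K (r + 1)} (hG : G.IsHomogeneous d) :
    dehom G ∈ degLT K r (d + 1) := by
  rw [G.as_sum, map_sum]
  exact Submodule.sum_mem _ fun x hx =>
    (dehom_monomial (degree_eq_of_mem_support hG hx) _).1

lemma homz_dehom {d : ℕ} {G : S K (r + 1)} (hG : G.IsHomogeneous d) : homz d (dehom G) = G := by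
  conv_rhs => rw [G.as_sum]
  conv_lhs => rw [G.as_sum]
  rw [map_sum, map_sum]
  exact Finset.sum_congr rfl fun x hx =>
    (dehom_monomial (degree_eq_of_mem_support hG hx) _).2

lemma isTop_dehom {d : ℕ} {G : S K (r + 1)} (hG : G.IsHomogeneous d) :
    IsTop (dehom G) (rho G) d := by
  have h := rho_homz d (dehom G)
  rw [homz_dehom hG] at h
  refine ⟨rho_isHomogeneous hG, mem_degLT_iff_homogeneousComponent.mpr fun j hj => ?_⟩
  rcases hj.eq_or_lt with rfl | hj
  · rw [map_sub, h, homogeneousComponent_of_isHomogeneous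
      (homogeneousComponent_isHomogeneous d (dehom G)), if_pos rfl, sub_self]
  · rw [map_sub, mem_degLT_iff_homogeneousComponent.mp (dehom_mem_degLT hG) j hj,
      homogeneousComponent_of_isHomogeneous (rho_isHomogeneous hG), if_neg hj.ne', sub_self]

/-- Divisibility of forms can be tested after dehomogenization. -/
lemma dvd_of_dehom_dvd {a d : ℕ} {G F : S K (r + 1)} (hG : G.IsHomogeneous a)
    (hF : F.IsHomogeneous d) (hdeg : (dehom G).totalDegree = a) (h0 : dehom G ≠ 0)
    (h : dehom G ∣ dehom F) : G ∣ F := by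
  obtain ⟨q, hq⟩ := h
  by_cases hq0 : q = 0
  · rw [hq0, mul_zero] at hq
    rw [← homz_dehom hF, hq, map_zero]
    exact dvd_zero _
  · have h1 := totalDegree_lt_of_mem_degLT (dehom_mem_degLT hF) (hq ▸ mul_ne_zero h0 hq0)
    rw [hq, totalDegree_mul_of_isDomain h0 hq0, hdeg] at h1
    refine ⟨homz (d - a) q, ?_⟩
    have hh : (G * homz (d - a) q).IsHomogeneous d := by
      have := hG.mul (homz_isHomogeneous (d - a) q)
      rwa [Nat.add_sub_cancel' (by omega)] at this
    rw [← homz_dehom hF, ← homz_dehom hh, map_mul, dehom_homz, hq]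
    exact mem_degLT_of_totalDegree_lt (by omega)

end dehomogenization

namespace PD
section
variable {r : ℕ} {ι κ : Type*} {D : PD K r ι κ} {s : Finset ι}

lemma dehom_al (h : ι) : dehom (D.al h) = D.af h := dehom_linForm_cons _ _

lemma WF.al_pow_dvd (hD : D.WF s) {h : ι} (hh : h ∈ s) {F : S K (r + 1)} {d : ℕ}
    (hF : F.IsHomogeneous d) (hdvd : D.af h ^ D.m h ∣ dehom F) : D.al h ^ D.m h ∣ F := by
  have hb := hD.np.1 _ (hD.cl_mem h hh)
  have htop := (IsTop.aff (D.β (D.cl h)) (D.av h)).pow (D.m h)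
  rw [mul_one] at htop
  have hd : dehom (D.al h ^ D.m h) = D.af h ^ D.m h := by rw [map_pow, dehom_al]
  refine dvd_of_dehom_dvd (a := D.m h) ?_ hF ?_ ?_ (hd ▸ hdvd)
  · have := (linForm_isHomogeneous (D.cov h)).pow (D.m h)
    rwa [one_mul] at this
  · rw [hd]
    exact htop.totalDegree_eq (pow_ne_zero _ (linForm_ne_zero hb))
  · rw [hd]
    exact pow_ne_zero _ (aff_ne_zero hb _)

/-- The lift of the first coordinate field. -/
lemma Good.exists_first (hG : D.Good s) : ∃ u ∈ D.Dh s, u 0 = 1 ∧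
    ∀ j : Fin r, rho (u j.succ) = 0 ∧ (u j.succ).IsHomogeneous D.m0 := by
  obtain ⟨u, hu, hv, -, h0, -, h1⟩ := exists_homogeneous_lift hG
    (v := Fin.cons 1 0) (d := D.m0) (cons_mem_E (Submodule.zero_mem _))
    (fun _ => by simpa using isHomogeneous_one (Fin r) K) (by simp)
    (fun j => by simpa using isHomogeneous_zero (Fin r) K _)
  refine ⟨u, hu, ?_, fun j => ⟨by simpa using congrFun hv j.succ, h1 j⟩⟩
  have h2 := h0 le_rfl
  rw [Nat.sub_self, ← totalDegree_zero_iff_isHomogeneous] at h2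
  have h3 := congrFun hv 0
  rw [totalDegree_eq_zero_iff_eq_C.mp h2] at h3 ⊢
  simp only [rho_C, Fin.cons_zero] at h3
  rw [C_injective (Fin r) K (h3.trans (map_one C).symm), map_one]

/-- Liftability implies the leading part property. -/
lemma WF.lead_of_good (hD : D.WF s) (hG : D.Good s) : D.Lead s := by
  intro j e he hej
  obtain ⟨u₁, hu₁, h10, h11⟩ := hG.exists_first
  obtain ⟨u, hu, hv, -, h0, h0', h1⟩ := exists_homogeneous_lift hG
    (v := Fin.cons 0 e) (d := j) (cons_mem_E he)
    (fun _ => by simpa using isHomogeneous_zero (Fin r) K _) (by simp) (fun i => by simpa using hej i)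
  have hw : u - u 0 • u₁ ∈ D.Dh s := Submodule.sub_mem _ hu (Submodule.smul_mem _ _ hu₁)
  have hhom : ∀ i : Fin r, (u i.succ - u 0 * u₁ i.succ).IsHomogeneous j := by
    intro i
    refine (h1 i).sub ?_
    by_cases hj : D.m0 ≤ j
    · have := (h0 hj).mul (h11 i).2
      rwa [Nat.sub_add_cancel hj] at this
    · rw [h0' (not_le.mp hj), zero_mul]
      exact isHomogeneous_zero _ _ _
  have hrho : ∀ i : Fin r, rho (u i.succ - u 0 * u₁ i.succ) = e i := by
    intro i
    have := congrFun hv i.succ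
    rw [map_sub, map_mul, (h11 i).1, mul_zero, sub_zero, this, Fin.cons_succ]
  refine ⟨fun i => dehom (u i.succ - u 0 * u₁ i.succ), fun k hk => ?_,
    mem_tupLT.mpr fun i => ?_⟩
  · rw [hD.cp_dvd_iff hk]
    rintro h hh rfl
    have h2 := hw h hh
    have h3 : D.bv h (u - u 0 • u₁) =
        ev (D.β (D.cl h)) fun i => u i.succ - u 0 * u₁ i.succ := by
      rw [bv_apply]
      have : (u - u 0 • u₁) 0 = 0 := by
        rw [Pi.sub_apply, Pi.smul_apply, h10, smul_eq_mul, mul_one, sub_self]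
      rw [this, mul_zero, mul_zero, zero_add]
      rfl
    rw [h3] at h2
    have h4 := map_dvd dehom h2
    rw [map_pow, dehom_al, map_ev] at h4
    exact h4
  · rw [Pi.sub_apply, ← hrho i]
    exact (isTop_dehom (hhom i)).2

lemma sum_tupComp {τ : Type*} {n : ℕ} {f : τ → S K r} (hf : f ∈ tupLT K r τ n) :
    ∑ j ∈ Finset.range n, tupComp K r τ j f = f := by
  funext i
  rw [Finset.sum_apply]
  exact sum_homogeneousComponent_of_mem_degLT (mem_tupLT.mp hf i)

lemma Lead.exists_lift (hD : D.WF s) (hL : D.Lead s) {j : ℕ} {e : Fin r → S K r}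
    (he : e ∈ LD D.t D.β (D.mu s)) (hej : ∀ i, (e i).IsHomogeneous j) :
    ∃ u ∈ D.Dh s, (fun i => rho (u i)) = (Fin.cons 0 e : Fin (r + 1) → S K r) := by
  obtain ⟨φ, hφ, hφe⟩ := hL j e he hej
  have hφ1 : ∀ i, φ i ∈ degLT K r (j + 1) := by
    intro i
    have := Submodule.add_mem _ (degLT_mono j.le_succ (mem_tupLT.mp hφe i))
      (mem_degLT_of_isHomogeneous (hej i) j.lt_succ_self)
    rwa [Pi.sub_apply, sub_add_cancel] at this
  refine ⟨Fin.cons 0 fun i => homz j (φ i), fun h hh => ?_, ?_⟩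
  · rw [bv_apply]
    simp only [Fin.cons_zero, Fin.cons_succ, mul_zero, zero_add]
    refine hD.al_pow_dvd hh (d := j) ?_ ?_
    · rw [ev]
      refine IsHomogeneous.sum _ _ _ fun i _ => ?_
      rw [smul_eq_C_mul]
      exact (homz_isHomogeneous j (φ i)).C_mul _
    · rw [map_ev]
      simp only [dehom_homz (hφ1 _)]
      exact (af_dvd_cp hh).trans (hφ _ (hD.cl_mem h hh))
  · funext i
    refine Fin.cases ?_ (fun i => ?_) i
    · simp
    · simp only [Fin.cons_succ]
      rw [rho_homz]
      have h1 := mem_degLT_iff_homogeneousComponent.mp (mem_tupLT.mp hφe i) j le_rfl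
      rw [Pi.sub_apply, map_sub, homogeneousComponent_of_isHomogeneous (hej i), if_pos rfl] at h1
      exact sub_eq_zero.mp h1

lemma Lead.exists_lift_of_mem (hD : D.WF s) (hL : D.Lead s) {e : Fin r → S K r}
    (he : e ∈ LD D.t D.β (D.mu s)) :
    ∃ u ∈ D.Dh s, (fun i => rho (u i)) = (Fin.cons 0 e : Fin (r + 1) → S K r) := by
  obtain ⟨n, hn⟩ := exists_mem_degLT e
  have h : ∀ j, ∃ u ∈ D.Dh s, (fun i => rho (u i)) =
      (Fin.cons 0 (tupComp K r (Fin r) j e) : Fin (r + 1) → S K r) := fun j =>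
    Lead.exists_lift hD hL (hD.leadIn.1 j e he) (tupComp_isHomogeneous j e)
  choose u hu huv using h
  refine ⟨∑ j ∈ Finset.range n, u j, Submodule.sum_mem _ fun j _ => hu j, ?_⟩
  funext i
  rw [Finset.sum_apply, map_sum, Finset.sum_congr rfl fun j _ => congrFun (huv j) i]
  refine Fin.cases ?_ (fun i => ?_) i
  · simp
  · simp only [Fin.cons_succ]
    rw [← Finset.sum_apply, sum_tupComp (mem_tupLT.mpr hn)]

end

variable {ι κ : Type*} {D : PD K 2 ι κ} {s : Finset ι} {P : Finset (Fin 2 → K)}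

/-- The leading part property implies liftability in the plane. -/
lemma WF.good_of_lead (hD : D.WF s) (hP : D.Covers s P) (hL : D.Lead s) : D.Good s := by
  have hfirst : ∃ u ∈ D.Dh s, u 0 = 1 ∧ ∀ j : Fin 2, rho (u j.succ) = 0 := by
    choose Q hQ hQ0 hQs using fun k : D.t => hD.interp k k.2
    have hw : (fun k => dehom (Q k)) ∈ D.AN s := by
      refine hD.mem_AN_of_forall_at' hP fun p _ => mem_AN.mpr ⟨fun i => C (p i), fun k => ?_⟩
      rw [(hD.mono (at'_subset D s p)).cp_dvd_iff k.2]
      intro h hh hk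
      have h1 := map_dvd dehom (hQs k h (at'_subset D s p hh) hk)
      rw [map_pow, dehom_al, map_add, map_mul, map_pow, dehom_X_zero, one_pow, mul_one,
        dehom_C] at h1
      have h2 : ev (D.β k) (fun i => (C (p i) : S K 2)) = -C (D.av h) := by
        have h3 := (mem_at'.mp hh).2
        rw [af, eval_aff, hk] at h3
        rw [← map_neg, ← eq_neg_of_add_eq_zero_left h3, map_sum, ev]
        exact Finset.sum_congr rfl fun i _ => by rw [smul_eq_C_mul, map_mul]
      rw [h2, sub_neg_eq_add]
      exact h1
    obtain ⟨φ, hφ, hdvd⟩ := hD.exists_of_lead hL (n := D.m0) hw (mem_tupLT.mpr fun k => by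
      have := (isTop_dehom (hQ k)).2
      rwa [hQ0 k, sub_zero] at this)
    have hφ0 := mem_tupLT.mp hφ
    refine ⟨Fin.cons 1 fun i => homz D.m0 (φ i), fun h hh => ?_, Fin.cons_zero _ _, fun i => ?_⟩
    · rw [bv_apply]
      simp only [Fin.cons_zero, Fin.cons_succ, mul_one]
      refine hD.al_pow_dvd hh (d := D.m0) ?_ ?_
      · refine ((X_zero_pow_isHomogeneous D.m0).C_mul _).add ?_
        rw [ev]
        refine IsHomogeneous.sum _ _ _ fun i _ => ?_
        rw [smul_eq_C_mul]
        exact (homz_isHomogeneous D.m0 (φ i)).C_mul _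
      · rw [map_add, map_mul, map_pow, dehom_X_zero, one_pow, mul_one, dehom_C, map_ev]
        simp only [fun i => dehom_homz (degLT_mono D.m0.le_succ (hφ0 i))]
        have hk := hD.cl_mem h hh
        have h1 := map_dvd dehom (hQs ⟨D.cl h, hk⟩ h hh rfl)
        rw [map_pow, dehom_al, map_add, map_mul, map_pow, dehom_X_zero, one_pow, mul_one,
          dehom_C] at h1
        have h2 := dvd_sub h1 ((af_dvd_cp hh).trans (hdvd ⟨D.cl h, hk⟩))
        convert h2 using 1
        ring
    · rw [Fin.cons_succ, rho_homz]
      exact mem_degLT_iff_homogeneousComponent.mp (hφ0 i) _ le_rfl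
  obtain ⟨u₁, hu₁, h10, h11⟩ := hfirst
  intro v hv
  obtain ⟨u, hu, huv⟩ := Lead.exists_lift_of_mem hD hL (mem_E_iff.mp hv)
  refine ⟨sig (v 0) • u₁ + u, Submodule.add_mem _ (Submodule.smul_mem _ _ hu₁) hu, ?_⟩
  funext i
  have h1 := congrFun huv i
  rw [Pi.add_apply, Pi.smul_apply, smul_eq_mul, map_add, map_mul, rho_sig, h1]
  refine Fin.cases ?_ (fun i => ?_) i
  · rw [h10, map_one, mul_one, Fin.cons_zero, add_zero]
  · rw [h11 i, mul_zero, Fin.cons_succ, zero_add]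
    rfl

end PD

section prodNZ
variable {r k : ℕ}

/-- The product of the nonzero entries. -/
noncomputable def prodNZ (d : Fin r → ℕ) : ℕ := ∏ i ∈ Finset.univ.filter (fun i => d i ≠ 0), d i

lemma prodNZ_eq (d : Fin r → ℕ) : prodNZ d = ∏ i, if d i ≠ 0 then d i else 1 :=
  Finset.prod_filter _ _

lemma prodNZ_comp {d : Fin r → ℕ} {σ : Fin k → Fin r} (hσ : Function.Injective σ)
    (h : ∀ i, i ∉ Set.range σ → d i = 0) : prodNZ d = prodNZ (d ∘ σ) := by
  rw [prodNZ_eq, prodNZ_eq]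
  refine (Finset.prod_of_injOn σ hσ.injOn (fun _ _ => by simp) (fun i _ hi => ?_)
    fun _ _ => rfl).symm
  rw [h i (by simpa using hi)]
  simp

lemma prodNZ_of_ne_zero {d : Fin r → ℕ} (h : ∀ i, d i ≠ 0) : prodNZ d = ∏ i, d i := by
  rw [prodNZ_eq]
  exact Finset.prod_congr rfl fun i _ => if_pos (h i)

lemma prodNZ_succAbove (d : Fin (r + 1) → ℕ) (i : Fin (r + 1)) (hi : d i ≠ 0) :
    prodNZ d = d i * prodNZ (d ∘ i.succAbove) := by
  rw [prodNZ_eq, Fin.prod_univ_succAbove _ i, if_pos hi, prodNZ_eq]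
  rfl

end prodNZ

section
variable {r : ℕ} {ι : Type*}

/-- Exponents of a family spanning the dual space are nonzero. -/
lemma HasExp.ne_zero {s : Finset ι} {a : ι → Fin r → K} {m : ι → ℕ} {d : Fin r → ℕ}
    (h : HasExp s a m d) (ha : ∀ h ∈ s, a h ≠ 0) (hm : ∀ h ∈ s, m h ≠ 0)
    (hs : ∀ v : Fin r → K, (∀ h ∈ s, ∑ j, a h j * v j = 0) → v = 0) (i : Fin r) : d i ≠ 0 := by
  obtain ⟨-, θ, hθ, hhom, hdet⟩ := h
  intro hi
  have hC : ∀ j, θ i j = C (coeff 0 (θ i j)) := fun j => by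
    have := hhom i j
    rw [hi, ← totalDegree_zero_iff_isHomogeneous] at this
    exact totalDegree_eq_zero_iff_eq_C.mp this
  have h0 := hs (fun j => coeff 0 (θ i j)) fun h hh => by
    have h1 := hθ i h hh
    have h2 : ev (a h) (θ i) = C (∑ j, a h j * coeff 0 (θ i j)) := by
      rw [ev, map_sum]
      refine Finset.sum_congr rfl fun j _ => ?_
      conv_lhs => rw [hC j]
      rw [smul_eq_C_mul, map_mul]
    rw [h2] at h1
    by_contra hne
    have h3 : IsUnit (linForm (a h) ^ m h) :=
      isUnit_of_dvd_unit h1 ((isUnit_iff_ne_zero.mpr hne).map C)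
    exact (prime_linForm (ha h hh)).not_isUnit ((isUnit_pow_iff (hm h hh)).mp h3)
  refine hdet (Matrix.det_eq_zero_of_row_eq_zero i fun j => ?_)
  rw [hC j, show coeff 0 (θ i j) = 0 from congrFun h0 j, map_zero]

/-- A family of two independent covectors of the plane determines a vector. -/
lemma eq_zero_of_sum_eq_zero {c c' : Fin 2 → K} (hc : c ≠ 0) (h : ∀ u : K, c' ≠ u • c)
    {v : Fin 2 → K} (h1 : ∑ j, c j * v j = 0) (h2 : ∑ j, c' j * v j = 0) : v = 0 := by
  have hdet := det_ne_zero_of_ne_smul hc h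
  rw [Fin.sum_univ_two] at h1 h2
  funext i
  refine (mul_eq_zero.mp (?_ : (c 0 * c' 1 - c 1 * c' 0) * v i = 0)).resolve_left hdet
  fin_cases i
  · simp only [Fin.zero_eta]
    linear_combination c' 1 * h1 - c 1 * h2
  · simp only [Fin.mk_one]
    linear_combination c 0 * h2 - c' 0 * h1

/-- The nonzero exponents of a planar family containing two transversal lines. -/
lemma HasExp.prodNZ_eq_mul {s : Finset ι} {a : ι → Fin 2 → K} {m : ι → ℕ} {d : Fin 2 → ℕ}
    (h : HasExp s a m d) (hs : NP s a) (hm : ∀ h ∈ s, m h ≠ 0) {k k' : ι} (hk : k ∈ s)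
    (hk' : k' ∈ s) (hne : k ≠ k') : prodNZ d = d 0 * d 1 := by
  rw [prodNZ_of_ne_zero (h.ne_zero hs.1 hm fun v hv => eq_zero_of_sum_eq_zero (hs.1 k hk)
    (hs.2 k hk k' hk' hne) (hv k hk) (hv k' hk')), Fin.prod_univ_two]

/-- The nonzero exponents of a single weighted hyperplane. -/
lemma HasExp.prodNZ_eq_of_forall {s : Finset ι} {a : ι → Fin r → K} {m : ι → ℕ} {d : Fin r → ℕ}
    (h : HasExp s a m d) {k : ι} (hk : k ∈ s) (hs : a k ≠ 0) (h0 : ∀ h ∈ s, h ≠ k → m h = 0)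
    (hm : m k ≠ 0) : prodNZ d = m k := by
  have h1 : HasExp ({k} : Finset ι) a m d := by
    refine h.congr ?_ fun k' hk' => Or.inr ⟨k, hk, ?_⟩
    · rw [Finset.sum_singleton, Finset.sum_eq_single_of_mem k hk h0]
    · rw [Finset.mem_singleton.mp hk']
      exact ⟨rfl, 1, one_ne_zero, (one_smul _ _).symm⟩
  let J : (Fin 1 → K) →ₗ[K] (Fin r → K) := (LinearMap.proj 0).smulRight (a k)
  have hJ : Function.Injective J := by
    rw [← LinearMap.ker_eq_bot, LinearMap.ker_eq_bot']
    intro x hx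
    have : x 0 • a k = 0 := hx
    funext i
    rw [Subsingleton.elim i 0]
    exact (smul_eq_zero.mp this).resolve_right hs
  have hnp : NP ({k} : Finset ι) fun _ : ι => (1 : Fin 1 → K) :=
    ⟨fun _ _ => one_ne_zero, fun x hx y hy hxy =>
      (hxy (by rw [Finset.mem_singleton.mp hx, Finset.mem_singleton.mp hy])).elim⟩
  have h2 : HasExp ({k} : Finset ι) (fun _ : ι => J 1) m d :=
    h1.congr rfl fun k' hk' => Or.inr ⟨k', hk', rfl, 1, one_ne_zero, by
      rw [Finset.mem_singleton.mp hk', one_smul]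
      exact one_smul K (a k)⟩
  obtain ⟨σ, hσ, hσ0, h3⟩ := HasExp.of_injective hnp hJ h2
  have h4 : (d ∘ σ) 0 = m k := by simpa using h3.1
  rw [prodNZ_comp hσ hσ0, prodNZ_of_ne_zero (fun i => by
    rw [Subsingleton.elim i 0, h4]; exact hm), Fin.prod_univ_one, h4]

end

namespace PD
variable {r n : ℕ} {ι κ : Type*}

/-- The members of a class. -/
noncomputable def cls (D : PD K r ι κ) (s : Finset ι) (k : κ) : Finset ι :=
  s.filter fun h => D.cl h = k

lemma mem_cls {D : PD K r ι κ} {s : Finset ι} {k : κ} {h : ι} :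
    h ∈ D.cls s k ↔ h ∈ s ∧ D.cl h = k := by
  rw [cls, Finset.mem_filter]

lemma cls_subset (D : PD K r ι κ) (s : Finset ι) (k : κ) : D.cls s k ⊆ s :=
  Finset.filter_subset _ _

lemma mu_eq_sum_cls (D : PD K r ι κ) (s : Finset ι) (k : κ) :
    D.mu s k = ∑ h ∈ D.cls s k, D.m h := rfl

lemma mu_cls (D : PD K r ι κ) (s : Finset ι) (k k' : κ) :
    D.mu (D.cls s k) k' = if k' = k then D.mu s k else 0 := by
  split_ifs with hk
  · rw [hk, mu_eq_sum_cls, mu_eq_sum_cls]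
    refine Finset.sum_congr (Finset.ext fun h => ?_) fun _ _ => rfl
    rw [mem_cls, mem_cls, and_assoc, and_self_iff]
  · refine Finset.sum_eq_zero fun x hx => (hk ?_).elim
    obtain ⟨h1, h2⟩ := mem_cls.mp hx
    exact h2.symm.trans (mem_cls.mp h1).2

/-- The family with positive multiplicities is well formed because the distinguished
hyperplane dominates every class with at least two members. -/
structure Heavy (D : PD K r ι κ) (s : Finset ι) : Prop where
  cl_mem : ∀ h ∈ s, D.cl h ∈ D.t
  np : NP D.t D.β
  inj : ∀ h ∈ s, ∀ h' ∈ s, D.cl h = D.cl h' → D.av h = D.av h' → h = h'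
  m0_pos : 0 < D.m0
  heavy : ∀ k ∈ D.t, (D.cls s k).card ≤ 1 ∨ D.mu s k ≤ D.m0

lemma Heavy.wf {D : PD K r ι κ} {s : Finset ι} (h : D.Heavy s) : D.WF s where
  cl_mem := h.cl_mem
  np := h.np
  inj := h.inj
  interp k hk := by
    obtain ⟨P, h1, h2, h3⟩ := D.exists_interp (s' := D.cls s k) (k := k)
      (fun x hx => (Finset.mem_filter.mp hx).2)
      (fun x hx y hy hxy => h.inj x (Finset.mem_filter.mp hx).1 y (Finset.mem_filter.mp hy).1
        ((Finset.mem_filter.mp hx).2.trans (Finset.mem_filter.mp hy).2.symm) hxy)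
      h.m0_pos (h.heavy k hk)
    exact ⟨P, h1, h2, fun x hx hxk => h3 x (Finset.mem_filter.mpr ⟨hx, hxk⟩)⟩

/-- The members of the family whose class lies in a subspace. -/
noncomputable def inside (D : PD K n ι κ) (s : Finset ι) (W : Submodule K (Fin n → K)) : Finset ι :=
  s.filter fun h => D.β (D.cl h) ∈ W

lemma mem_inside {D : PD K n ι κ} {s : Finset ι} {W : Submodule K (Fin n → K)} {h : ι} :
    h ∈ D.inside s W ↔ h ∈ s ∧ D.β (D.cl h) ∈ W := by
  rw [inside, Finset.mem_filter]

lemma inside_subset (D : PD K n ι κ) (s : Finset ι) (W : Submodule K (Fin n → K)) :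
    D.inside s W ⊆ s := Finset.filter_subset _ _

/-- The family of the members whose class lies in a subspace, in coordinates of that subspace. -/
noncomputable def pull (D : PD K n ι κ) (q : (Fin n → K) →ₗ[K] (Fin r → K))
    (W : Submodule K (Fin n → K)) : PD K r ι κ where
  cl := D.cl
  av := D.av
  m := D.m
  m0 := D.m0
  β := fun k => q (D.β k)
  t := D.t.filter fun k => D.β k ∈ W

lemma mem_pull_t {D : PD K n ι κ} {q : (Fin n → K) →ₗ[K] (Fin r → K)}
    {W : Submodule K (Fin n → K)} {k : κ} : k ∈ (D.pull q W).t ↔ k ∈ D.t ∧ D.β k ∈ W := by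
  rw [pull, Finset.mem_filter]

lemma mu_pull {D : PD K n ι κ} {q : (Fin n → K) →ₗ[K] (Fin r → K)}
    {W : Submodule K (Fin n → K)} {s : Finset ι} : (D.pull q W).mu s = D.mu s := rfl

lemma mu_inside {D : PD K n ι κ} {s : Finset ι} {W : Submodule K (Fin n → K)} {k : κ}
    (hk : D.β k ∈ W) : D.mu (D.inside s W) k = D.mu s k := by
  rw [mu, mu]
  refine Finset.sum_congr (Finset.ext fun h => ?_) fun _ _ => rfl
  rw [Finset.mem_filter, Finset.mem_filter, mem_inside]
  constructor
  · exact fun h => ⟨h.1.1, h.2⟩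
  · rintro ⟨h1, rfl⟩
    exact ⟨⟨h1, hk⟩, rfl⟩

variable {D : PD K n ι κ} {s : Finset ι} {W : Submodule K (Fin n → K)}
  {q : (Fin n → K) →ₗ[K] (Fin r → K)} {J : (Fin r → K) →ₗ[K] (Fin n → K)}

lemma np_pull (hnp : NP D.t D.β) (hq : ∀ x ∈ W, J (q x) = x) :
    NP (D.pull q W).t (D.pull q W).β := by
  refine ⟨fun k hk h0 => ?_, fun k hk k' hk' hne u hu => ?_⟩
  · obtain ⟨hk, hkW⟩ := mem_pull_t.mp hk
    refine hnp.1 k hk ?_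
    have h1 : q (D.β k) = 0 := h0
    rw [← hq _ hkW, h1, map_zero]
  · obtain ⟨hk, hkW⟩ := mem_pull_t.mp hk
    obtain ⟨hk', hkW'⟩ := mem_pull_t.mp hk'
    refine hnp.2 k hk k' hk' hne u ?_
    have h1 : q (D.β k') = u • q (D.β k) := hu
    rw [← hq _ hkW', h1, map_smul, hq _ hkW]

lemma Heavy.pull (h : D.Heavy s) (hq : ∀ x ∈ W, J (q x) = x) :
    (D.pull q W).Heavy (D.inside s W) where
  cl_mem x hx := mem_pull_t.mpr ⟨h.cl_mem x (mem_inside.mp hx).1, (mem_inside.mp hx).2⟩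
  np := np_pull h.np hq
  inj x hx y hy := h.inj x (mem_inside.mp hx).1 y (mem_inside.mp hy).1
  m0_pos := h.m0_pos
  heavy k hk := by
    obtain ⟨hk, hkW⟩ := mem_pull_t.mp hk
    rw [mu_pull, mu_inside hkW]
    refine (h.heavy k hk).imp_left fun h1 => (Finset.card_le_card ?_).trans h1
    exact Finset.filter_subset_filter _ (inside_subset D s W)

/-- Extension of a linear map by the identity on a first coordinate. -/
noncomputable def consMap (J : (Fin r → K) →ₗ[K] (Fin n → K)) :
    (Fin (r + 1) → K) →ₗ[K] (Fin (n + 1) → K) where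
  toFun c := Fin.cons (c 0) (J fun j => c j.succ)
  map_add' c c' := by
    have : (fun j : Fin r => (c + c') j.succ) = (fun j => c j.succ) + fun j => c' j.succ := rfl
    rw [this, map_add]
    funext j
    refine Fin.cases ?_ (fun j => ?_) j <;> simp
  map_smul' u c := by
    have : (fun j : Fin r => (u • c) j.succ) = u • (fun j => c j.succ) := rfl
    rw [this, map_smul]
    funext j
    refine Fin.cases ?_ (fun j => ?_) j <;> simp

lemma consMap_cons (x : K) (c : Fin r → K) :
    consMap J (Fin.cons x c : Fin (r + 1) → K) = Fin.cons x (J c) := by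
  simp [consMap]

lemma consMap_injective (hJ : Function.Injective J) : Function.Injective (consMap J) := by
  rw [← LinearMap.ker_eq_bot, LinearMap.ker_eq_bot']
  intro c hc
  have h0 : c 0 = 0 := congrFun hc 0
  have h1 : J (fun j => c j.succ) = 0 := funext fun j => congrFun hc j.succ
  have h2 := hJ (h1.trans (map_zero J).symm)
  funext j
  exact Fin.cases h0 (fun j => congrFun h2 j) j

lemma consMap_full (hq : ∀ x ∈ W, J (q x) = x) {h : Option ι}
    (hh : h ∈ Finset.insertNone (D.inside s W)) : consMap J ((D.pull q W).full h) = D.full h := by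
  cases h with
  | none =>
    rw [full, full, consMap_cons, map_zero]
  | some h =>
    have := (mem_inside.mp (Finset.some_mem_insertNone.mp hh)).2
    rw [full, full, cov, cov, consMap_cons]
    congr 1
    exact hq _ this

lemma Heavy.hasExp_pull (h : D.Heavy s) (hJ : Function.Injective J) (hq : ∀ x ∈ W, J (q x) = x)
    {d : Fin (n + 1) → ℕ} (hd : HasExp (Finset.insertNone (D.inside s W)) D.full D.fm d) :
    ∃ d', HasExp (Finset.insertNone (D.inside s W)) (D.pull q W).full (D.pull q W).fm d' := by
  have h1 : HasExp (Finset.insertNone (D.inside s W))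
      (fun x => consMap J ((D.pull q W).full x)) (D.pull q W).fm d := by
    refine hd.congr ?_ fun x hx => Or.inr ⟨x, hx, ?_, 1, one_ne_zero, ?_⟩
    · rw [sum_fm, sum_fm]
      rfl
    · cases x <;> rfl
    · rw [one_smul, consMap_full hq hx]
  obtain ⟨σ, -, -, h2⟩ := HasExp.of_injective (h.pull hq).wf.np_full (consMap_injective hJ) h1
  exact ⟨_, h2⟩

lemma Heavy.hasExp_of_pull (h : D.Heavy s) (hJ : Function.Injective J)
    (hq : ∀ x ∈ W, J (q x) = x) {d : Fin (r + 1) → ℕ}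
    (hd : HasExp (Finset.insertNone (D.inside s W)) (D.pull q W).full (D.pull q W).fm d) :
    ∃ d', HasExp (Finset.insertNone (D.inside s W)) D.full D.fm d' := by
  obtain ⟨d', h1⟩ := HasExp.map_injective (h.pull hq).wf.np_full hd (consMap_injective hJ)
  refine ⟨d', h1.congr ?_ fun x hx => Or.inr ⟨x, hx, ?_, 1, one_ne_zero, ?_⟩⟩
  · rw [sum_fm, sum_fm]
    rfl
  · cases x <;> rfl
  · rw [one_smul, consMap_full hq hx]

/-- Freeness of the whole family restricts to members over a subspace. -/
lemma Heavy.good_pull_of_hasExp (h : D.Heavy s) (hJ : Function.Injective J)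
    (hq : ∀ x ∈ W, J (q x) = x) {d : Fin (n + 1) → ℕ}
    (hd : HasExp (Finset.insertNone s) D.full D.fm d) : (D.pull q W).Good (D.inside s W) := by
  obtain ⟨d', hd'⟩ := hd.filter_subspace h.wf.np_full
    (W.comap (LinearMap.funLeft K K (Fin.succ : Fin n → Fin (n + 1))))
  have hset : (Finset.insertNone s).filter (fun x => D.full x ∈
      W.comap (LinearMap.funLeft K K (Fin.succ : Fin n → Fin (n + 1)))) =
      Finset.insertNone (D.inside s W) := by
    ext x
    rw [Finset.mem_filter]
    cases x with
    | none =>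
      have : LinearMap.funLeft K K Fin.succ (D.full none) = 0 := rfl
      simp [this]
    | some x => rw [Finset.some_mem_insertNone, Finset.some_mem_insertNone, mem_inside]; rfl
  rw [hset] at hd'
  obtain ⟨d'', hd''⟩ := h.hasExp_pull hJ hq hd'
  exact ((h.pull hq).wf.good_of_hasExp hd'').2

/-- Liftability in the coordinates of a subspace implies liftability. -/
lemma Heavy.good_of_good_pull (h : D.Heavy s) (hJ : Function.Injective J)
    (hq : ∀ x ∈ W, J (q x) = x) {e : Fin r → ℕ}
    (he : HasExp (D.pull q W).t (D.pull q W).β ((D.pull q W).mu (D.inside s W)) e)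
    (hG : (D.pull q W).Good (D.inside s W)) : D.Good (D.inside s W) := by
  obtain ⟨d, hd⟩ := h.hasExp_of_pull hJ hq ((h.pull hq).wf.hasExp_of_good hG he)
  exact ((h.wf.mono (inside_subset D s W)).good_of_hasExp hd).2

end PD

section flats

lemma mem_locHyps {A : Arrangement K ℓ} {U : Submodule K (Fin ℓ → K)} {c : Fin ℓ → K} :
    c ∈ locHyps A U ↔ c ∈ A.hyps ∧ c ∈ U := by
  rw [locHyps, Finset.mem_filter]

lemma finrank_span_pair_of_ne_smul {c c' : Fin ℓ → K} (hc : c ≠ 0) (h : ∀ u : K, c' ≠ u • c) :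
    Module.finrank K (Submodule.span K ({c, c'} : Set (Fin ℓ → K))) = 2 := by
  have hli : LinearIndependent K ![c, c'] :=
    (LinearIndependent.pair_iff' hc).mpr fun a ha => h a ha.symm
  have := finrank_span_eq_card hli
  rwa [Matrix.range_cons_cons_empty, Fintype.card_fin] at this

lemma eq_span_pair {c c' : Fin ℓ → K} (hc : c ≠ 0) (h : ∀ u : K, c' ≠ u • c)
    {U : Submodule K (Fin ℓ → K)} (hU : Module.finrank K U = 2) (hcU : c ∈ U) (hcU' : c' ∈ U) :
    Submodule.span K ({c, c'} : Set (Fin ℓ → K)) = U := by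
  refine Submodule.eq_of_le_of_finrank_eq (Submodule.span_le.mpr ?_)
    ((finrank_span_pair_of_ne_smul hc h).trans hU.symm)
  rintro x (rfl | rfl)
  · exact hcU
  · exact hcU'

lemma isFlatOfRank_span_pair (A : Arrangement K ℓ) {c c' : Fin ℓ → K} (hc : c ∈ A.hyps)
    (hc' : c' ∈ A.hyps) (hne : c ≠ c') :
    IsFlatOfRank A (Submodule.span K ({c, c'} : Set (Fin ℓ → K))) 2 := by
  refine ⟨finrank_span_pair_of_ne_smul (A.ne_zero c hc) (A.nonparallel c hc c' hc' hne),
    le_antisymm (Submodule.span_le.mpr fun x hx => ?_) (Submodule.span_mono fun x hx => ?_)⟩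
  · exact (mem_locHyps.mp hx).2
  · refine mem_locHyps.mpr ⟨?_, Submodule.subset_span hx⟩
    rcases hx with rfl | rfl
    · exact hc
    · exact hc'

lemma IsFlatOfRank.eq_span_pair {A : Arrangement K ℓ} {U : Submodule K (Fin ℓ → K)}
    (hU : IsFlatOfRank A U 2) {c c' : Fin ℓ → K} (hc : c ∈ locHyps A U) (hc' : c' ∈ locHyps A U)
    (hne : c ≠ c') : Submodule.span K ({c, c'} : Set (Fin ℓ → K)) = U :=
  ArrPaper.eq_span_pair (A.ne_zero c (mem_locHyps.mp hc).1)
    (A.nonparallel c (mem_locHyps.mp hc).1 c' (mem_locHyps.mp hc').1 hne) hU.1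
    (mem_locHyps.mp hc).2 (mem_locHyps.mp hc').2

lemma IsFlatOfRank.exists_ne {A : Arrangement K ℓ} {U : Submodule K (Fin ℓ → K)}
    (hU : IsFlatOfRank A U 2) (c : Fin ℓ → K) : ∃ c' ∈ locHyps A U, c ≠ c' := by
  by_contra! h
  have h1 : Submodule.span K (locHyps A U : Set (Fin ℓ → K)) ≤ Submodule.span K {c} :=
    Submodule.span_mono fun x hx => (h x hx).symm
  rw [hU.2] at h1
  have h2 := Submodule.finrank_mono h1
  have h3 := finrank_span_le_card (R := K) ({c} : Set (Fin ℓ → K))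
  rw [hU.1] at h2
  simp at h3
  omega

/-- The rank two flats of an arrangement. -/
noncomputable def flats2 (A : Arrangement K ℓ) : Finset (Submodule K (Fin ℓ → K)) :=
  ((A.hyps ×ˢ A.hyps).filter fun x => x.1 ≠ x.2).image
    fun x => Submodule.span K ({x.1, x.2} : Set (Fin ℓ → K))

lemma mem_flats2 {A : Arrangement K ℓ} {U : Submodule K (Fin ℓ → K)} :
    U ∈ flats2 A ↔ IsFlatOfRank A U 2 := by
  rw [flats2, Finset.mem_image]
  constructor
  · rintro ⟨x, hx, rfl⟩
    obtain ⟨h1, h2⟩ := Finset.mem_filter.mp hx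
    exact isFlatOfRank_span_pair A (Finset.mem_product.mp h1).1 (Finset.mem_product.mp h1).2 h2
  · intro hU
    obtain ⟨c, hc, -⟩ := hU.exists_ne 0
    obtain ⟨c', hc', hne⟩ := hU.exists_ne c
    exact ⟨(c, c'), Finset.mem_filter.mpr ⟨Finset.mem_product.mpr
      ⟨(mem_locHyps.mp hc).1, (mem_locHyps.mp hc').1⟩, hne⟩, hU.eq_span_pair hc hc' hne⟩

lemma IsB2.exists_sum {A : Arrangement K ℓ} {m : (Fin ℓ → K) → ℕ} {b : ℕ} (h : IsB2 A m b) :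
    ∃ d : Submodule K (Fin ℓ → K) → Fin ℓ → ℕ,
      (∀ U ∈ flats2 A, HasExp (locHyps A U) id m (d U)) ∧ b = ∑ U ∈ flats2 A, prodNZ (d U) := by
  obtain ⟨bloc, h1, h2⟩ := h
  have h3 : ∀ U, ∃ d : Fin ℓ → ℕ, U ∈ flats2 A →
      HasExp (locHyps A U) id m d ∧ bloc U = prodNZ d := by
    intro U
    by_cases hU : U ∈ flats2 A
    · obtain ⟨d, hd, hb⟩ := h1 U (mem_flats2.mp hU)
      exact ⟨d, fun _ => ⟨(isFreeWithExp_iff _ _ _).mp hd, hb⟩⟩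
    · exact ⟨0, fun h => (hU h).elim⟩
  choose d hd using h3
  refine ⟨d, fun U hU => (hd U hU).1, ?_⟩
  have h4 : {U : Submodule K (Fin ℓ → K) | IsFlatOfRank A U 2} = ↑(flats2 A) :=
    Set.ext fun U => mem_flats2.symm
  rw [h2, h4, finsum_mem_coe_finset]
  exact Finset.sum_congr rfl fun U hU => (hd U hU).2

end flats

section adapted
variable {n : ℕ}

/-- The weighted family attached to an Euler–Ziegler restriction. -/
def ezPD (m : (Fin (n + 1) → K) → ℕ) (c₀ : Fin (n + 1) → K) (B : Arrangement K n)
    (cl : (Fin (n + 1) → K) → Fin n → K) (av : (Fin (n + 1) → K) → K) :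
    PD K n (Fin (n + 1) → K) (Fin n → K) where
  cl := cl
  av := av
  m := m
  m0 := m c₀
  β := id
  t := B.hyps

/-- Coordinates on the dual space, classes and slopes adapted to an Euler–Ziegler restriction. -/
structure Adapted (A : Arrangement K (n + 1)) (m : (Fin (n + 1) → K) → ℕ) (c₀ : Fin (n + 1) → K)
    (B : Arrangement K n) (mB : (Fin n → K) → ℕ)
    (L : (Fin (n + 1) → K) ≃ₗ[K] (Fin (n + 1) → K)) (cl : (Fin (n + 1) → K) → Fin n → K)
    (av : (Fin (n + 1) → K) → K) : Prop where
  mem : c₀ ∈ A.hyps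
  pos : ∀ c ∈ A.hyps, 0 < m c
  map_c₀ : L c₀ = Fin.cons 1 0
  map : ∀ c ∈ A.hyps.erase c₀, ∃ u : K, u ≠ 0 ∧ L c = u • (Fin.cons (av c) (cl c) : Fin (n + 1) → K)
  cl_mem : ∀ c ∈ A.hyps.erase c₀, cl c ∈ B.hyps
  cl_surj : ∀ b ∈ B.hyps, ∃ c ∈ A.hyps.erase c₀, cl c = b
  mult : ∀ c ∈ A.hyps.erase c₀, mB (cl c) = EZmult A m c₀ c

lemma toFunc_apply (c v : Fin ℓ → K) : toFunc c v = ∑ i, c i * v i := by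
  simp [toFunc]

lemma exists_toFunc_eq_one {c : Fin ℓ → K} (hc : c ≠ 0) : ∃ w, toFunc c w = 1 := by
  obtain ⟨i, hi⟩ := Function.ne_iff.mp hc
  refine ⟨Pi.single i (c i)⁻¹, ?_⟩
  rw [toFunc_apply, Finset.sum_eq_single i]
  · rw [Pi.single_eq_same]; exact mul_inv_cancel₀ hi
  · intro j _ hj
    rw [Pi.single_eq_of_ne hj, mul_zero]
  · simp

lemma toFunc_add (c c' : Fin ℓ → K) : toFunc (c + c') = toFunc c + toFunc c' := by
  rw [toFunc, toFunc, toFunc, ← Finset.sum_add_distrib]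
  exact Finset.sum_congr rfl fun i _ => add_smul _ _ _

lemma toFunc_smul (u : K) (c : Fin ℓ → K) : toFunc (u • c) = u • toFunc c := by
  rw [toFunc, toFunc, Finset.smul_sum]
  exact Finset.sum_congr rfl fun i _ => mul_smul _ _ _

/-- The change of coordinates adapted to a hyperplane. -/
noncomputable def ezMap (c₀ : Fin (n + 1) → K)
    (e : ↥(LinearMap.ker (toFunc c₀)) ≃ₗ[K] (Fin n → K)) (w : Fin (n + 1) → K) :
    (Fin (n + 1) → K) →ₗ[K] (Fin (n + 1) → K) where
  toFun c := Fin.cons (toFunc c w) (resCov c₀ e c)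
  map_add' c c' := by
    funext j
    refine Fin.cases ?_ (fun j => ?_) j <;> simp [resCov, toFunc_add]
  map_smul' u c := by
    funext j
    refine Fin.cases ?_ (fun j => ?_) j <;> simp [resCov, toFunc_smul]

lemma ezMap_injective {c₀ : Fin (n + 1) → K}
    (e : ↥(LinearMap.ker (toFunc c₀)) ≃ₗ[K] (Fin n → K)) {w : Fin (n + 1) → K}
    (hw : toFunc c₀ w = 1) : Function.Injective (ezMap c₀ e w) := by
  rw [← LinearMap.ker_eq_bot, LinearMap.ker_eq_bot']
  intro c hc
  have h0 : toFunc c w = 0 := by simpa [ezMap] using congrFun hc 0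
  have h1 : (toFunc c).comp ((LinearMap.ker (toFunc c₀)).subtype.comp e.symm.toLinearMap) = 0 := by
    refine LinearMap.pi_ext' fun j => LinearMap.ext_ring ?_
    simpa [ezMap, resCov] using congrFun hc j.succ
  have h2 : ∀ v, toFunc c v = 0 := by
    intro v
    have hv : v - toFunc c₀ v • w ∈ LinearMap.ker (toFunc c₀) := by
      rw [LinearMap.mem_ker, map_sub, map_smul, hw, smul_eq_mul, mul_one, sub_self]
    have h3 := DFunLike.congr_fun h1 (e ⟨_, hv⟩)
    have h4 : toFunc c (v - toFunc c₀ v • w) = 0 := by simpa using h3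
    rwa [map_sub, map_smul, h0, smul_zero, sub_zero] at h4
  funext i
  have := h2 (Pi.single i 1)
  rw [toFunc_apply, Finset.sum_eq_single i (fun j _ hj => by
    rw [Pi.single_eq_of_ne hj, mul_zero]) (by simp), Pi.single_eq_same, mul_one] at this
  exact this

lemma IsEZRes.exists_adapted {A : Arrangement K (n + 1)} {m : (Fin (n + 1) → K) → ℕ}
    {c₀ : Fin (n + 1) → K} {B : Arrangement K n} {mB : (Fin n → K) → ℕ}
    (h : IsEZRes A m c₀ B mB) (hm : ∀ c ∈ A.hyps, 0 < m c) :
    ∃ L cl av, Adapted A m c₀ B mB L cl av := by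
  obtain ⟨hc₀, e, h1, h2⟩ := h
  obtain ⟨w, hw⟩ := exists_toFunc_eq_one (A.ne_zero c₀ hc₀)
  let L := LinearEquiv.ofInjectiveEndo (ezMap c₀ e w) (ezMap_injective e hw)
  have hL : ∀ c, L c = Fin.cons (toFunc c w) (resCov c₀ e c) := fun c => rfl
  have h3 : ∀ c, ∃ b : Fin n → K, ∃ t : K, c ∈ A.hyps.erase c₀ →
      b ∈ B.hyps ∧ t ≠ 0 ∧ resCov c₀ e c = t • b ∧ mB b = EZmult A m c₀ c := by
    intro c
    by_cases hc : c ∈ A.hyps.erase c₀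
    · obtain ⟨b, hb, ⟨t, ht, htb⟩, hm⟩ := h1 c hc
      exact ⟨b, t, fun _ => ⟨hb, ht, htb, hm⟩⟩
    · exact ⟨0, 0, fun h => (hc h).elim⟩
  choose cl t ht using h3
  refine ⟨L, cl, fun c => toFunc c w / t c, hc₀, hm, ?_, fun c hc => ⟨t c, (ht c hc).2.1, ?_⟩,
    fun c hc => (ht c hc).1, fun b hb => ?_, fun c hc => (ht c hc).2.2.2⟩
  · rw [hL, hw]
    congr 1
    funext j
    exact (e.symm (Pi.single j 1)).2
  · rw [hL, (ht c hc).2.2.1]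
    funext j
    refine Fin.cases ?_ (fun j => ?_) j
    · simp [mul_div_cancel₀ _ (ht c hc).2.1]
    · simp
  · obtain ⟨c, hc, u, hu, hub⟩ := h2 b hb
    refine ⟨c, hc, ?_⟩
    by_contra hne
    refine B.nonparallel _ (ht c hc).1 b hb hne (u⁻¹ * t c) ?_
    rw [mul_smul, ← (ht c hc).2.2.1, hub, smul_smul, inv_mul_cancel₀ hu, one_smul]

end adapted

section adapted
variable {n : ℕ} {A : Arrangement K (n + 1)} {m : (Fin (n + 1) → K) → ℕ} {c₀ : Fin (n + 1) → K}
  {B : Arrangement K n} {mB : (Fin n → K) → ℕ} {L : (Fin (n + 1) → K) ≃ₗ[K] (Fin (n + 1) → K)}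
  {cl : (Fin (n + 1) → K) → Fin n → K} {av : (Fin (n + 1) → K) → K}

/-- Restriction of covectors to the distinguished hyperplane, in adapted coordinates. -/
noncomputable def ezTail (L : (Fin (n + 1) → K) ≃ₗ[K] (Fin (n + 1) → K)) :
    (Fin (n + 1) → K) →ₗ[K] (Fin n → K) :=
  (LinearMap.funLeft K K (Fin.succ : Fin n → Fin (n + 1))).comp L.toLinearMap

lemma ezTail_apply (c : Fin (n + 1) → K) : ezTail L c = Fin.tail (L c) := rfl

namespace Adapted

lemma tail_c₀ (h : Adapted A m c₀ B mB L cl av) : ezTail L c₀ = 0 := by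
  rw [ezTail_apply, h.map_c₀]
  rfl

lemma tail_map (h : Adapted A m c₀ B mB L cl av) {c : Fin (n + 1) → K}
    (hc : c ∈ A.hyps.erase c₀) : ∃ u : K, u ≠ 0 ∧ ezTail L c = u • cl c := by
  obtain ⟨u, hu, huc⟩ := h.map c hc
  refine ⟨u, hu, ?_⟩
  rw [ezTail_apply, huc]
  funext j
  simp [Fin.tail]

lemma mem_span_c₀_of_tail (h : Adapted A m c₀ B mB L cl av) {c : Fin (n + 1) → K}
    (hc : ezTail L c = 0) : c = (L c 0) • c₀ := by
  apply L.injective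
  rw [map_smul, h.map_c₀]
  funext j
  refine Fin.cases ?_ (fun j => ?_) j
  · simp
  · have : L c j.succ = 0 := congrFun hc j
    simp [this]

lemma mem_span_iff (h : Adapted A m c₀ B mB L cl av) {c c' : Fin (n + 1) → K}
    (hc : c ∈ A.hyps.erase c₀) (hc' : c' ∈ A.hyps.erase c₀) :
    c' ∈ Submodule.span K ({c₀, c} : Set (Fin (n + 1) → K)) ↔ cl c' = cl c := by
  obtain ⟨u, hu, huc⟩ := h.tail_map hc
  obtain ⟨u', hu', huc'⟩ := h.tail_map hc'
  rw [Submodule.mem_span_pair]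
  constructor
  · rintro ⟨x, y, hxy⟩
    by_contra hne
    refine B.nonparallel _ (h.cl_mem c hc) _ (h.cl_mem c' hc') (Ne.symm hne) (u'⁻¹ * (y * u)) ?_
    rw [← inv_smul_smul₀ hu' (cl c'), ← huc', ← hxy, map_add, map_smul, map_smul, h.tail_c₀,
      smul_zero, zero_add, huc, smul_smul, smul_smul, mul_assoc]
  · intro heq
    have h1 : ezTail L (c' - (u' * u⁻¹) • c) = 0 := by
      rw [map_sub, map_smul, huc, huc', heq, smul_smul, mul_assoc, inv_mul_cancel₀ hu, mul_one,
        sub_self]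
    exact ⟨_, u' * u⁻¹, by rw [← h.mem_span_c₀_of_tail h1, sub_add_cancel]⟩

lemma inj (h : Adapted A m c₀ B mB L cl av) {c c' : Fin (n + 1) → K}
    (hc : c ∈ A.hyps.erase c₀) (hc' : c' ∈ A.hyps.erase c₀) (hcl : cl c = cl c')
    (hav : av c = av c') : c = c' := by
  by_contra hne
  obtain ⟨u, hu, huc⟩ := h.map c hc
  obtain ⟨u', hu', huc'⟩ := h.map c' hc'
  refine A.nonparallel c (Finset.mem_of_mem_erase hc) c' (Finset.mem_of_mem_erase hc') hne
    (u' * u⁻¹) (L.injective ?_)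
  rw [map_smul, huc, huc', hcl, hav, smul_smul, mul_assoc, inv_mul_cancel₀ hu, mul_one]

lemma locHyps_span (h : Adapted A m c₀ B mB L cl av) {c : Fin (n + 1) → K}
    (hc : c ∈ A.hyps.erase c₀) :
    locHyps A (Submodule.span K ({c₀, c} : Set (Fin (n + 1) → K))) =
      insert c₀ ((ezPD m c₀ B cl av).cls (A.hyps.erase c₀) (cl c)) := by
  ext c'
  rw [mem_locHyps, Finset.mem_insert, PD.mem_cls]
  by_cases h0 : c' = c₀
  · rw [h0]
    exact ⟨fun _ => Or.inl rfl, fun _ => ⟨h.mem, Submodule.subset_span (by simp)⟩⟩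
  · have h1 : c' ∈ A.hyps ↔ c' ∈ A.hyps.erase c₀ := by simp [h0]
    rw [h1, or_iff_right h0]
    exact and_congr_right fun hc' => h.mem_span_iff hc hc'

lemma notMem_cls (b : Fin n → K) : c₀ ∉ (ezPD m c₀ B cl av).cls (A.hyps.erase c₀) b :=
  fun h => Finset.notMem_erase c₀ _ (PD.cls_subset _ _ _ h)

lemma mult_eq (h : Adapted A m c₀ B mB L cl av) {b : Fin n → K} (hb : b ∈ B.hyps) :
    mB b = (ezPD m c₀ B cl av).mu (A.hyps.erase c₀) b := by
  obtain ⟨c, hc, rfl⟩ := h.cl_surj b hb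
  have h1 := h.locHyps_span hc
  rw [locHyps] at h1
  rw [h.mult c hc, EZmult, h1, Finset.sum_insert (notMem_cls _), Nat.add_sub_cancel_left]
  rfl

lemma heavy (h : Adapted A m c₀ B mB L cl av) (hlh : IsLocallyHeavy A m c₀) :
    (ezPD m c₀ B cl av).Heavy (A.hyps.erase c₀) where
  cl_mem := h.cl_mem
  np := B.np
  inj _ hc _ hc' := h.inj hc hc'
  m0_pos := h.pos _ h.mem
  heavy k hk := by
    obtain ⟨c, hc, rfl⟩ := h.cl_surj k hk
    rw [or_iff_not_imp_left, not_le]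
    intro hcard
    have h1 := h.locHyps_span hc
    have h2 := hlh.2 _ (isFlatOfRank_span_pair A h.mem (Finset.mem_of_mem_erase hc)
      (Finset.ne_of_mem_erase hc).symm) (Submodule.subset_span (by simp)) (by
        rw [h1, Finset.card_insert_of_notMem (notMem_cls _)]
        exact Nat.succ_le_succ hcard)
    rwa [h1, Finset.erase_insert (notMem_cls _)] at h2

lemma hasExp_full_iff (h : Adapted A m c₀ B mB L cl av) {s : Finset (Fin (n + 1) → K)}
    (hs : s ⊆ A.hyps.erase c₀) {d : Fin (n + 1) → ℕ} :
    HasExp (insert c₀ s) id m d ↔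
      HasExp (Finset.insertNone s) (ezPD m c₀ B cl av).full (ezPD m c₀ B cl av).fm d := by
  have hc₀ : c₀ ∉ s := fun h => by simpa using hs h
  constructor
  · intro hd
    refine (hd.linearEquiv L).congr ?_ fun x hx => Or.inr ?_
    · rw [Finset.sum_insert hc₀, PD.sum_fm]
      rfl
    · cases x with
      | none =>
        refine ⟨c₀, Finset.mem_insert_self _ _, rfl, 1, one_ne_zero, ?_⟩
        rw [one_smul, id, h.map_c₀]
        rfl
      | some c =>
        have hc := Finset.some_mem_insertNone.mp hx
        obtain ⟨u, hu, huc⟩ := h.map c (hs hc)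
        refine ⟨c, Finset.mem_insert_of_mem hc, rfl, u⁻¹, inv_ne_zero hu, ?_⟩
        rw [id, huc, inv_smul_smul₀ hu]
        rfl
  · intro hd
    refine (hd.linearEquiv L.symm).congr ?_ fun c hc => Or.inr ?_
    · rw [Finset.sum_insert hc₀, PD.sum_fm]
      rfl
    · rcases Finset.mem_insert.mp hc with rfl | hc
      · refine ⟨none, by simp, rfl, 1, one_ne_zero, ?_⟩
        rw [one_smul, id, PD.full, ← h.map_c₀, L.symm_apply_apply]
      · obtain ⟨u, hu, huc⟩ := h.map c (hs hc)
        refine ⟨some c, Finset.some_mem_insertNone.mpr hc, rfl, u, hu, ?_⟩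
        rw [id, ← map_smul, L.eq_symm_apply, huc]
        rfl

lemma hasExp_cov (h : Adapted A m c₀ B mB L cl av) {s : Finset (Fin (n + 1) → K)}
    (hs : s ⊆ A.hyps.erase c₀) {d : Fin (n + 1) → ℕ} (hd : HasExp s id m d) :
    HasExp s (ezPD m c₀ B cl av).cov m d := by
  refine (hd.linearEquiv L).congr rfl fun c hc => Or.inr ?_
  obtain ⟨u, hu, huc⟩ := h.map c (hs hc)
  refine ⟨c, hc, rfl, u⁻¹, inv_ne_zero hu, ?_⟩
  rw [id, huc, inv_smul_smul₀ hu]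
  rfl

lemma isFree_iff (h : Adapted A m c₀ B mB L cl av) : IsFree A m ↔
    ∃ d, HasExp (Finset.insertNone (A.hyps.erase c₀)) (ezPD m c₀ B cl av).full
      (ezPD m c₀ B cl av).fm d := by
  refine exists_congr fun d => ?_
  rw [isFreeWithExp_iff, ← h.hasExp_full_iff (Finset.Subset.refl _), Finset.insert_erase h.mem]

lemma isFree_restriction_iff (h : Adapted A m c₀ B mB L cl av) : IsFree B mB ↔
    ∃ e, HasExp B.hyps id ((ezPD m c₀ B cl av).mu (A.hyps.erase c₀)) e := by
  refine exists_congr fun d => ?_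
  rw [isFreeWithExp_iff]
  constructor
  · exact fun hd => hd.congr (Finset.sum_congr rfl fun b hb => (h.mult_eq hb).symm)
      fun b hb => Or.inr ⟨b, hb, h.mult_eq hb, 1, one_ne_zero, (one_smul _ _).symm⟩
  · exact fun hd => hd.congr (Finset.sum_congr rfl fun b hb => h.mult_eq hb)
      fun b hb => Or.inr ⟨b, hb, (h.mult_eq hb).symm, 1, one_ne_zero, (one_smul _ _).symm⟩

lemma mult_pos (h : Adapted A m c₀ B mB L cl av) {b : Fin n → K} (hb : b ∈ B.hyps) :
    mB b ≠ 0 := by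
  rw [h.mult_eq hb]
  obtain ⟨c, hc, rfl⟩ := h.cl_surj b hb
  have h1 : m c ≤ (ezPD m c₀ B cl av).mu (A.hyps.erase c₀) (cl c) :=
    Finset.single_le_sum (f := m) (fun _ _ => Nat.zero_le _)
      (PD.mem_cls.mpr ⟨hc, rfl⟩)
  have := h.pos c (Finset.mem_of_mem_erase hc)
  omega

/-- The local second Betti number at a flat in the distinguished hyperplane. -/
lemma prodNZ_of_mem (h : Adapted A m c₀ B mB L cl av) (hlh : IsLocallyHeavy A m c₀)
    {c : Fin (n + 1) → K} (hc : c ∈ A.hyps.erase c₀) {d : Fin (n + 1) → ℕ}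
    (hd : HasExp (locHyps A (Submodule.span K ({c₀, c} : Set (Fin (n + 1) → K)))) id m d) :
    prodNZ d = m c₀ * (ezPD m c₀ B cl av).mu (A.hyps.erase c₀) (cl c) := by
  rw [h.locHyps_span hc, h.hasExp_full_iff (PD.cls_subset _ _ _)] at hd
  obtain ⟨⟨i, hi, he⟩, -⟩ :=
    ((h.heavy hlh).wf.mono (PD.cls_subset _ _ _)).good_of_hasExp hd
  have hi' : d i = m c₀ := hi
  have hpos := h.mult_pos (h.cl_mem c hc)
  rw [h.mult_eq (h.cl_mem c hc)] at hpos
  rw [prodNZ_succAbove d i (by rw [hi']; exact (h.pos c₀ h.mem).ne'), hi',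
    he.prodNZ_eq_of_forall (k := cl c) (h.cl_mem c hc) (B.ne_zero _ (h.cl_mem c hc))
      (fun b _ hb => by rw [PD.mu_cls, if_neg hb]) (by rw [PD.mu_cls, if_pos rfl]; exact hpos),
    PD.mu_cls, if_pos rfl]

/-- The contribution of the flats in the distinguished hyperplane. -/
lemma sum_prodNZ_of_mem (h : Adapted A m c₀ B mB L cl av) (hlh : IsLocallyHeavy A m c₀)
    {d : Submodule K (Fin (n + 1) → K) → Fin (n + 1) → ℕ}
    (hd : ∀ U ∈ flats2 A, HasExp (locHyps A U) id m (d U)) :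
    ∑ U ∈ flats2 A with c₀ ∈ U, prodNZ (d U) = m c₀ * (msum A m - m c₀) := by
  have hsum : msum A m - m c₀ = ∑ c ∈ A.hyps.erase c₀, m c := by
    rw [msum, ← Finset.add_sum_erase _ _ h.mem, Nat.add_sub_cancel_left]
  have hflat : ∀ c ∈ A.hyps.erase c₀,
      Submodule.span K ({c₀, c} : Set (Fin (n + 1) → K)) ∈ flats2 A := fun c hc =>
    mem_flats2.mpr (isFlatOfRank_span_pair A h.mem (Finset.mem_of_mem_erase hc)
      (Finset.ne_of_mem_erase hc).symm)
  rw [hsum, ← Finset.sum_fiberwise_of_maps_to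
    (g := fun c => Submodule.span K ({c₀, c} : Set (Fin (n + 1) → K)))
    (t := (flats2 A).filter fun U => c₀ ∈ U) fun c hc =>
      Finset.mem_filter.mpr ⟨hflat c hc, Submodule.subset_span (by simp)⟩, Finset.mul_sum]
  refine Finset.sum_congr rfl fun U hU => ?_
  obtain ⟨hU, hcU⟩ := Finset.mem_filter.mp hU
  have hU2 := mem_flats2.mp hU
  obtain ⟨c, hc, hne⟩ := hU2.exists_ne c₀
  have hcs : c ∈ A.hyps.erase c₀ := Finset.mem_erase.mpr ⟨hne.symm, (mem_locHyps.mp hc).1⟩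
  obtain rfl := hU2.eq_span_pair (mem_locHyps.mpr ⟨h.mem, hcU⟩) hc hne
  rw [h.prodNZ_of_mem hlh hcs (hd _ hU)]
  congr 1
  rw [PD.mu_eq_sum_cls]
  refine Finset.sum_congr (Finset.ext fun c' => ?_) fun _ _ => rfl
  rw [PD.mem_cls, Finset.mem_filter]
  refine and_congr_right fun hc' => (h.mem_span_iff hcs hc').symm.trans ?_
  constructor
  · intro hmem
    exact hU2.eq_span_pair (mem_locHyps.mpr ⟨h.mem, hcU⟩)
      (mem_locHyps.mpr ⟨Finset.mem_of_mem_erase hc', hmem⟩) (Finset.ne_of_mem_erase hc').symm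
  · intro heq
    rw [← heq]
    exact Submodule.subset_span (by simp)

end Adapted
end adapted

section linear

lemma exists_coordinates {n : ℕ} (W : Submodule K (Fin n → K)) {r : ℕ}
    (hW : Module.finrank K W = r) :
    ∃ (J : (Fin r → K) →ₗ[K] (Fin n → K)) (q : (Fin n → K) →ₗ[K] (Fin r → K)),
      Function.Injective J ∧ ∀ x ∈ W, J (q x) = x := by
  let b := Module.finBasisOfFinrankEq K W hW
  let J : (Fin r → K) →ₗ[K] (Fin n → K) := W.subtype.comp b.equivFun.symm.toLinearMap
  have hJ : Function.Injective J := W.injective_subtype.comp b.equivFun.symm.injective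
  obtain ⟨q, hq⟩ := J.exists_leftInverse_of_injective (LinearMap.ker_eq_bot.mpr hJ)
  refine ⟨J, q, hJ, fun x hx => ?_⟩
  have h1 : J (b.equivFun ⟨x, hx⟩) = x := by simp [J]
  rw [← h1, show q (J (b.equivFun ⟨x, hx⟩)) = b.equivFun ⟨x, hx⟩ from DFunLike.congr_fun hq _]

lemma exists_solution {c c' : Fin 2 → K} (hc : c ≠ 0) (h : ∀ u : K, c' ≠ u • c) (a a' : K) :
    ∃ p : Fin 2 → K, ∑ i, c i * p i = a ∧ ∑ i, c' i * p i = a' := by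
  have hdet := det_ne_zero_of_ne_smul hc h
  refine ⟨fun i => ![a * c' 1 - a' * c 1, c 0 * a' - c' 0 * a] i / (c 0 * c' 1 - c 1 * c' 0),
    ?_, ?_⟩ <;> rw [Fin.sum_univ_two] <;> simp only [Matrix.cons_val_zero, Matrix.cons_val_one] <;>
    rw [← mul_div_assoc, ← mul_div_assoc, ← add_div, div_eq_iff hdet] <;> ring

end linear

namespace PD
variable {r n : ℕ} {ι κ : Type*} {D : PD K n ι κ} {s : Finset ι} {W : Submodule K (Fin n → K)}
  {q : (Fin n → K) →ₗ[K] (Fin r → K)} {J : (Fin r → K) →ₗ[K] (Fin n → K)}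

/-- The graph over a subspace of the functional given by a point. -/
noncomputable def graphMap (J : (Fin r → K) →ₗ[K] (Fin n → K)) (p : Fin r → K) :
    (Fin r → K) →ₗ[K] (Fin (n + 1) → K) where
  toFun c := Fin.cons (-∑ i, c i * p i) (J c)
  map_add' c c' := by
    funext j
    refine Fin.cases ?_ (fun j => ?_) j
    · simp [add_mul, Finset.sum_add_distrib, add_comm]
    · simp
  map_smul' u c := by
    funext j
    refine Fin.cases ?_ (fun j => ?_) j
    · simp [Finset.mul_sum, mul_assoc]
    · simp

lemma graphMap_injective (hJ : Function.Injective J) (p : Fin r → K) :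
    Function.Injective (graphMap J p) := by
  rw [← LinearMap.ker_eq_bot, LinearMap.ker_eq_bot']
  intro c hc
  have h1 : J c = 0 := funext fun j => congrFun hc j.succ
  exact hJ (h1.trans (map_zero J).symm)

lemma eval_af_pull (p : Fin r → K) (h : ι) :
    eval p ((D.pull q W).af h) = ∑ i, q (D.β (D.cl h)) i * p i + D.av h :=
  eval_aff _ _ _

/-- Exponents of the members through a point, in coordinates of the plane. -/
lemma Heavy.hasExp_at' {W : Submodule K (Fin n → K)} {q : (Fin n → K) →ₗ[K] (Fin 2 → K)}
    {J : (Fin 2 → K) →ₗ[K] (Fin n → K)} (h : D.Heavy s) (hm : ∀ x ∈ s, D.m x ≠ 0)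
    (hJ : Function.Injective J) (hq : ∀ x ∈ W, J (q x) = x) {p : Fin 2 → K}
    {d : Fin (n + 1) → ℕ}
    (hd : HasExp ((D.pull q W).at' (D.inside s W) p) D.cov D.m d)
    {x y : ι} (hx : x ∈ (D.pull q W).at' (D.inside s W) p)
    (hy : y ∈ (D.pull q W).at' (D.inside s W) p) (hxy : x ≠ y) :
    ∃ d' : Fin 2 → ℕ, HasExp (D.pull q W).t (D.pull q W).β
      ((D.pull q W).mu ((D.pull q W).at' (D.inside s W) p)) d' ∧ prodNZ d = d' 0 * d' 1 := by
  have hwf := (h.pull hq).wf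
  have hsub := at'_subset (D.pull q W) (D.inside s W) p
  have hcl : ∀ x ∈ (D.pull q W).at' (D.inside s W) p, ∀ y ∈ (D.pull q W).at' (D.inside s W) p,
      D.cl x = D.cl y → x = y := by
    intro x hx y hy hxy
    have h1 := (mem_at'.mp hx).2
    have h2 := (mem_at'.mp hy).2
    rw [eval_af_pull] at h1 h2
    refine hwf.inj x (hsub hx) y (hsub hy) hxy (?_ : D.av x = D.av y)
    rw [hxy] at h1
    linear_combination h1 - h2
  have hnp : NP ((D.pull q W).at' (D.inside s W) p) fun x => q (D.β (D.cl x)) :=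
    ⟨fun x hx => hwf.np.1 _ (hwf.cl_mem x (hsub hx)), fun x hx y hy hxy =>
      hwf.np.2 _ (hwf.cl_mem x (hsub hx)) _ (hwf.cl_mem y (hsub hy))
        fun hc => hxy (hcl x hx y hy hc)⟩
  have hg : ∀ x ∈ (D.pull q W).at' (D.inside s W) p,
      graphMap J p (q (D.β (D.cl x))) = D.cov x := by
    intro x hx
    have h1 := (mem_at'.mp hx).2
    rw [eval_af_pull] at h1
    have h2 : D.av x = -∑ i, q (D.β (D.cl x)) i * p i := by linear_combination h1
    rw [cov, h2]
    exact congrArg (fun v => (Fin.cons (-∑ i, q (D.β (D.cl x)) i * p i) v : Fin (n + 1) → K))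
      (hq _ (mem_inside.mp (hsub hx)).2)
  have hd2 : HasExp ((D.pull q W).at' (D.inside s W) p)
      (fun x => graphMap J p (q (D.β (D.cl x)))) D.m d :=
    hd.congr rfl fun x hx => Or.inr ⟨x, hx, rfl, 1, one_ne_zero, by rw [one_smul, hg x hx]⟩
  obtain ⟨σ, hσ, hσ0, hd3⟩ := HasExp.of_injective hnp (graphMap_injective hJ p) hd2
  refine ⟨d ∘ σ, hd3.congr ?_ fun k _ => ?_, ?_⟩
  · exact (hwf.mono hsub).sum_mu
  · by_cases hk : ∃ x ∈ (D.pull q W).at' (D.inside s W) p, D.cl x = k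
    · obtain ⟨x, hx, rfl⟩ := hk
      refine Or.inr ⟨x, hx, ?_, 1, one_ne_zero, (one_smul _ _).symm⟩
      rw [mu_eq_sum_cls]
      have : (D.pull q W).cls ((D.pull q W).at' (D.inside s W) p) (D.cl x) = {x} := by
        ext y
        rw [mem_cls, Finset.mem_singleton]
        exact ⟨fun hy => hcl y hy.1 x hx hy.2, fun hy => by rw [hy]; exact ⟨hx, rfl⟩⟩
      rw [this, Finset.sum_singleton]
      rfl
    · refine Or.inl (Finset.sum_eq_zero fun x hx => (hk ⟨x, ?_⟩).elim)
      exact mem_cls.mp hx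
  · rw [prodNZ_comp hσ hσ0]
    exact hd3.prodNZ_eq_mul hnp (fun x hx => hm x (inside_subset D s W (hsub hx))) hx hy hxy

end PD

namespace Adapted
variable {n : ℕ} {A : Arrangement K (n + 1)} {m : (Fin (n + 1) → K) → ℕ} {c₀ : Fin (n + 1) → K}
  {B : Arrangement K n} {mB : (Fin n → K) → ℕ} {L : (Fin (n + 1) → K) ≃ₗ[K] (Fin (n + 1) → K)}
  {cl : (Fin (n + 1) → K) → Fin n → K} {av : (Fin (n + 1) → K) → K}

lemma c₀_notMem_span_pair (h : Adapted A m c₀ B mB L cl av) {c c' : Fin (n + 1) → K}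
    (hc : c ∈ A.hyps.erase c₀) (hc' : c' ∈ A.hyps.erase c₀) (hne : cl c ≠ cl c') :
    c₀ ∉ Submodule.span K ({c, c'} : Set (Fin (n + 1) → K)) := by
  intro hmem
  have hA := Finset.mem_of_mem_erase hc
  have hU := isFlatOfRank_span_pair A hA (Finset.mem_of_mem_erase hc') fun h => hne (by rw [h])
  have h1 := hU.eq_span_pair (mem_locHyps.mpr ⟨h.mem, hmem⟩)
    (mem_locHyps.mpr ⟨hA, Submodule.subset_span (by simp)⟩) (Finset.ne_of_mem_erase hc).symm
  refine hne ((h.mem_span_iff hc hc').mp ?_).symm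
  rw [h1]
  exact Submodule.subset_span (by simp)

lemma cl_ne_of_c₀_notMem (h : Adapted A m c₀ B mB L cl av) {U : Submodule K (Fin (n + 1) → K)}
    (hU : c₀ ∉ U) {c c' : Fin (n + 1) → K} (hc : c ∈ A.hyps.erase c₀)
    (hc' : c' ∈ A.hyps.erase c₀) (hcU : c ∈ U) (hcU' : c' ∈ U) (hne : c ≠ c') : cl c ≠ cl c' := by
  intro heq
  obtain ⟨x, y, hxy⟩ := Submodule.mem_span_pair.mp ((h.mem_span_iff hc hc').mpr heq.symm)
  have hx : x ≠ 0 := by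
    rintro rfl
    rw [zero_smul, zero_add] at hxy
    exact A.nonparallel c (Finset.mem_of_mem_erase hc) c' (Finset.mem_of_mem_erase hc') hne y
      hxy.symm
  refine hU ((Submodule.smul_mem_iff U hx).mp ?_)
  rw [eq_sub_of_add_eq hxy]
  exact U.sub_mem hcU' (U.smul_mem y hcU)

lemma tail_ne_zero (h : Adapted A m c₀ B mB L cl av) {c : Fin (n + 1) → K}
    (hc : c ∈ A.hyps.erase c₀) : ezTail L c ≠ 0 := by
  obtain ⟨u, hu, huc⟩ := h.tail_map hc
  rw [huc]
  exact smul_ne_zero hu (B.ne_zero _ (h.cl_mem c hc))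

lemma tail_ne_smul (h : Adapted A m c₀ B mB L cl av) {c c' : Fin (n + 1) → K}
    (hc : c ∈ A.hyps.erase c₀) (hc' : c' ∈ A.hyps.erase c₀) (hne : cl c ≠ cl c') (x : K) :
    ezTail L c' ≠ x • ezTail L c := by
  obtain ⟨u, hu, huc⟩ := h.tail_map hc
  obtain ⟨u', hu', huc'⟩ := h.tail_map hc'
  intro hx
  refine B.nonparallel _ (h.cl_mem c hc) _ (h.cl_mem c' hc') hne (u'⁻¹ * (x * u)) ?_
  rw [← inv_smul_smul₀ hu' (cl c'), ← huc', hx, huc, smul_smul, smul_smul, mul_assoc]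

lemma tail_mem_iff (h : Adapted A m c₀ B mB L cl av) {c : Fin (n + 1) → K}
    (hc : c ∈ A.hyps.erase c₀) (W : Submodule K (Fin n → K)) : ezTail L c ∈ W ↔ cl c ∈ W := by
  obtain ⟨u, hu, huc⟩ := h.tail_map hc
  rw [huc]
  exact Submodule.smul_mem_iff W hu

lemma map_span_pair (h : Adapted A m c₀ B mB L cl av) {c c' : Fin (n + 1) → K}
    (hc : c ∈ A.hyps.erase c₀) (hc' : c' ∈ A.hyps.erase c₀) (hne : cl c ≠ cl c') :
    (Submodule.span K ({c, c'} : Set (Fin (n + 1) → K))).map (ezTail L) =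
      Submodule.span K ({cl c, cl c'} : Set (Fin n → K)) := by
  have hB := isFlatOfRank_span_pair B (h.cl_mem c hc) (h.cl_mem c' hc') hne
  rw [Submodule.map_span, Set.image_pair]
  refine eq_span_pair (h.tail_ne_zero hc) (h.tail_ne_smul hc hc' hne) hB.1 ?_ ?_
  · exact (h.tail_mem_iff hc _).mpr (Submodule.subset_span (by simp))
  · exact (h.tail_mem_iff hc' _).mpr (Submodule.subset_span (by simp))

lemma exists_pair (h : Adapted A m c₀ B mB L cl av) {U : Submodule K (Fin (n + 1) → K)}
    (hU : U ∈ flats2 A) (hcU : c₀ ∉ U) : ∃ c ∈ A.hyps.erase c₀, ∃ c' ∈ A.hyps.erase c₀,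
      c ∈ U ∧ c' ∈ U ∧ cl c ≠ cl c' ∧ U = Submodule.span K {c, c'} := by
  have hU2 := mem_flats2.mp hU
  obtain ⟨c, hc, -⟩ := hU2.exists_ne 0
  obtain ⟨c', hc', hne⟩ := hU2.exists_ne c
  have hs : ∀ x ∈ locHyps A U, x ∈ A.hyps.erase c₀ := fun x hx =>
    Finset.mem_erase.mpr ⟨fun h0 => hcU (h0 ▸ (mem_locHyps.mp hx).2), (mem_locHyps.mp hx).1⟩
  exact ⟨c, hs c hc, c', hs c' hc', (mem_locHyps.mp hc).2, (mem_locHyps.mp hc').2,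
    h.cl_ne_of_c₀_notMem hcU (hs c hc) (hs c' hc') (mem_locHyps.mp hc).2 (mem_locHyps.mp hc').2
      hne, (hU2.eq_span_pair hc hc' hne).symm⟩

lemma map_tail_mem (h : Adapted A m c₀ B mB L cl av) {U : Submodule K (Fin (n + 1) → K)}
    (hU : U ∈ flats2 A) (hcU : c₀ ∉ U) : U.map (ezTail L) ∈ flats2 B := by
  obtain ⟨c, hc, c', hc', -, -, hne, rfl⟩ := h.exists_pair hU hcU
  rw [h.map_span_pair hc hc' hne]
  exact mem_flats2.mpr (isFlatOfRank_span_pair B (h.cl_mem c hc) (h.cl_mem c' hc') hne)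

/-- A flat transversal to the distinguished hyperplane corresponds to a point. -/
lemma exists_point (h : Adapted A m c₀ B mB L cl av) {U : Submodule K (Fin (n + 1) → K)}
    (hU : U ∈ flats2 A) (hcU : c₀ ∉ U) {q : (Fin n → K) →ₗ[K] (Fin 2 → K)}
    {J : (Fin 2 → K) →ₗ[K] (Fin n → K)} (hq : ∀ x ∈ U.map (ezTail L), J (q x) = x) :
    ∃ p : Fin 2 → K, locHyps A U =
      ((ezPD m c₀ B cl av).pull q (U.map (ezTail L))).at'
        ((ezPD m c₀ B cl av).inside (A.hyps.erase c₀) (U.map (ezTail L))) p := by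
  obtain ⟨c, hc, c', hc', hcm, hcm', hne, hspan⟩ := h.exists_pair hU hcU
  have hT : ∀ x ∈ U, J (q (ezTail L x)) = ezTail L x := fun x hx =>
    hq _ (Submodule.mem_map_of_mem hx)
  obtain ⟨p, hp, hp'⟩ := exists_solution (c := q (ezTail L c)) (c' := q (ezTail L c'))
    (fun h0 => h.tail_ne_zero hc (by rw [← hT c hcm, h0, map_zero]))
    (fun u hu => h.tail_ne_smul hc hc' hne u (by
      rw [← hT c' hcm', hu, map_smul, hT c hcm])) (-L c 0) (-L c' 0)
  have hlin : ∀ x ∈ U, ∑ i, q (ezTail L x) i * p i = -L x 0 := by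
    intro x hx
    rw [hspan] at hx
    obtain ⟨a, b, rfl⟩ := Submodule.mem_span_pair.mp hx
    rw [Fin.sum_univ_two] at hp hp' ⊢
    simp only [map_add, map_smul, Pi.add_apply, Pi.smul_apply, smul_eq_mul]
    linear_combination a * hp + b * hp'
  have hiff : ∀ x, x ∈ U ↔ ezTail L x ∈ U.map (ezTail L) ∧
      ∑ i, q (ezTail L x) i * p i = -L x 0 := by
    refine fun x => ⟨fun hx => ⟨Submodule.mem_map_of_mem hx, hlin x hx⟩, fun ⟨h1, h2⟩ => ?_⟩
    obtain ⟨y, hy, hyx⟩ := h1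
    have h3 := hlin y hy
    rw [hyx, h2] at h3
    suffices x = y by rwa [this]
    apply L.injective
    funext j
    refine Fin.cases (neg_injective h3) (fun j => ?_) j
    exact (congrFun hyx j).symm
  refine ⟨p, Finset.ext fun x => ?_⟩
  rw [mem_locHyps, PD.mem_at', PD.mem_inside]
  by_cases hx : x ∈ A.hyps.erase c₀
  · have hxA := Finset.mem_of_mem_erase hx
    obtain ⟨u, hu, hux⟩ := h.map x hx
    have h0 : L x 0 = u * av x := by rw [hux]; simp
    have h1 : ezTail L x = u • cl x := by
      rw [ezTail_apply, hux]
      funext j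
      simp [Fin.tail]
    simp only [hxA, hx, true_and]
    rw [hiff x, h.tail_mem_iff hx, PD.eval_af_pull]
    refine and_congr_right fun _ => ?_
    rw [h1, h0, map_smul]
    simp only [Pi.smul_apply, smul_eq_mul, Fin.sum_univ_two]
    change _ ↔ q (cl x) 0 * p 0 + q (cl x) 1 * p 1 + av x = 0
    constructor
    · intro h2
      refine (mul_eq_zero.mp (?_ : u * (q (cl x) 0 * p 0 + q (cl x) 1 * p 1 + av x) = 0)).resolve_left
        hu
      linear_combination h2
    · intro h2
      linear_combination u * h2
  · refine iff_of_false (fun h1 => hx ?_) fun h1 => hx h1.1.1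
    exact Finset.mem_erase.mpr ⟨fun h0 => hcU (h0 ▸ h1.2), h1.1⟩

end Adapted

namespace Adapted
variable {n : ℕ} {A : Arrangement K (n + 1)} {m : (Fin (n + 1) → K) → ℕ} {c₀ : Fin (n + 1) → K}
  {B : Arrangement K n} {mB : (Fin n → K) → ℕ} {L : (Fin (n + 1) → K) ≃ₗ[K] (Fin (n + 1) → K)}
  {cl : (Fin (n + 1) → K) → Fin n → K} {av : (Fin (n + 1) → K) → K}

/-- The flats transversal to the distinguished hyperplane restricting to a given flat. -/
noncomputable def fiber (A : Arrangement K (n + 1)) (c₀ : Fin (n + 1) → K)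
    (L : (Fin (n + 1) → K) ≃ₗ[K] (Fin (n + 1) → K)) (W : Submodule K (Fin n → K)) :
    Finset (Submodule K (Fin (n + 1) → K)) :=
  ((flats2 A).filter fun U => c₀ ∉ U).filter fun U => U.map (ezTail L) = W

lemma mem_fiber {W : Submodule K (Fin n → K)} {U : Submodule K (Fin (n + 1) → K)} :
    U ∈ fiber A c₀ L W ↔ (U ∈ flats2 A ∧ c₀ ∉ U) ∧ U.map (ezTail L) = W := by
  rw [fiber, Finset.mem_filter, Finset.mem_filter]

/-- Exponents of a localization of the restriction, in coordinates of the plane. -/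
lemma exists_hasExp_pull (h : Adapted A m c₀ B mB L cl av) {W : Submodule K (Fin n → K)}
    (hW : W ∈ flats2 B) {q : (Fin n → K) →ₗ[K] (Fin 2 → K)} {J : (Fin 2 → K) →ₗ[K] (Fin n → K)}
    (hJ : Function.Injective J) (hq : ∀ x ∈ W, J (q x) = x) {d : Fin n → ℕ}
    (hd : HasExp (locHyps B W) id mB d) :
    ∃ e : Fin 2 → ℕ, HasExp ((ezPD m c₀ B cl av).pull q W).t ((ezPD m c₀ B cl av).pull q W).β
      (((ezPD m c₀ B cl av).pull q W).mu ((ezPD m c₀ B cl av).inside (A.hyps.erase c₀) W)) e ∧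
      prodNZ d = e 0 * e 1 := by
  have hmem : ∀ {b}, b ∈ ((ezPD m c₀ B cl av).pull q W).t ↔ b ∈ locHyps B W :=
    PD.mem_pull_t.trans mem_locHyps.symm
  have hnp : NP ((ezPD m c₀ B cl av).pull q W).t ((ezPD m c₀ B cl av).pull q W).β :=
    PD.np_pull (D := ezPD m c₀ B cl av) B.np hq
  have hmu : ∀ b ∈ ((ezPD m c₀ B cl av).pull q W).t, mB b = ((ezPD m c₀ B cl av).pull q W).mu
      ((ezPD m c₀ B cl av).inside (A.hyps.erase c₀) W) b := fun b hb => by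
    rw [PD.mu_pull, PD.mu_inside (PD.mem_pull_t.mp hb).2]
    exact h.mult_eq (PD.mem_pull_t.mp hb).1
  have hd2 : HasExp ((ezPD m c₀ B cl av).pull q W).t
      (fun b => J (((ezPD m c₀ B cl av).pull q W).β b))
      (((ezPD m c₀ B cl av).pull q W).mu ((ezPD m c₀ B cl av).inside (A.hyps.erase c₀) W)) d := by
    refine hd.congr ?_ fun b hb => Or.inr ⟨b, hmem.mp hb, hmu b hb, 1, one_ne_zero, ?_⟩
    · exact Finset.sum_congr (Finset.ext fun b => hmem) fun b hb => (hmu b (hmem.mpr hb)).symm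
    · rw [one_smul]
      exact hq b (PD.mem_pull_t.mp hb).2
  obtain ⟨σ, hσ, hσ0, hd3⟩ := HasExp.of_injective hnp hJ hd2
  refine ⟨d ∘ σ, hd3, ?_⟩
  obtain ⟨b, hb, -⟩ := (mem_flats2.mp hW).exists_ne 0
  obtain ⟨b', hb', hne⟩ := (mem_flats2.mp hW).exists_ne b
  rw [prodNZ_comp hσ hσ0]
  refine hd3.prodNZ_eq_mul hnp (fun x hx => ?_) (hmem.mpr hb) (hmem.mpr hb') hne
  rw [← hmu x hx]
  exact h.mult_pos (PD.mem_pull_t.mp hx).1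

/-- The comparison of local second Betti numbers over a flat of the restriction. -/
lemma prodNZ_le_sum_fiber (h : Adapted A m c₀ B mB L cl av) (hlh : IsLocallyHeavy A m c₀)
    {dA : Submodule K (Fin (n + 1) → K) → Fin (n + 1) → ℕ}
    (hdA : ∀ U ∈ flats2 A, HasExp (locHyps A U) id m (dA U)) {W : Submodule K (Fin n → K)}
    (hW : W ∈ flats2 B) {dB : Fin n → ℕ} (hdB : HasExp (locHyps B W) id mB dB) :
    prodNZ dB ≤ ∑ U ∈ fiber A c₀ L W, prodNZ (dA U) ∧
    (IsFree A m → prodNZ dB = ∑ U ∈ fiber A c₀ L W, prodNZ (dA U)) ∧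
    (prodNZ dB = ∑ U ∈ fiber A c₀ L W, prodNZ (dA U) →
      (ezPD m c₀ B cl av).Good ((ezPD m c₀ B cl av).inside (A.hyps.erase c₀) W)) := by
  have hH := h.heavy hlh
  obtain ⟨J, q, hJ, hq⟩ := exists_coordinates W (mem_flats2.mp hW).1
  obtain ⟨e, he, hdBe⟩ := h.exists_hasExp_pull hW hJ hq hdB
  have hwf := (hH.pull hq).wf
  have hpt : ∀ U, ∃ p : Fin 2 → K, U ∈ fiber A c₀ L W →
      locHyps A U = ((ezPD m c₀ B cl av).pull q W).at'
        ((ezPD m c₀ B cl av).inside (A.hyps.erase c₀) W) p := by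
    intro U
    by_cases hU : U ∈ fiber A c₀ L W
    · obtain ⟨⟨hU2, hcU⟩, rfl⟩ := mem_fiber.mp hU
      obtain ⟨p, hp⟩ := h.exists_point hU2 hcU hq
      exact ⟨p, fun _ => hp⟩
    · exact ⟨0, fun hU' => (hU hU').elim⟩
  choose pt hpt using hpt
  have hinj : ∀ U ∈ fiber A c₀ L W, ∀ U' ∈ fiber A c₀ L W, pt U = pt U' → U = U' := by
    intro U hU U' hU' heq
    have h1 : locHyps A U = locHyps A U' := by rw [hpt U hU, hpt U' hU', heq]
    rw [← (mem_flats2.mp (mem_fiber.mp hU).1.1).2, h1]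
    exact (mem_flats2.mp (mem_fiber.mp hU').1.1).2
  have hex : ∀ U ∈ fiber A c₀ L W, ∃ d' : Fin 2 → ℕ,
      HasExp ((ezPD m c₀ B cl av).pull q W).t ((ezPD m c₀ B cl av).pull q W).β
        (((ezPD m c₀ B cl av).pull q W).mu (((ezPD m c₀ B cl av).pull q W).at'
          ((ezPD m c₀ B cl av).inside (A.hyps.erase c₀) W) (pt U))) d' ∧
      prodNZ (dA U) = d' 0 * d' 1 := by
    intro U hU
    obtain ⟨⟨hU2, hcU⟩, -⟩ := mem_fiber.mp hU
    obtain ⟨c, hc, c', hc', hcm, hcm', hne, -⟩ := h.exists_pair hU2 hcU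
    have hd := hdA U hU2
    have hx : c ∈ locHyps A U := mem_locHyps.mpr ⟨Finset.mem_of_mem_erase hc, hcm⟩
    have hy : c' ∈ locHyps A U := mem_locHyps.mpr ⟨Finset.mem_of_mem_erase hc', hcm'⟩
    rw [hpt U hU] at hd hx hy
    exact hH.hasExp_at' (fun x hx => (h.pos x (Finset.mem_of_mem_erase hx)).ne') hJ hq
      (h.hasExp_cov ((PD.at'_subset _ _ _).trans (PD.inside_subset _ _ _)) hd) hx hy
      fun heq => hne (by rw [heq])
  have hd' : ∀ p, ∃ d' : Fin 2 → ℕ, ∀ U ∈ fiber A c₀ L W, pt U = p →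
      HasExp ((ezPD m c₀ B cl av).pull q W).t ((ezPD m c₀ B cl av).pull q W).β
        (((ezPD m c₀ B cl av).pull q W).mu (((ezPD m c₀ B cl av).pull q W).at'
          ((ezPD m c₀ B cl av).inside (A.hyps.erase c₀) W) p)) d' ∧
      prodNZ (dA U) = d' 0 * d' 1 := by
    intro p
    by_cases hp : ∃ U ∈ fiber A c₀ L W, pt U = p
    · obtain ⟨U, hU, rfl⟩ := hp
      obtain ⟨d', h1⟩ := hex U hU
      exact ⟨d', fun U' hU' heq => by rwa [hinj U' hU' U hU heq]⟩
    · exact ⟨0, fun U hU hUp => (hp ⟨U, hU, hUp⟩).elim⟩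
  choose d' hd' using hd'
  have hcov : ((ezPD m c₀ B cl av).pull q W).Covers
      ((ezPD m c₀ B cl av).inside (A.hyps.erase c₀) W) ((fiber A c₀ L W).image pt) := by
    intro c hc c' hc' hne
    obtain ⟨hcs, hcW⟩ := PD.mem_inside.mp hc
    obtain ⟨hcs', hcW'⟩ := PD.mem_inside.mp hc'
    have hcA := Finset.mem_of_mem_erase hcs
    have hcA' := Finset.mem_of_mem_erase hcs'
    have hU : Submodule.span K {c, c'} ∈ fiber A c₀ L W := by
      refine mem_fiber.mpr ⟨⟨mem_flats2.mpr (isFlatOfRank_span_pair A hcA hcA' ?_),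
        h.c₀_notMem_span_pair hcs hcs' hne⟩, ?_⟩
      · exact fun heq => hne (by rw [heq])
      · rw [h.map_span_pair hcs hcs' hne]
        exact (mem_flats2.mp hW).eq_span_pair (mem_locHyps.mpr ⟨h.cl_mem c hcs, hcW⟩)
          (mem_locHyps.mpr ⟨h.cl_mem c' hcs', hcW'⟩) hne
    have hx : c ∈ locHyps A (Submodule.span K {c, c'}) :=
      mem_locHyps.mpr ⟨hcA, Submodule.subset_span (by simp)⟩
    have hy : c' ∈ locHyps A (Submodule.span K {c, c'}) :=
      mem_locHyps.mpr ⟨hcA', Submodule.subset_span (by simp)⟩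
    rw [hpt _ hU] at hx hy
    exact ⟨_, Finset.mem_image_of_mem _ hU, (PD.mem_at'.mp hx).2, (PD.mem_at'.mp hy).2⟩
  have hsum : ∑ p ∈ (fiber A c₀ L W).image pt, d' p 0 * d' p 1 =
      ∑ U ∈ fiber A c₀ L W, prodNZ (dA U) := by
    rw [Finset.sum_image fun U hU U' hU' => hinj U hU U' hU']
    exact Finset.sum_congr rfl fun U hU => ((hd' _ U hU rfl).2).symm
  obtain ⟨hle, hiff⟩ := hwf.mul_le_sum_and_lead_iff hcov he (d := d') fun p hp => by
    obtain ⟨U, hU, rfl⟩ := Finset.mem_image.mp hp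
    exact (hd' _ U hU rfl).1
  rw [hsum, ← hdBe] at hle hiff
  refine ⟨hle, fun hA => ?_, fun heq => ?_⟩
  · obtain ⟨d, hd⟩ := h.isFree_iff.mp hA
    exact hiff.mp (hwf.lead_of_good (hH.good_pull_of_hasExp hJ hq hd))
  · exact hH.good_of_good_pull hJ hq he (hwf.good_of_lead hcov (hiff.mpr heq))

/-- Freeness from freeness of the restriction and liftability over its flats of rank two. -/
lemma isFree_of_good (h : Adapted A m c₀ B mB L cl av) (hlh : IsLocallyHeavy A m c₀)
    (hB : IsFree B mB) (hG : ∀ W ∈ flats2 B, (ezPD m c₀ B cl av).Good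
      ((ezPD m c₀ B cl av).inside (A.hyps.erase c₀) W)) : IsFree A m := by
  have hH := h.heavy hlh
  obtain ⟨e, he⟩ := h.isFree_restriction_iff.mp hB
  have hgood : (ezPD m c₀ B cl av).Good (A.hyps.erase c₀) := by
    refine hH.wf.good_of_finrank_le_two hH.m0_pos he fun W hW => ?_
    change (ezPD m c₀ B cl av).Good ((ezPD m c₀ B cl av).inside (A.hyps.erase c₀) W)
    by_cases hall : ∀ c ∈ (ezPD m c₀ B cl av).inside (A.hyps.erase c₀) W,
        ∀ c' ∈ (ezPD m c₀ B cl av).inside (A.hyps.erase c₀) W, cl c = cl c'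
    · have hwf := hH.wf.mono (PD.inside_subset (ezPD m c₀ B cl av) (A.hyps.erase c₀) W)
      rcases ((ezPD m c₀ B cl av).inside (A.hyps.erase c₀) W).eq_empty_or_nonempty with
        h0 | ⟨c, hc⟩
      · exact hwf.good_of_forall_cl_eq 0 fun c hc => by simp [h0] at hc
      · exact hwf.good_of_forall_cl_eq (cl c) fun c' hc' => hall c' hc' c hc
    · push Not at hall
      obtain ⟨c, hc, c', hc', hne⟩ := hall
      obtain ⟨hcs, hcW⟩ := PD.mem_inside.mp hc
      obtain ⟨hcs', hcW'⟩ := PD.mem_inside.mp hc'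
      have hfl := isFlatOfRank_span_pair B (h.cl_mem c hcs) (h.cl_mem c' hcs') hne
      have hle : Submodule.span K {cl c, cl c'} ≤ W := by
        refine Submodule.span_le.mpr ?_
        rintro x (rfl | rfl)
        · exact hcW
        · exact hcW'
      have hWeq : Submodule.span K {cl c, cl c'} = W :=
        Submodule.eq_of_le_of_finrank_le hle (hW.trans hfl.1.ge)
      exact hG W (mem_flats2.mpr (hWeq ▸ hfl))
  exact h.isFree_iff.mpr ⟨_, hH.wf.hasExp_of_good hgood he⟩

lemma isFree_restriction (h : Adapted A m c₀ B mB L cl av) (hlh : IsLocallyHeavy A m c₀)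
    (hA : IsFree A m) : IsFree B mB := by
  obtain ⟨d, hd⟩ := h.isFree_iff.mp hA
  obtain ⟨⟨i, -, he⟩, -⟩ := (h.heavy hlh).wf.good_of_hasExp hd
  exact h.isFree_restriction_iff.mpr ⟨_, he⟩

/-- The decomposition of the second Betti number along the restriction. -/
lemma sum_prodNZ_eq (h : Adapted A m c₀ B mB L cl av) (hlh : IsLocallyHeavy A m c₀)
    {d : Submodule K (Fin (n + 1) → K) → Fin (n + 1) → ℕ}
    (hd : ∀ U ∈ flats2 A, HasExp (locHyps A U) id m (d U)) :
    ∑ U ∈ flats2 A, prodNZ (d U) = m c₀ * (msum A m - m c₀) +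
      ∑ W ∈ flats2 B, ∑ U ∈ fiber A c₀ L W, prodNZ (d U) := by
  rw [← Finset.sum_filter_add_sum_filter_not (flats2 A) fun U => c₀ ∈ U,
    h.sum_prodNZ_of_mem hlh hd]
  congr 1
  refine (Finset.sum_fiberwise_of_maps_to (g := Submodule.map (ezTail L))
    (fun U hU => ?_) _).symm
  obtain ⟨h1, h2⟩ := Finset.mem_filter.mp hU
  exact h.map_tail_mem h1 h2

end Adapted

theorem stmt10 {n : ℕ} (A : Arrangement K (n+1)) (m : (Fin (n+1) → K) → ℕ)
    (hm : ∀ c ∈ A.hyps, 0 < m c) (c₀ : Fin (n+1) → K) (hlh : IsLocallyHeavy A m c₀)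
    (B : Arrangement K n) (mB : (Fin n → K) → ℕ) (hres : IsEZRes A m c₀ B mB)
    (bA bB : ℕ) (hbA : IsB2 A m bA) (hbB : IsB2 B mB bB) :
    m c₀ * (msum A m - m c₀) + bB ≤ bA ∧
    (IsFree A m ↔ (IsFree B mB ∧ bA = m c₀ * (msum A m - m c₀) + bB)) := by
  obtain ⟨L, cl, av, h⟩ := hres.exists_adapted hm
  obtain ⟨dA, hdA, rfl⟩ := hbA.exists_sum
  obtain ⟨dB, hdB, rfl⟩ := hbB.exists_sum
  have hloc := fun W hW => h.prodNZ_le_sum_fiber hlh hdA hW (hdB W hW)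
  rw [h.sum_prodNZ_eq hlh hdA]
  refine ⟨Nat.add_le_add_left (Finset.sum_le_sum fun W hW => (hloc W hW).1) _, fun hA => ?_, ?_⟩
  · exact ⟨h.isFree_restriction hlh hA, congrArg _
      (Finset.sum_congr rfl fun W hW => ((hloc W hW).2.1 hA).symm)⟩
  · rintro ⟨hB, heq⟩
    have heq' := (Finset.sum_eq_sum_iff_of_le fun W hW => (hloc W hW).1).mp
      (Nat.add_left_cancel heq).symm
    exact h.isFree_of_good hlh hB fun W hW => (hloc W hW).2.2 (heq' W hW)

end ArrPaper
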